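/- arXiv:2102.11987 — 2 statements merged into one kernel-verified Lean document; each statement's English description precedes it below -/
import Mathlib

section
/- Let H be a real Hilbert space and suppose that C(·) satisfies (H1). Let h : [T0,T] → H be a mapping in L¹([T0,T],H). Then for any x0 ∈ C(T0) there exists a unique absolutely continuous mapping x : [T0,T] → H with x(T0) = x0, x(t) ∈ C(t) for all t ∈ [T0,T], and −x'(t) ∈ N_{C(t)}(x(t)) + h(t) for almost every t ∈ [T0,T]. Moreover this solution satisfies ‖x'(t) + h(t)‖ ≤ ‖h(t)‖ + |υ'(t)| for almost every t ∈ [T0,T]. -/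
open MeasureTheory Set
open scoped RealInnerProductSpace ENNReal Pointwise NNReal

noncomputable section

variable {H : Type*} [NormedAddCommGroup H] [InnerProductSpace ℝ H]

/-- The proximal normal cone of `S` at `x`. -/
def proxNormalCone (S : Set H) (x : H) : Set H :=
  {v | ∃ σ : ℝ, 0 ≤ σ ∧ ∃ δ : ℝ, 0 < δ ∧
    ∀ y ∈ S ∩ Metric.ball x δ, ⟪v, y - x⟫ ≤ σ * ‖y - x‖ ^ 2}

/-- Uniform `r`-prox-regularity, `r ∈ (0, ∞]`. -/
def IsProxRegular (r : ℝ≥0∞) (S : Set H) : Prop :=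
  ∀ x ∈ S, ∀ v ∈ proxNormalCone S x, v ≠ 0 →
    ∀ y ∈ S, ⟪‖v‖⁻¹ • v, y - x⟫ ≤ ((2 * r)⁻¹).toReal * ‖y - x‖ ^ 2

variable [CompleteSpace H]

/-- Absolutely continuous solution of the perturbed sweeping process
`-x'(t) ∈ N_{C(t)}(x(t)) + h(t)`. -/
def IsPerturbedSweepingSol (T0 T : ℝ) (C : ℝ → Set H) (h : ℝ → H)
    (x x' : ℝ → H) : Prop :=
  IntervalIntegrable x' volume T0 T ∧
  (∀ t ∈ Icc T0 T, x t = x T0 + ∫ s in T0..t, x' s) ∧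
  (∀ t ∈ Icc T0 T, x t ∈ C t) ∧
  (∀ᵐ t ∂volume, t ∈ Icc T0 T → (-x' t - h t) ∈ proxNormalCone (C t) (x t))

theorem aux_ii_sub {F : Type*} [NormedAddCommGroup F] {T0 T : ℝ} (hT : T0 ≤ T) {f : ℝ → F}
    (hf : IntervalIntegrable f volume T0 T) :
    ∀ s ∈ Icc T0 T, ∀ t ∈ Icc T0 T, IntervalIntegrable f volume s t := by
  intro s hs t ht
  exact hf.mono_set (by rw [uIcc_of_le hT]; exact (uIcc_subset_Icc hs ht))

theorem aux_ac_of_le {f G : ℝ → ℝ} {a b : ℝ} (hG : AbsolutelyContinuousOnInterval G a b)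
    (hfG : ∀ s ∈ uIcc a b, ∀ t ∈ uIcc a b, |f s - f t| ≤ |G s - G t|) :
    AbsolutelyContinuousOnInterval f a b := by
  rw [absolutelyContinuousOnInterval_iff] at hG ⊢
  intro ε hε
  obtain ⟨δ, hδ, h⟩ := hG ε hε
  refine ⟨δ, hδ, fun E hE hEδ => lt_of_le_of_lt ?_ (h E hE hEδ)⟩
  refine Finset.sum_le_sum fun i hi => ?_
  rw [Real.dist_eq, Real.dist_eq]
  exact hfG _ (hE.1 i hi).1 _ (hE.1 i hi).2

theorem aux_gronwall {E : Type*} [NormedAddCommGroup E] [InnerProductSpace ℝ E] [CompleteSpace E]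
    {T0 T : ℝ} (hT : T0 ≤ T) {u' : ℝ → E} {g : ℝ → ℝ}
    (hu' : IntervalIntegrable u' volume T0 T) (hg : IntervalIntegrable g volume T0 T)
    (hg0 : ∀ t, 0 ≤ g t) {b : ℝ} (hb : 0 ≤ b)
    (hineq : ∀ᵐ t ∂volume, t ∈ Icc T0 T →
      ⟪∫ s in T0..t, u' s, u' t⟫ ≤ g t * (‖∫ s in T0..t, u' s‖ ^ 2 + b)) :
    ∀ t ∈ Icc T0 T, ‖∫ s in T0..t, u' s‖ ^ 2 + b ≤ b * Real.exp (2 * ∫ s in T0..T, g s) := by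
  set u : ℝ → E := fun t => ∫ s in T0..t, u' s with hu
  set G : ℝ → ℝ := fun t => ∫ s in T0..t, g s with hG
  set W : ℝ → ℝ := fun t => ∫ s in T0..t, ‖u' s‖ with hW
  have hI : uIcc T0 T = Icc T0 T := uIcc_of_le hT
  have hT0 : T0 ∈ Icc T0 T := left_mem_Icc.2 hT
  have hGac : AbsolutelyContinuousOnInterval G T0 T :=
    hg.absolutelyContinuousOnInterval_intervalIntegral (by simp)
  have hWac : AbsolutelyContinuousOnInterval W T0 T :=
    hu'.norm.absolutelyContinuousOnInterval_intervalIntegral (by simp)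
  have hudiff : ∀ s ∈ Icc T0 T, ∀ t ∈ Icc T0 T, ‖u s - u t‖ ≤ |W s - W t| := by
    intro s hs t ht
    have e1 : u s - u t = ∫ r in t..s, u' r := by
      simp only [hu]
      exact intervalIntegral.integral_interval_sub_left (aux_ii_sub hT hu' _ hT0 _ hs) (aux_ii_sub hT hu' _ hT0 _ ht)
    have e2 : W s - W t = ∫ r in t..s, ‖u' r‖ := by
      simp only [hW]
      exact intervalIntegral.integral_interval_sub_left (aux_ii_sub hT hu'.norm _ hT0 _ hs)
        (aux_ii_sub hT hu'.norm _ hT0 _ ht)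
    rw [e1, e2]
    exact intervalIntegral.norm_integral_le_abs_integral_norm
  obtain ⟨M, hM⟩ := hWac.exists_bound
  have huM : ∀ t ∈ Icc T0 T, ‖u t‖ ≤ M := by
    intro t ht
    have h1 := hudiff t ht T0 hT0
    have h2 := hM t (hI ▸ ht)
    simp only [hu, hW, intervalIntegral.integral_same, sub_zero] at h1 h2 ⊢
    exact h1.trans h2
  have hM0 : 0 ≤ M := (norm_nonneg _).trans (huM T0 hT0)
  have hG0 : ∀ t ∈ Icc T0 T, 0 ≤ G t := fun t ht =>
    intervalIntegral.integral_nonneg ht.1 fun s _ => hg0 s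
  have hac1 : AbsolutelyContinuousOnInterval (fun t => ‖u t‖ ^ 2 + b) T0 T := by
    refine aux_ac_of_le (hWac.const_mul (2 * M)) ?_
    intro s hs t ht
    rw [hI] at hs ht
    have h1 := hudiff s hs t ht
    have h2 : |‖u s‖ - ‖u t‖| ≤ ‖u s - u t‖ := abs_norm_sub_norm_le _ _
    have h3 : ‖u s‖ ^ 2 + b - (‖u t‖ ^ 2 + b) = (‖u s‖ + ‖u t‖) * (‖u s‖ - ‖u t‖) := by ring
    rw [h3, ← mul_sub, abs_mul, abs_mul, abs_of_nonneg (by positivity : 0 ≤ ‖u s‖ + ‖u t‖),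
      abs_of_nonneg (by positivity : 0 ≤ 2 * M)]
    have := huM s hs
    have := huM t ht
    exact mul_le_mul (by linarith) (h2.trans h1) (abs_nonneg _) (by positivity)
  have hexp : ∀ p q : ℝ, p ≤ q → q ≤ 0 → Real.exp q - Real.exp p ≤ q - p := by
    intro p q hpq hq
    have h1 : Real.exp p = Real.exp q * Real.exp (p - q) := by rw [← Real.exp_add]; ring_nf
    have h2 := Real.add_one_le_exp (p - q)
    have h3 : Real.exp q ≤ 1 := Real.exp_le_one_iff.2 hq
    have h4 := Real.exp_pos q
    rw [h1]
    nlinarith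
  have hac2 : AbsolutelyContinuousOnInterval (fun t => Real.exp (-(2 * G t))) T0 T := by
    refine aux_ac_of_le (hGac.const_mul 2) ?_
    intro s hs t ht
    rw [hI] at hs ht
    have h1 := hG0 s hs
    have h2 := hG0 t ht
    rcases le_total (G s) (G t) with h | h
    · have := hexp (-(2 * G t)) (-(2 * G s)) (by linarith) (by linarith)
      have h5 : Real.exp (-(2 * G t)) ≤ Real.exp (-(2 * G s)) := Real.exp_le_exp.2 (by linarith)
      rw [abs_of_nonneg (by linarith), abs_of_nonpos (by linarith)]
      linarith
    · have := hexp (-(2 * G s)) (-(2 * G t)) (by linarith) (by linarith)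
      have h5 : Real.exp (-(2 * G s)) ≤ Real.exp (-(2 * G t)) := Real.exp_le_exp.2 (by linarith)
      rw [abs_of_nonpos (by linarith), abs_of_nonneg (by linarith)]
      linarith
  have hac := hac1.fun_mul hac2
  have hder1 := hu'.ae_hasDerivAt_integral
  have hder2 := hg.ae_hasDerivAt_integral
  intro t ht
  have hsubI : uIcc T0 t ⊆ uIcc T0 T := by
    rw [hI, uIcc_of_le ht.1]; exact Icc_subset_Icc_right ht.2
  have hFTC := (hac.mono hsubI).integral_deriv_eq_sub
  have hle : ∫ s in T0..t, deriv (fun t => (‖u t‖ ^ 2 + b) * Real.exp (-(2 * G t))) s ≤ 0 := by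
    have : ∫ s in T0..t, deriv (fun t => (‖u t‖ ^ 2 + b) * Real.exp (-(2 * G t))) s
        ≤ ∫ s in T0..t, (0 : ℝ) := by
      refine intervalIntegral.integral_mono_ae_restrict ht.1
        (hac.mono hsubI).intervalIntegrable_deriv (by simp) ?_
      rw [Filter.EventuallyLE, ae_restrict_iff' measurableSet_Icc]
      filter_upwards [hder1, hder2, hineq] with s h1 h2 h3 hs
      have hs' : s ∈ Icc T0 T := ⟨hs.1, hs.2.trans ht.2⟩
      have d1 : HasDerivAt u (u' s) s := h1 (hI ▸ hs') T0 (hI ▸ hT0)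
      have d2 : HasDerivAt G (g s) s := h2 (hI ▸ hs') T0 (hI ▸ hT0)
      have d3 := ((d1.norm_sq).add_const b).mul ((d2.const_mul 2).fun_neg.exp)
      have d4 : deriv (fun t => (‖u t‖ ^ 2 + b) * Real.exp (-(2 * G t))) s = _ := d3.deriv
      rw [d4]
      have h4 : ⟪u s, u' s⟫ ≤ g s * (‖u s‖ ^ 2 + b) := h3 hs'
      have h5 := Real.exp_pos (-(2 * G s))
      nlinarith
    simpa using this
  rw [hFTC] at hle
  have hGt : G t ≤ G T := by
    have : G T - G t = ∫ s in t..T, g s := by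
      simp only [hG]
      exact intervalIntegral.integral_interval_sub_left (aux_ii_sub hT hg _ hT0 _ (right_mem_Icc.2 hT))
        (aux_ii_sub hT hg _ hT0 _ ht)
    have h2 : 0 ≤ ∫ s in t..T, g s := intervalIntegral.integral_nonneg ht.2 fun s _ => hg0 s
    linarith
  have hz : u T0 = 0 := by simp [hu]
  have hz' : G T0 = 0 := by simp [hG]
  simp only [hz, hz', norm_zero] at hle
  simp only [ne_eq, OfNat.ofNat_ne_zero, not_false_eq_true, zero_pow, zero_add, mul_zero, neg_zero,
    Real.exp_zero, mul_one, sub_nonpos] at hle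
  rw [Real.exp_neg, ← div_eq_mul_inv, div_le_iff₀ (Real.exp_pos _)] at hle
  refine hle.trans ?_
  gcongr

open Filter Topology in
theorem aux_dense_proj {E : Type*} [NormedAddCommGroup E] [InnerProductSpace ℝ E] [CompleteSpace E]
    {S : Set E} (hS : IsClosed S) (hne : S.Nonempty) :
    Dense {u : E | ∃ p ∈ S, ‖u - p‖ = Metric.infDist u S} := by
  let Gk : ℕ → Set E := fun k => {u | ∃ η > 0, ∃ y, ∀ w ∈ S, ‖w - u‖ < Metric.infDist u S + η →
    ‖w - y‖ ≤ 1 / ((k : ℝ) + 1)}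
  have hopen : ∀ k, IsOpen (Gk k) := by
    intro k
    rw [Metric.isOpen_iff]
    rintro u ⟨η, hη, y, hy⟩
    refine ⟨η / 4, by positivity, fun u' hu' => ⟨η / 4, by positivity, y, fun w hw hwu => hy w hw ?_⟩⟩
    rw [Metric.mem_ball] at hu'
    have h1 : Metric.infDist u' S ≤ Metric.infDist u S + dist u' u := Metric.infDist_le_infDist_add_dist
    have h2 : ‖w - u‖ ≤ ‖w - u'‖ + dist u' u := by
      rw [dist_eq_norm]; simpa using norm_add_le (w - u') (u' - u)
    linarith
  have hdense : ∀ k, Dense (Gk k) := by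
    intro k
    rw [Metric.dense_iff]
    intro u ε hε
    set d := Metric.infDist u S with hd
    have hd0 : 0 ≤ d := Metric.infDist_nonneg
    set ρ : ℝ := 1 / ((k : ℝ) + 1) with hρ
    have hρ0 : 0 < ρ := by positivity
    obtain ⟨t, ht0, ht1, ht2⟩ : ∃ t : ℝ, 0 < t ∧ t ≤ 1 / 2 ∧ t * (d + 1) < ε := by
      refine ⟨min (1 / 2) (ε / (2 * (d + 1))), by positivity, min_le_left _ _, ?_⟩
      have : min (1 / 2) (ε / (2 * (d + 1))) * (d + 1) ≤ ε / (2 * (d + 1)) * (d + 1) := by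
        gcongr; exact min_le_right _ _
      have h3 : ε / (2 * (d + 1)) * (d + 1) = ε / 2 := by field_simp
      linarith
    obtain ⟨e, he0, he1, he2⟩ : ∃ e : ℝ, 0 < e ∧ e ≤ 1 ∧ e * (4 * d + 4) ≤ t * ρ ^ 2 := by
      refine ⟨min 1 (t * ρ ^ 2 / (4 * d + 4)), by positivity, min_le_left _ _, ?_⟩
      calc _ ≤ t * ρ ^ 2 / (4 * d + 4) * (4 * d + 4) := by gcongr; exact min_le_right _ _
        _ = _ := by field_simp
    obtain ⟨y, hyS, hy⟩ := (Metric.infDist_lt_iff (x := u) (r := d + e) hne).1 (by linarith)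
    rw [dist_eq_norm, norm_sub_rev] at hy
    set a := ‖y - u‖ with ha
    have hda : d ≤ a := by
      have := Metric.infDist_le_dist_of_mem (x := u) hyS
      rwa [dist_eq_norm, norm_sub_rev] at this
    refine ⟨u + t • (y - u), ?_, e, he0, y, ?_⟩
    · rw [Metric.mem_ball, dist_eq_norm, add_sub_cancel_left, norm_smul, Real.norm_of_nonneg ht0.le]
      refine lt_of_le_of_lt ?_ ht2
      gcongr
      linarith
    · intro w hw hwu
      set u1 := u + t • (y - u) with hu1
      have h1 : Metric.infDist u1 S ≤ (1 - t) * a := by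
        have := Metric.infDist_le_dist_of_mem (x := u1) hyS
        rw [dist_eq_norm] at this
        have h2 : u1 - y = (-(1 - t)) • (y - u) := by rw [hu1]; module
        rw [h2, norm_smul, norm_neg, Real.norm_of_nonneg (by linarith)] at this
        exact this
      have h2 : d ≤ ‖w - u‖ := by
        have := Metric.infDist_le_dist_of_mem (x := u) hw
        rwa [dist_eq_norm, norm_sub_rev] at this
      have h3 : ‖w - u1‖ ^ 2 = (1 - t) * ‖w - u‖ ^ 2 + t * ‖w - y‖ ^ 2 - t * (1 - t) * a ^ 2 := by
        have e1 : w - u1 = (w - u) - t • (y - u) := by rw [hu1]; module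
        have e2 : w - y = (w - u) - (y - u) := by abel
        rw [e1, e2, ha, norm_sub_sq_real (w - u), norm_sub_sq_real (w - u), norm_smul, inner_smul_right, mul_pow,
          Real.norm_eq_abs, sq_abs]
        ring
      have h4 : ‖w - u1‖ ≤ (1 - t) * a + e := by linarith
      have h5 : ‖w - u1‖ ^ 2 ≤ ((1 - t) * a + e) ^ 2 := by gcongr
      have h6 : d ^ 2 ≤ ‖w - u‖ ^ 2 := by gcongr
      have h7 : t * ‖w - y‖ ^ 2 ≤ (1 - t) * (a ^ 2 - d ^ 2) + 2 * (1 - t) * a * e + e ^ 2 := by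
        have h8 : (1 - t) * d ^ 2 ≤ (1 - t) * ‖w - u‖ ^ 2 :=
          mul_le_mul_of_nonneg_left h6 (by linarith)
        linear_combination -h3 + h5 + h8
      have h9 : (1 - t) * (a ^ 2 - d ^ 2) ≤ 1 * (e * (2 * d + 1)) := by
        have : a ^ 2 - d ^ 2 ≤ e * (2 * d + 1) := by nlinarith
        have h0 : 0 ≤ a ^ 2 - d ^ 2 := by nlinarith
        exact mul_le_mul (by linarith) this h0 (by norm_num)
      have h10 : 2 * (1 - t) * a * e ≤ 2 * (d + 1) * e := by
        have : (1 - t) * a ≤ 1 * (d + 1) := mul_le_mul (by linarith) (by linarith) (by linarith) (by norm_num)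
        nlinarith
      have h11 : t * ‖w - y‖ ^ 2 ≤ t * ρ ^ 2 := by nlinarith
      have h12 : ‖w - y‖ ^ 2 ≤ ρ ^ 2 := le_of_mul_le_mul_left h11 ht0
      exact (sq_le_sq₀ (norm_nonneg _) hρ0.le).1 h12
  refine (dense_iInter_of_isOpen_nat hopen hdense).mono ?_
  intro u hu
  rw [mem_iInter] at hu
  have hseq : ∀ n : ℕ, ∃ w ∈ S, ‖w - u‖ < Metric.infDist u S + 1 / ((n : ℝ) + 1) := by
    intro n
    obtain ⟨y, hyS, hy⟩ := (Metric.infDist_lt_iff (x := u)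
      (r := Metric.infDist u S + 1 / ((n : ℝ) + 1)) hne).1 (by
        have : (0 : ℝ) < 1 / ((n : ℝ) + 1) := by positivity
        linarith)
    rw [dist_eq_norm, norm_sub_rev] at hy
    exact ⟨y, hyS, hy⟩
  choose w hwS hw using hseq
  have hcau : CauchySeq w := by
    rw [Metric.cauchySeq_iff]
    intro ε hε
    obtain ⟨k, hk⟩ := exists_nat_one_div_lt (half_pos hε)
    obtain ⟨η, hη, y, hy⟩ := hu k
    obtain ⟨N, hN⟩ := exists_nat_one_div_lt hη
    have hh : ∀ m ≥ N, ‖w m - y‖ < ε / 2 := by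
      intro m hm
      refine lt_of_le_of_lt (hy _ (hwS m) ((hw m).trans ?_)) hk
      have : 1 / ((m : ℝ) + 1) ≤ 1 / ((N : ℝ) + 1) := by gcongr
      linarith
    refine ⟨N, fun m hm n hn => ?_⟩
    have h1 := hh m hm
    have h2 := hh n hn
    have h3 := dist_triangle_right (w m) (w n) y
    rw [dist_eq_norm (w m) y, dist_eq_norm (w n) y] at h3
    linarith
  obtain ⟨p, hp⟩ := cauchySeq_tendsto_of_complete hcau
  have hpS : p ∈ S := hS.mem_of_tendsto hp (Eventually.of_forall hwS)
  refine ⟨p, hpS, le_antisymm ?_ ?_⟩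
  · have l1 : Tendsto (fun n => ‖w n - u‖) atTop (𝓝 ‖p - u‖) := (hp.sub_const u).norm
    have l2 : Tendsto (fun n : ℕ => Metric.infDist u S + 1 / ((n : ℝ) + 1)) atTop
        (𝓝 (Metric.infDist u S + 0)) := tendsto_const_nhds.add tendsto_one_div_add_atTop_nhds_zero_nat
    rw [norm_sub_rev]
    have := le_of_tendsto_of_tendsto' l1 l2 fun n => (hw n).le
    simpa using this
  · rw [← dist_eq_norm]
    exact Metric.infDist_le_dist_of_mem hpS

/-- Auxiliary form of prox-regularity. -/
def AuxPR {E : Type*} [NormedAddCommGroup E] [InnerProductSpace ℝ E] (κ : ℝ) (S : Set E) : Prop :=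
  ∀ x ∈ S, ∀ v ∈ proxNormalCone S x, ∀ y ∈ S, ⟪v, y - x⟫ ≤ κ * ‖v‖ * ‖y - x‖ ^ 2

theorem aux_pr_of {E : Type*} [NormedAddCommGroup E] [InnerProductSpace ℝ E] {r : ℝ≥0∞} {S : Set E}
    (h : IsProxRegular r S) : AuxPR ((2 * r)⁻¹).toReal S := by
  intro x hx v hv y hy
  by_cases hv0 : v = 0
  · simp [hv0]
  · have h1 := h x hx v hv hv0 y hy
    have hpos : 0 < ‖v‖ := norm_pos_iff.2 hv0
    rw [real_inner_smul_left] at h1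
    have h2 := mul_le_mul_of_nonneg_left h1 hpos.le
    rw [← mul_assoc, mul_inv_cancel₀ hpos.ne', one_mul] at h2
    linarith

theorem aux_normal_of_nearest {E : Type*} [NormedAddCommGroup E] [InnerProductSpace ℝ E] {S : Set E}
    {u p : E} (hu : ‖u - p‖ = Metric.infDist u S) : u - p ∈ proxNormalCone S p := by
  refine ⟨1 / 2, by norm_num, 1, by norm_num, ?_⟩
  rintro y ⟨hy, -⟩
  have h1 := Metric.infDist_le_dist_of_mem (x := u) hy
  rw [← hu, dist_eq_norm] at h1
  have h2 : u - y = (u - p) - (y - p) := by abel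
  have h3 : ‖u - p‖ ^ 2 ≤ ‖u - y‖ ^ 2 := by gcongr
  rw [h2, norm_sub_sq_real (u - p) (y - p)] at h3
  linarith

open Filter Topology in
theorem aux_exists_proj {E : Type*} [NormedAddCommGroup E] [InnerProductSpace ℝ E] [CompleteSpace E]
    {S : Set E} (hS : IsClosed S) (hne : S.Nonempty) {κ : ℝ} (hκ : 0 ≤ κ) (hPR : AuxPR κ S)
    {ρ : ℝ} (hρ : 2 * κ * ρ < 1) {u : E} (hu : Metric.infDist u S < ρ) :
    ∃ p ∈ S, ‖u - p‖ = Metric.infDist u S := by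
  have hcl := aux_dense_proj hS hne u
  rw [mem_closure_iff_seq_limit] at hcl
  obtain ⟨v, hv, hvu⟩ := hcl
  choose p hpS hp using hv
  have hdist : Tendsto (fun n => Metric.infDist (v n) S) atTop (𝓝 (Metric.infDist u S)) :=
    ((Metric.continuous_infDist_pt S).tendsto u).comp hvu
  have hev := hdist.eventually (gt_mem_nhds hu)
  rw [eventually_atTop] at hev
  obtain ⟨N0, hN0⟩ := hev
  have hcau : CauchySeq p := by
    rw [Metric.cauchySeq_iff]
    intro ε hε
    obtain ⟨N, hN⟩ := Metric.cauchySeq_iff.1 hvu.cauchySeq (ε * (1 - 2 * κ * ρ))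
      (mul_pos hε (by linarith))
    refine ⟨max N N0, fun m hm n hn => ?_⟩
    have h1 := hN m (le_of_max_le_left hm) n (le_of_max_le_left hn)
    have a1 := hPR _ (hpS m) _ (aux_normal_of_nearest (hp m)) _ (hpS n)
    have a2 := hPR _ (hpS n) _ (aux_normal_of_nearest (hp n)) _ (hpS m)
    have b1 : ‖v m - p m‖ ≤ ρ := by rw [hp]; exact (hN0 m (le_of_max_le_right hm)).le
    have b2 : ‖v n - p n‖ ≤ ρ := by rw [hp]; exact (hN0 n (le_of_max_le_right hn)).le
    rw [norm_sub_rev (p n) (p m)] at a1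
    have c1 : κ * ‖v m - p m‖ * ‖p m - p n‖ ^ 2 ≤ κ * ρ * ‖p m - p n‖ ^ 2 := by gcongr
    have c2 : κ * ‖v n - p n‖ * ‖p m - p n‖ ^ 2 ≤ κ * ρ * ‖p m - p n‖ ^ 2 := by gcongr
    have e1 : ⟪v m - v n, p m - p n⟫ =
        ‖p m - p n‖ ^ 2 - ⟪v m - p m, p n - p m⟫ - ⟪v n - p n, p m - p n⟫ := by
      have : v m - v n = (p m - p n) + (v m - p m) - (v n - p n) := by abel
      rw [this, inner_sub_left, inner_add_left, real_inner_self_eq_norm_sq,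
        ← neg_sub (p m) (p n), inner_neg_right]
      ring
    have e2 := real_inner_le_norm (v m - v n) (p m - p n)
    rw [dist_eq_norm] at h1 ⊢
    by_contra hcon
    push Not at hcon
    have e3 : (1 - 2 * κ * ρ) * ‖p m - p n‖ ^ 2 ≤ ‖v m - v n‖ * ‖p m - p n‖ := by linarith
    have hpos : 0 < ‖p m - p n‖ := hε.trans_le hcon
    have e4 : (1 - 2 * κ * ρ) * ‖p m - p n‖ ≤ ‖v m - v n‖ := by
      refine le_of_mul_le_mul_right ?_ hpos
      linarith
    have e5 : (1 - 2 * κ * ρ) * ε ≤ (1 - 2 * κ * ρ) * ‖p m - p n‖ :=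
      mul_le_mul_of_nonneg_left hcon (by linarith)
    linarith
  obtain ⟨q, hq⟩ := cauchySeq_tendsto_of_complete hcau
  refine ⟨q, hS.mem_of_tendsto hq (Eventually.of_forall hpS), ?_⟩
  have l1 := (hvu.sub hq).norm
  simp only [hp] at l1
  exact tendsto_nhds_unique l1 hdist

open Filter Topology in
theorem aux_mazur {X : Type*} [NormedAddCommGroup X] [InnerProductSpace ℝ X] [CompleteSpace X]
    (f : ℕ → X) (M : ℝ) (hM : ∀ n, ‖f n‖ ≤ M) :
    ∃ w : X, ∀ K : Set X, IsClosed K → Convex ℝ K → (∀ᶠ n in atTop, f n ∈ K) → w ∈ K := by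
  let K : ℕ → Set X := fun n => closure (convexHull ℝ (f '' Ici n))
  have hKconv : ∀ n, Convex ℝ (K n) := fun n => (convex_convexHull ℝ _).closure
  have hKne : ∀ n, f n ∈ K n := fun n =>
    subset_closure (subset_convexHull ℝ _ ⟨n, le_refl n, rfl⟩)
  have hKmono : ∀ m n, m ≤ n → K n ⊆ K m := fun m n hmn =>
    closure_mono (convexHull_mono (image_mono (Ici_subset_Ici.2 hmn)))
  have hKmin : ∀ S : Set X, IsClosed S → Convex ℝ S → ∀ n, (∀ m ≥ n, f m ∈ S) → K n ⊆ S := by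
    intro S h1 h2 n h3
    refine closure_minimal (convexHull_min ?_ h2) h1
    rintro _ ⟨m, hm, rfl⟩
    exact h3 m hm
  have hp : ∀ n, ∃ p ∈ K n, ∀ q ∈ K n, ‖q - p‖ ^ 2 ≤ ‖q‖ ^ 2 - ‖p‖ ^ 2 := by
    intro n
    obtain ⟨p, hpK, hp⟩ := exists_norm_eq_iInf_of_complete_convex ⟨_, hKne n⟩
      (isClosed_closure.isComplete) (hKconv n) (0 : X)
    refine ⟨p, hpK, fun q hq => ?_⟩
    have h1 := (norm_eq_iInf_iff_real_inner_le_zero (hKconv n) hpK).1 hp q hq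
    have h2 : ‖q‖ ^ 2 = ‖(q - p) + p‖ ^ 2 := by simp
    rw [norm_add_sq_real (q - p) p] at h2
    rw [zero_sub, inner_neg_left, real_inner_comm] at h1
    linarith
  choose p hpK hp using hp
  have hmono : Monotone (fun n => ‖p n‖ ^ 2) := by
    intro m n hmn
    have := hp m (p n) (hKmono m n hmn (hpK n))
    have h2 := sq_nonneg ‖p n - p m‖
    show ‖p m‖ ^ 2 ≤ ‖p n‖ ^ 2
    linarith
  have hbdd : BddAbove (range fun n => ‖p n‖ ^ 2) := by
    refine ⟨M ^ 2, ?_⟩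
    rintro _ ⟨n, rfl⟩
    have h1 : p n ∈ Metric.closedBall (0 : X) M :=
      hKmin _ Metric.isClosed_closedBall (convex_closedBall _ _) n (fun m _ => by simpa using hM m) (hpK n)
    have h2 : ‖p n‖ ≤ M := by simpa using h1
    show ‖p n‖ ^ 2 ≤ M ^ 2
    gcongr
  have hconv := tendsto_atTop_ciSup hmono hbdd
  have hcau : CauchySeq p := by
    rw [Metric.cauchySeq_iff']
    intro ε hε
    obtain ⟨N, hN⟩ := Metric.cauchySeq_iff'.1 hconv.cauchySeq (ε ^ 2) (by positivity)
    refine ⟨N, fun n hn => ?_⟩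
    have h1 := hN n hn
    have h2 := hp N (p n) (hKmono N n hn (hpK n))
    rw [Real.dist_eq] at h1
    have h3 := (abs_lt.1 h1).2
    rw [dist_eq_norm]
    exact (sq_lt_sq₀ (norm_nonneg _) hε.le).1 (by linarith)
  obtain ⟨w, hw⟩ := cauchySeq_tendsto_of_complete hcau
  refine ⟨w, fun S hS1 hS2 hS3 => ?_⟩
  obtain ⟨n, hn⟩ := eventually_atTop.1 hS3
  refine hKmin S hS1 hS2 n hn ?_
  refine isClosed_closure.mem_of_tendsto hw ?_
  filter_upwards [eventually_ge_atTop n] with m hm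
  exact hKmono n m hm (hpK m)

open Filter Topology in
theorem aux_L2 {α E ι : Type*} [MeasurableSpace α] {μ : Measure α} [IsFiniteMeasure μ]
    [NormedAddCommGroup E] [InnerProductSpace ℝ E] [CompleteSpace E]
    (w : ℕ → α → E) (hw : ∀ n, AEStronglyMeasurable (w n) μ) (hw1 : ∀ n t, ‖w n t‖ ≤ 1)
    (A : ℕ → α → Set E) (hAc : ∀ m t, IsClosed (A m t)) (hAv : ∀ m t, Convex ℝ (A m t))
    (hA : ∀ m, ∀ᶠ n in atTop, ∀ᵐ t ∂μ, w n t ∈ A m t)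
    (s : ι → Set α) (hs : ∀ i, MeasurableSet (s i)) (l : ι → E)
    (hl : ∀ i, Tendsto (fun n => ∫ t in s i, w n t ∂μ) atTop (𝓝 (l i))) :
    ∃ v : α → E, Integrable v μ ∧ (∀ m, ∀ᵐ t ∂μ, v t ∈ A m t) ∧ ∀ i, ∫ t in s i, v t ∂μ = l i := by
  have hLp : ∀ n, MemLp (w n) 2 μ := fun n =>
    MemLp.of_bound (hw n) 1 (Eventually.of_forall (hw1 n))
  let f : ℕ → Lp E 2 μ := fun n => (hLp n).toLp
  have hf : ∀ n, f n =ᵐ[μ] w n := fun n => (hLp n).coeFn_toLp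
  have hbd : ∃ M : ℝ, ∀ n, ‖f n‖ ≤ M := by
    refine ⟨μ.real univ ^ ((2 : ℝ≥0∞).toReal)⁻¹ * 1, fun n => ?_⟩
    refine Lp.norm_le_of_ae_bound zero_le_one ?_
    filter_upwards [hf n] with t ht
    rw [ht]; exact hw1 n t
  obtain ⟨M, hM⟩ := hbd
  obtain ⟨v, hv⟩ := aux_mazur f M hM
  refine ⟨v, (Lp.memLp v).integrable (by norm_num), fun m => ?_, fun i => ?_⟩
  · refine hv {g : Lp E 2 μ | ∀ᵐ t ∂μ, g t ∈ A m t} ?_ ?_ ?_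
    · refine IsSeqClosed.isClosed ?_
      intro g g0 hg hg0
      obtain ⟨ns, -, hns⟩ := (tendstoInMeasure_of_tendsto_Lp hg0).exists_seq_tendsto_ae
      have hg' : ∀ᵐ t ∂μ, ∀ n, g n t ∈ A m t := ae_all_iff.2 hg
      show ∀ᵐ t ∂μ, g0 t ∈ A m t
      filter_upwards [hns, hg'] with t h1 h2
      exact (hAc m t).mem_of_tendsto h1 (Eventually.of_forall fun n => h2 _)
    · intro g hg g' hg' a b ha hb hab
      show ∀ᵐ t ∂μ, (a • g + b • g' : Lp E 2 μ) t ∈ A m t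
      have hg1 : ∀ᵐ t ∂μ, g t ∈ A m t := hg
      have hg2 : ∀ᵐ t ∂μ, g' t ∈ A m t := hg'
      filter_upwards [hg1, hg2, Lp.coeFn_add (a • g) (b • g'), Lp.coeFn_smul a g,
        Lp.coeFn_smul b g'] with t h1 h2 h3 h4 h5
      rw [h3, Pi.add_apply, h4, h5]
      exact hAv m t h1 h2 ha hb hab
    · filter_upwards [hA m] with n hn
      show ∀ᵐ t ∂μ, f n t ∈ A m t
      filter_upwards [hf n, hn] with t h1 h2
      rw [h1]; exact h2
  · refine ext_inner_left ℝ fun e => ?_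
    have key : ∀ g : Lp E 2 μ, ⟪indicatorConstLp 2 (hs i) (measure_ne_top μ _) e, g⟫ =
        ⟪e, ∫ t in s i, g t ∂μ⟫ := fun g =>
      L2.inner_indicatorConstLp_eq_inner_setIntegral ℝ (hs i) (measure_ne_top μ _) e g
    refine eq_of_forall_dist_le fun ε hε => ?_
    have := hv ((innerSL ℝ (indicatorConstLp 2 (hs i) (measure_ne_top μ _) e : Lp E 2 μ)) ⁻¹'
      Metric.closedBall (⟪e, l i⟫) ε) (Metric.isClosed_closedBall.preimage (by fun_prop))
      ((convex_closedBall _ _).is_linear_preimage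
        (LinearMap.isLinear (innerSL ℝ (indicatorConstLp 2 (hs i) (measure_ne_top μ _) e : Lp E 2 μ)).toLinearMap)) ?_
    · rw [mem_preimage, innerSL_apply_apply, key] at this
      exact this
    · have h1 : Tendsto (fun n => ⟪e, ∫ t in s i, w n t ∂μ⟫) atTop (𝓝 ⟪e, l i⟫) :=
        tendsto_const_nhds.inner (hl i)
      filter_upwards [h1.eventually (Metric.closedBall_mem_nhds _ hε)] with n hn
      rw [mem_preimage, innerSL_apply_apply, key]
      rw [setIntegral_congr_ae (hs i) ((hf n).mono fun t ht _ => ht)]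
      exact hn

/-- Approximate solutions of the sweeping process on `[T0, τ]`. -/
def AuxApprox {E : Type*} [NormedAddCommGroup E] [InnerProductSpace ℝ E] (T0 : ℝ) (g : ℝ → ℝ)
    (κ : ℝ) (D : ℝ → Set E) (z0 : E) (ε τ : ℝ) (w : ℝ → E) : Prop :=
  StronglyMeasurable w ∧ (∀ t, ‖w t‖ ≤ 1) ∧ (z0 + ∫ s in T0..τ, g s • w s) ∈ D τ ∧
  ∀ t ∈ Ioc T0 τ, (∃ y ∈ D t, ‖(z0 + ∫ s in T0..t, g s • w s) - y‖ ≤ ε) ∧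
    ∀ y ∈ D t, ⟪-w t, y - (z0 + ∫ s in T0..t, g s • w s)⟫ ≤
      κ * (‖y - (z0 + ∫ s in T0..t, g s • w s)‖ + ε) ^ 2 + ε

theorem aux_ii_smul {E : Type*} [NormedAddCommGroup E] [InnerProductSpace ℝ E] {a b : ℝ}
    {g : ℝ → ℝ} {w : ℝ → E} (hg : IntervalIntegrable g volume a b) (hw : StronglyMeasurable w)
    (hw1 : ∀ t, ‖w t‖ ≤ 1) : IntervalIntegrable (fun t => g t • w t) volume a b := by
  refine hg.mono_fun (hg.def'.aestronglyMeasurable.smul hw.aestronglyMeasurable) ?_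
  refine Filter.Eventually.of_forall fun t => ?_
  show ‖g t • w t‖ ≤ ‖g t‖
  rw [norm_smul]
  exact mul_le_of_le_one_right (norm_nonneg _) (hw1 t)

theorem aux_step {E : Type*} [NormedAddCommGroup E] [InnerProductSpace ℝ E] [CompleteSpace E]
    {T0 T : ℝ} (hT : T0 ≤ T) {g : ℝ → ℝ} (hg : IntervalIntegrable g volume T0 T)
    (hg0 : ∀ t, 0 ≤ g t) {κ : ℝ} (hκ : 0 ≤ κ) {D : ℝ → Set E}
    (hD : ∀ t ∈ Icc T0 T, (D t).Nonempty ∧ IsClosed (D t) ∧ AuxPR κ (D t))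
    (hmove : ∀ s ∈ Icc T0 T, ∀ t ∈ Icc T0 T, s ≤ t →
      (∀ y ∈ D t, ∃ y' ∈ D s, ‖y - y'‖ ≤ ∫ r in s..t, g r) ∧
      (∀ y ∈ D s, ∃ y' ∈ D t, ‖y - y'‖ ≤ ∫ r in s..t, g r))
    {z0 : E} {ε : ℝ} (hε : 0 < ε) (hκε : 2 * κ * ε < 1) {s s' : ℝ} (hs : s ∈ Icc T0 T)
    (hs' : s' ∈ Icc T0 T) (hss : s ≤ s') (hΔ : ∫ r in s..s', g r ≤ ε / 2) {w : ℝ → E}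
    (hw : AuxApprox T0 g κ D z0 ε s w) : ∃ v, AuxApprox T0 g κ D z0 ε s' v := by
  obtain ⟨hwm, hw1, hwD, hwI⟩ := hw
  have hT0 : T0 ∈ Icc T0 T := left_mem_Icc.2 hT
  set Δ := ∫ r in s..s', g r with hΔdef
  have hΔ0 : 0 ≤ Δ := intervalIntegral.integral_nonneg hss fun _ _ => hg0 _
  set zs := z0 + ∫ r in T0..s, g r • w r with hzs
  have hinf : Metric.infDist zs (D s') ≤ Δ := by
    obtain ⟨y', hy', hy⟩ := (hmove s hs s' hs' hss).2 zs hwD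
    refine (Metric.infDist_le_dist_of_mem hy').trans ?_
    rwa [dist_eq_norm]
  obtain ⟨hne, hcl, hpr⟩ := hD s' hs'
  obtain ⟨p, hpD, hp⟩ := aux_exists_proj hcl hne hκ hpr hκε (u := zs) (by linarith)
  have hpn : ‖p - zs‖ ≤ Δ := by rw [norm_sub_rev, hp]; exact hinf
  have hcone := aux_normal_of_nearest hp
  set c : E := Δ⁻¹ • (p - zs) with hc
  have hΔc : Δ • c = p - zs := by
    by_cases h0 : Δ = 0
    · rw [h0] at hpn
      have : p - zs = 0 := norm_le_zero_iff.1 hpn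
      rw [hc, this]; simp
    · rw [hc, smul_smul, mul_inv_cancel₀ h0, one_smul]
  have hc1 : ‖c‖ ≤ 1 := by
    rw [hc, norm_smul, norm_inv, Real.norm_of_nonneg hΔ0]
    rcases eq_or_lt_of_le hΔ0 with h0 | h0
    · rw [← h0]; simp
    · rw [inv_mul_le_iff₀ h0]; linarith
  have hcn : ∀ y ∈ D s', ⟪-c, y - p⟫ ≤ κ * ‖y - p‖ ^ 2 := by
    intro y hy
    have h1 := hpr p hpD _ hcone y hy
    have h2 : -c = Δ⁻¹ • (zs - p) := by rw [hc, ← smul_neg, neg_sub]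
    have h3 : Δ⁻¹ * ⟪zs - p, y - p⟫ ≤ Δ⁻¹ * (κ * ‖zs - p‖ * ‖y - p‖ ^ 2) :=
      mul_le_mul_of_nonneg_left h1 (inv_nonneg.2 hΔ0)
    have h4 : Δ⁻¹ * (κ * ‖zs - p‖ * ‖y - p‖ ^ 2) = ‖c‖ * (κ * ‖y - p‖ ^ 2) := by
      rw [hc, norm_smul, norm_inv, Real.norm_of_nonneg hΔ0, norm_sub_rev p zs]; ring
    rw [h2, real_inner_smul_left]
    refine h3.trans (h4.le.trans ?_)
    exact mul_le_of_le_one_left (by positivity) hc1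
  let v : ℝ → E := fun t => if t ≤ s then w t else c
  have hvm : StronglyMeasurable v :=
    StronglyMeasurable.ite measurableSet_Iic hwm stronglyMeasurable_const
  have hv1 : ∀ t, ‖v t‖ ≤ 1 := by
    intro t
    by_cases h : t ≤ s
    · simp only [v, if_pos h]; exact hw1 t
    · simp only [v, if_neg h]; exact hc1
  have hz1 : ∀ t ∈ Icc T0 s, (∫ r in T0..t, g r • v r) = ∫ r in T0..t, g r • w r := by
    intro t ht
    refine intervalIntegral.integral_congr fun r hr => ?_
    rw [uIcc_of_le ht.1] at hr
    simp only [v, if_pos (hr.2.trans ht.2)]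
  have hvint := aux_ii_smul hg hvm hv1
  have hz2 : ∀ t ∈ Icc s s', z0 + (∫ r in T0..t, g r • v r) = zs + (∫ r in s..t, g r) • c := by
    intro t ht
    have htI : t ∈ Icc T0 T := ⟨hs.1.trans ht.1, ht.2.trans hs'.2⟩
    rw [← intervalIntegral.integral_add_adjacent_intervals (aux_ii_sub hT hvint _ hT0 _ hs)
      (aux_ii_sub hT hvint _ hs _ htI), hz1 s ⟨hs.1, le_refl _⟩, ← add_assoc,
      ← intervalIntegral.integral_smul_const]
    congr 1
    refine intervalIntegral.integral_congr_ae (Filter.Eventually.of_forall fun r hr => ?_)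
    rw [uIoc_of_le ht.1] at hr
    simp only [v, if_neg (not_le.2 hr.1)]
  refine ⟨v, hvm, hv1, ?_, ?_⟩
  · rw [hz2 s' ⟨hss, le_refl _⟩, ← hΔdef, hΔc]
    simpa using hpD
  · intro t ht
    by_cases hts : t ≤ s
    · have h1 := hwI t ⟨ht.1, hts⟩
      rw [hz1 t ⟨ht.1.le, hts⟩]
      simp only [v, if_pos hts]
      exact h1
    · have hts' := not_le.1 hts
      have htI : t ∈ Icc T0 T := ⟨ht.1.le, ht.2.trans hs'.2⟩
      rw [hz2 t ⟨hts'.le, ht.2⟩]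
      simp only [v, if_neg hts]
      set zt := zs + (∫ r in s..t, g r) • c with hzt
      have hadd : (∫ r in s..t, g r) + (∫ r in t..s', g r) = Δ :=
        intervalIntegral.integral_add_adjacent_intervals (aux_ii_sub hT hg _ hs _ htI)
          (aux_ii_sub hT hg _ htI _ hs')
      set β := ∫ r in t..s', g r with hβ
      have hβ0 : 0 ≤ β := intervalIntegral.integral_nonneg ht.2 fun _ _ => hg0 _
      have hα0 : 0 ≤ ∫ r in s..t, g r := intervalIntegral.integral_nonneg hts'.le fun _ _ => hg0 _
      have hβε : β ≤ ε / 2 := by linarith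
      have hpz : p - zt = β • c := by
        have : p = zs + Δ • c := by rw [hΔc]; abel
        rw [this, hzt, ← hadd]; module
      have hpzn : ‖p - zt‖ ≤ ε / 2 := by
        rw [hpz, norm_smul, Real.norm_of_nonneg hβ0]
        exact (mul_le_of_le_one_right hβ0 hc1).trans hβε
      obtain ⟨m1, m2⟩ := hmove t htI s' hs' ht.2
      constructor
      · obtain ⟨y, hy, hyn⟩ := m1 p hpD
        refine ⟨y, hy, ?_⟩
        have h1 : zt - y = (p - y) - (p - zt) := by abel
        rw [h1]
        refine (norm_sub_le _ _).trans ?_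
        linarith
      · intro y hy
        obtain ⟨y', hy', hyn⟩ := m2 y hy
        have h1 := hcn y' hy'
        have h2 : y - zt = (y' - p) + ((y - y') + (p - zt)) := by abel
        have h3 : ‖(y - y') + (p - zt)‖ ≤ ε := (norm_add_le _ _).trans (by linarith)
        have h4 : ⟪-c, (y - y') + (p - zt)⟫ ≤ ε := by
          refine (real_inner_le_norm _ _).trans ?_
          rw [norm_neg]
          exact (mul_le_of_le_one_left (norm_nonneg _) hc1).trans h3
        have h5 : ‖y' - p‖ ≤ ‖y - zt‖ + ε := by
          have : y' - p = (y - zt) - ((y - y') + (p - zt)) := by abel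
          rw [this]
          exact (norm_sub_le _ _).trans (by linarith)
        have h6 : ‖y' - p‖ ^ 2 ≤ (‖y - zt‖ + ε) ^ 2 := by gcongr
        have h7 := mul_le_mul_of_nonneg_left h6 hκ
        have h8 : ⟪-c, y - zt⟫ = ⟪-c, y' - p⟫ + ⟪-c, (y - y') + (p - zt)⟫ := by
          rw [h2, inner_add_right]
        linarith

theorem aux_exists_approx {E : Type*} [NormedAddCommGroup E] [InnerProductSpace ℝ E]
    [CompleteSpace E]
    {T0 T : ℝ} (hT : T0 ≤ T) {g : ℝ → ℝ} (hg : IntervalIntegrable g volume T0 T)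
    (hg0 : ∀ t, 0 ≤ g t) {κ : ℝ} (hκ : 0 ≤ κ) {D : ℝ → Set E}
    (hD : ∀ t ∈ Icc T0 T, (D t).Nonempty ∧ IsClosed (D t) ∧ AuxPR κ (D t))
    (hmove : ∀ s ∈ Icc T0 T, ∀ t ∈ Icc T0 T, s ≤ t →
      (∀ y ∈ D t, ∃ y' ∈ D s, ‖y - y'‖ ≤ ∫ r in s..t, g r) ∧
      (∀ y ∈ D s, ∃ y' ∈ D t, ‖y - y'‖ ≤ ∫ r in s..t, g r))
    {z0 : E} (hz0 : z0 ∈ D T0) {ε : ℝ} (hε : 0 < ε) (hκε : 2 * κ * ε < 1) :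
    ∃ w, AuxApprox T0 g κ D z0 ε T w := by
  have hT0 : T0 ∈ Icc T0 T := left_mem_Icc.2 hT
  have hac : AbsolutelyContinuousOnInterval (fun t => ∫ s in T0..t, g s) T0 T :=
    hg.absolutelyContinuousOnInterval_intervalIntegral (by simp)
  obtain ⟨δ, hδ, hunif⟩ := Metric.uniformContinuousOn_iff.1 hac.uniformContinuousOn (ε / 2)
    (by positivity)
  rw [uIcc_of_le hT] at hunif
  have hmain : ∀ n : ℕ, ∀ τ ∈ Icc T0 T, τ ≤ T0 + n * (δ / 2) →
      ∃ w, AuxApprox T0 g κ D z0 ε τ w := by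
    intro n
    induction n with
    | zero =>
      intro τ hτ hτ'
      have : τ = T0 := le_antisymm (by simpa using hτ') hτ.1
      subst this
      refine ⟨fun _ => 0, stronglyMeasurable_const, by simp, by simpa using hz0, ?_⟩
      intro t ht
      exact absurd ht.2 (not_le.2 ht.1)
    | succ n ih =>
      intro τ hτ hτ'
      have hs : max T0 (τ - δ / 2) ∈ Icc T0 T :=
        ⟨le_max_left _ _, max_le hT (by linarith [hτ.2])⟩
      obtain ⟨w, hw⟩ := ih (max T0 (τ - δ / 2)) hs (by
        refine max_le ?_ ?_
        · have : 0 ≤ (n : ℝ) * (δ / 2) := by positivity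
          linarith
        · push_cast at hτ'; linarith)
      refine aux_step hT hg hg0 hκ hD hmove hε hκε hs hτ (max_le hτ.1 (by linarith)) ?_ hw
      have h1 := hunif τ hτ _ hs (by
        rw [Real.dist_eq, abs_lt]
        have h2 := le_max_right T0 (τ - δ / 2)
        have h3 : max T0 (τ - δ / 2) ≤ τ := max_le hτ.1 (by linarith)
        constructor <;> linarith)
      rw [Real.dist_eq, intervalIntegral.integral_interval_sub_left (aux_ii_sub hT hg _ hT0 _ hτ)
        (aux_ii_sub hT hg _ hT0 _ hs)] at h1
      exact (le_abs_self _).trans h1.le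
  obtain ⟨n, hn⟩ := exists_nat_ge ((T - T0) / (δ / 2))
  refine hmain n T (right_mem_Icc.2 hT) ?_
  rw [div_le_iff₀ (by positivity)] at hn
  linarith

theorem aux_approx_mono {E : Type*} [NormedAddCommGroup E] [InnerProductSpace ℝ E] {T0 : ℝ}
    {g : ℝ → ℝ} {κ : ℝ} (hκ : 0 ≤ κ) {D : ℝ → Set E} {z0 : E} {ε ε' τ : ℝ} (hε : 0 ≤ ε)
    (hεε : ε ≤ ε') {w : ℝ → E}
    (hw : AuxApprox T0 g κ D z0 ε τ w) : AuxApprox T0 g κ D z0 ε' τ w := by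
  obtain ⟨h1, h2, h3, h4⟩ := hw
  refine ⟨h1, h2, h3, fun t ht => ?_⟩
  obtain ⟨⟨y, hy, hyn⟩, h5⟩ := h4 t ht
  refine ⟨⟨y, hy, hyn.trans hεε⟩, fun y hy => (h5 y hy).trans ?_⟩
  gcongr

theorem aux_approx_close {E : Type*} [NormedAddCommGroup E] [InnerProductSpace ℝ E]
    [CompleteSpace E]
    {T0 T : ℝ} (hT : T0 ≤ T) {g : ℝ → ℝ} (hg : IntervalIntegrable g volume T0 T)
    (hg0 : ∀ t, 0 ≤ g t) {κ : ℝ} (hκ : 0 ≤ κ) {D : ℝ → Set E} {z0 : E} {ε : ℝ} (hε : 0 < ε)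
    (hε1 : ε ≤ 1) {w v : ℝ → E} (hw : AuxApprox T0 g κ D z0 ε T w)
    (hv : AuxApprox T0 g κ D z0 ε T v) :
    ∀ t ∈ Icc T0 T, ‖(z0 + ∫ s in T0..t, g s • w s) - (z0 + ∫ s in T0..t, g s • v s)‖ ^ 2 ≤
      4 * ε * Real.exp (2 * ∫ s in T0..T, (4 * κ + 1) * g s) := by
  obtain ⟨hwm, hw1, -, hwI⟩ := hw
  obtain ⟨hvm, hv1, -, hvI⟩ := hv
  have hT0 : T0 ∈ Icc T0 T := left_mem_Icc.2 hT
  have iw := aux_ii_smul hg hwm hw1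
  have iv := aux_ii_smul hg hvm hv1
  have hdiff : ∀ t ∈ Icc T0 T, (z0 + ∫ s in T0..t, g s • w s) - (z0 + ∫ s in T0..t, g s • v s) =
      ∫ s in T0..t, (g s • w s - g s • v s) := by
    intro t ht
    rw [intervalIntegral.integral_sub (aux_ii_sub hT iw _ hT0 _ ht) (aux_ii_sub hT iv _ hT0 _ ht)]
    abel
  have key := aux_gronwall hT (u' := fun s => g s • w s - g s • v s)
    (g := fun s => (4 * κ + 1) * g s) (iw.sub iv) (hg.const_mul _)
    (fun t => mul_nonneg (by positivity) (hg0 t)) (b := 4 * ε) (by positivity) ?_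
  · intro t ht
    have := key t ht
    rw [hdiff t ht]
    linarith
  · have hne : ∀ᵐ t ∂(volume : Measure ℝ), t ≠ T0 := by
      simp [ae_iff]
    filter_upwards [hne] with t htne ht
    have htI : t ∈ Ioc T0 T := ⟨lt_of_le_of_ne ht.1 (Ne.symm htne), ht.2⟩
    rw [← hdiff t ht]
    obtain ⟨⟨y1, hy1, hn1⟩, k1⟩ := hwI t htI
    obtain ⟨⟨y2, hy2, hn2⟩, k2⟩ := hvI t htI
    set z := z0 + ∫ s in T0..t, g s • w s
    set x := z0 + ∫ s in T0..t, g s • v s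
    have gen : ∀ (a b y c : E), ‖c‖ ≤ 1 → ‖b - y‖ ≤ ε →
        ⟪-c, y - a⟫ ≤ κ * (‖y - a‖ + ε) ^ 2 + ε →
        ⟪-c, b - a⟫ ≤ κ * (‖b - a‖ + 2 * ε) ^ 2 + 2 * ε := by
      intro a b y c hc hby hin
      have e1 : b - a = (y - a) + (b - y) := by abel
      have e2 : ⟪-c, b - y⟫ ≤ ε := by
        refine (real_inner_le_norm _ _).trans ?_
        rw [norm_neg]
        exact (mul_le_of_le_one_left (norm_nonneg _) hc).trans hby
      have e3 : ‖y - a‖ ≤ ‖b - a‖ + ε := by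
        have : y - a = (b - a) - (b - y) := by abel
        rw [this]
        exact (norm_sub_le _ _).trans (by linarith)
      have e4 : (‖y - a‖ + ε) ^ 2 ≤ (‖b - a‖ + 2 * ε) ^ 2 :=
        pow_le_pow_left₀ (by positivity) (by linarith) 2
      have e5 := mul_le_mul_of_nonneg_left e4 hκ
      have e6 : ⟪-c, b - a⟫ = ⟪-c, y - a⟫ + ⟪-c, b - y⟫ := by rw [e1, inner_add_right]
      linarith
    have a1 := gen z x y2 (w t) (hw1 t) hn2 (k1 y2 hy2)
    have a2 := gen x z y1 (v t) (hv1 t) hn1 (k2 y1 hy1)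
    rw [norm_sub_rev x z] at a1
    have e1 : ⟪z - x, g t • w t - g t • v t⟫ = g t * (⟪-w t, x - z⟫ + ⟪-v t, z - x⟫) := by
      rw [← smul_sub, inner_smul_right, ← neg_sub z x, inner_neg_neg, inner_neg_left,
        inner_sub_right, real_inner_comm (w t), real_inner_comm (v t)]
      ring
    rw [e1]
    have e2 : ⟪-w t, x - z⟫ + ⟪-v t, z - x⟫ ≤ (4 * κ + 1) * (‖z - x‖ ^ 2 + 4 * ε) := by
      have f1 : (‖z - x‖ + 2 * ε) ^ 2 ≤ 2 * ‖z - x‖ ^ 2 + 8 * ε := by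
        nlinarith [sq_nonneg (‖z - x‖ - 2 * ε)]
      have f2 := mul_le_mul_of_nonneg_left f1 hκ
      nlinarith [sq_nonneg ‖z - x‖]
    calc _ ≤ g t * ((4 * κ + 1) * (‖z - x‖ ^ 2 + 4 * ε)) := mul_le_mul_of_nonneg_left e2 (hg0 t)
      _ = _ := by ring

open Filter Topology in
theorem aux_exists_sol {E : Type*} [NormedAddCommGroup E] [InnerProductSpace ℝ E]
    [CompleteSpace E]
    {T0 T : ℝ} (hT : T0 ≤ T) {g : ℝ → ℝ} (hg : IntervalIntegrable g volume T0 T)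
    (hg0 : ∀ t, 0 ≤ g t) {κ : ℝ} (hκ : 0 ≤ κ) {D : ℝ → Set E}
    (hD : ∀ t ∈ Icc T0 T, (D t).Nonempty ∧ IsClosed (D t) ∧ AuxPR κ (D t))
    (hmove : ∀ s ∈ Icc T0 T, ∀ t ∈ Icc T0 T, s ≤ t →
      (∀ y ∈ D t, ∃ y' ∈ D s, ‖y - y'‖ ≤ ∫ r in s..t, g r) ∧
      (∀ y ∈ D s, ∃ y' ∈ D t, ‖y - y'‖ ≤ ∫ r in s..t, g r))
    {z0 : E} (hz0 : z0 ∈ D T0) :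
    ∃ z z' : ℝ → E, IntervalIntegrable z' volume T0 T ∧
      (∀ t ∈ Icc T0 T, z t = z0 + ∫ s in T0..t, z' s) ∧ (∀ t ∈ Icc T0 T, z t ∈ D t) ∧
      ∀ᵐ t ∂volume, t ∈ Icc T0 T → -z' t ∈ proxNormalCone (D t) (z t) ∧ ‖z' t‖ ≤ g t := by
  have hT0 : T0 ∈ Icc T0 T := left_mem_Icc.2 hT
  let e : ℕ → ℝ := fun n => 1 / (2 * κ + 1) * (1 / ((n : ℝ) + 1))
  have he0 : ∀ n, 0 < e n := fun n => by positivity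
  have heanti : ∀ m n, m ≤ n → e n ≤ e m := by
    intro m n hmn
    simp only [e]
    gcongr
  have hee0 : e 0 = 1 / (2 * κ + 1) := by simp [e]
  have he1 : ∀ n, e n ≤ 1 := by
    intro n
    refine (heanti 0 n (Nat.zero_le _)).trans ?_
    rw [hee0, div_le_one (by positivity)]
    linarith
  have heκ : ∀ n, 2 * κ * e n < 1 := by
    intro n
    have h1 : 2 * κ * e n ≤ 2 * κ * e 0 := by
      have := heanti 0 n (Nat.zero_le _)
      gcongr
    refine lt_of_le_of_lt h1 ?_
    rw [hee0, mul_one_div, div_lt_one (by positivity)]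
    linarith
  have hetend : Tendsto e atTop (𝓝 0) := by
    have := (tendsto_one_div_add_atTop_nhds_zero_nat (𝕜 := ℝ)).const_mul (1 / (2 * κ + 1))
    simpa only [mul_zero] using this
  have hex := fun n => aux_exists_approx hT hg hg0 hκ hD hmove hz0 (he0 n) (heκ n)
  choose w hw using hex
  set K : ℝ := 4 * Real.exp (2 * ∫ s in T0..T, (4 * κ + 1) * g s) with hK
  have hK0 : 0 < K := by positivity
  let zz : ℕ → ℝ → E := fun n t => z0 + ∫ s in T0..t, g s • w n s
  let η : ℕ → ℝ := fun n => Real.sqrt (K * e n)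
  have hη : Tendsto η atTop (𝓝 0) := by
    have h1 : Tendsto (fun n => K * e n) atTop (𝓝 0) := by simpa using hetend.const_mul K
    have h2 := (Real.continuous_sqrt.tendsto 0).comp h1
    rw [Real.sqrt_zero] at h2
    exact h2
  have hclose : ∀ N, ∀ m ≥ N, ∀ n ≥ N, ∀ t ∈ Icc T0 T, ‖zz m t - zz n t‖ ≤ η N := by
    intro N m hm n hn t ht
    have h1 := aux_approx_close hT hg hg0 hκ (he0 N) (he1 N)
      (aux_approx_mono hκ (he0 m).le (heanti N m hm) (hw m))
      (aux_approx_mono hκ (he0 n).le (heanti N n hn) (hw n)) t ht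
    refine Real.le_sqrt_of_sq_le (h1.trans (le_of_eq ?_))
    rw [hK]; ring
  have hlim : ∀ t, ∃ l, t ∈ Icc T0 T → Tendsto (fun n => zz n t) atTop (𝓝 l) := by
    intro t
    by_cases ht : t ∈ Icc T0 T
    · have : CauchySeq fun n => zz n t := by
        rw [Metric.cauchySeq_iff]
        intro ε hε
        obtain ⟨N, hN⟩ := (hη.eventually (gt_mem_nhds hε)).exists
        refine ⟨N, fun m hm n hn => ?_⟩
        rw [dist_eq_norm]
        exact (hclose N m hm n hn t ht).trans_lt hN
      obtain ⟨l, hl⟩ := cauchySeq_tendsto_of_complete this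
      exact ⟨l, fun _ => hl⟩
    · exact ⟨0, fun h => absurd h ht⟩
  choose z hz using hlim
  have hzclose : ∀ n, ∀ t ∈ Icc T0 T, ‖z t - zz n t‖ ≤ η n := by
    intro n t ht
    refine le_of_tendsto ((hz t ht).sub_const (zz n t)).norm ?_
    filter_upwards [eventually_ge_atTop n] with m hm
    exact hclose n m hm n le_rfl t ht
  have hzT0 : z T0 = z0 := by
    refine tendsto_nhds_unique (hz T0 hT0) ?_
    simp [zz]
  have hzD : ∀ t ∈ Icc T0 T, z t ∈ D t := by
    intro t ht
    rcases eq_or_lt_of_le ht.1 with h | h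
    · rw [← h, hzT0]; exact hz0
    · have hy := fun n => ((hw n).2.2.2 t ⟨h, ht.2⟩).1
      choose y hyD hyn using hy
      refine (hD t ht).2.1.mem_of_tendsto (f := y) (b := atTop) ?_ (Eventually.of_forall hyD)
      have h1 : Tendsto (fun n => zz n t - y n) atTop (𝓝 0) :=
        squeeze_zero_norm hyn hetend
      have h2 := (hz t ht).sub h1
      simpa using h2
  let A : ℕ → ℝ → Set E := fun m t => {v | ‖v‖ ≤ 1 ∧ ∀ y ∈ D t,
    ⟪-v, y - z t⟫ ≤ κ * (‖y - z t‖ + 1 / ((m : ℝ) + 1)) ^ 2 + 1 / ((m : ℝ) + 1)}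
  have hAeq : ∀ m t, A m t = Metric.closedBall (0 : E) 1 ∩ ⋂ y ∈ D t, {v |
    ⟪-v, y - z t⟫ ≤ κ * (‖y - z t‖ + 1 / ((m : ℝ) + 1)) ^ 2 + 1 / ((m : ℝ) + 1)} := by
    intro m t
    ext v
    simp [A]
  have hAc : ∀ m t, IsClosed (A m t) := by
    intro m t
    rw [hAeq]
    refine Metric.isClosed_closedBall.inter (isClosed_biInter fun y _ => ?_)
    exact isClosed_le (by fun_prop) continuous_const
  have hAv : ∀ m t, Convex ℝ (A m t) := by
    intro m t v1 h1 v2 h2 a b ha hb hab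
    refine ⟨?_, fun y hy => ?_⟩
    · have := (convex_closedBall (0 : E) 1) (x := v1) (by simpa using h1.1) (y := v2)
        (by simpa using h2.1) ha hb hab
      simpa using this
    · have e1 := mul_le_mul_of_nonneg_left (h1.2 y hy) ha
      have e2 := mul_le_mul_of_nonneg_left (h2.2 y hy) hb
      have e3 : ⟪-(a • v1 + b • v2), y - z t⟫ = a * ⟪-v1, y - z t⟫ + b * ⟪-v2, y - z t⟫ := by
        rw [neg_add, ← smul_neg, ← smul_neg, inner_add_left, real_inner_smul_left,
          real_inner_smul_left]
      rw [e3]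
      refine (add_le_add e1 e2).trans (le_of_eq ?_)
      rw [← add_mul, hab, one_mul]
  have hAmem : ∀ m, ∀ᶠ n in atTop, ∀ t ∈ Ioc T0 T, w n t ∈ A m t := by
    intro m
    have h0 : Tendsto (fun n => η n + e n) atTop (𝓝 0) := by simpa using hη.add hetend
    have hpos : (0 : ℝ) < 1 / ((m : ℝ) + 1) := by positivity
    filter_upwards [h0.eventually (gt_mem_nhds hpos)] with n hn t ht
    have htI : t ∈ Icc T0 T := Ioc_subset_Icc_self ht
    refine ⟨(hw n).2.1 t, fun y hy => ?_⟩
    have h1 : ⟪-w n t, y - zz n t⟫ ≤ κ * (‖y - zz n t‖ + e n) ^ 2 + e n :=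
      ((hw n).2.2.2 t ht).2 y hy
    have h2 := hzclose n t htI
    have h3 : ⟪-w n t, y - z t⟫ = ⟪-w n t, y - zz n t⟫ + ⟪w n t, z t - zz n t⟫ := by
      have : y - z t = (y - zz n t) - (z t - zz n t) := by abel
      rw [this, inner_sub_right, inner_neg_left _ (z t - zz n t)]
      ring
    have h4 : ⟪w n t, z t - zz n t⟫ ≤ η n := by
      refine (real_inner_le_norm _ _).trans ?_
      exact (mul_le_of_le_one_left (norm_nonneg _) ((hw n).2.1 t)).trans h2
    have h5 : ‖y - zz n t‖ ≤ ‖y - z t‖ + η n := by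
      have : y - zz n t = (y - z t) + (z t - zz n t) := by abel
      rw [this]
      exact (norm_add_le _ _).trans (by linarith)
    have h6 : (‖y - zz n t‖ + e n) ^ 2 ≤ (‖y - z t‖ + 1 / ((m : ℝ) + 1)) ^ 2 :=
      pow_le_pow_left₀ (add_nonneg (norm_nonneg _) (he0 n).le) (by linarith) 2
    have h7 := mul_le_mul_of_nonneg_left h6 hκ
    linarith
  -- the weighted measure
  have hgint : Integrable g (volume.restrict (Ioc T0 T)) :=
    (intervalIntegrable_iff_integrableOn_Ioc_of_le hT).1 hg
  have hgae : AEMeasurable (fun t => (g t).toNNReal) (volume.restrict (Ioc T0 T)) :=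
    hgint.aestronglyMeasurable.aemeasurable.real_toNNReal
  let μ : Measure ℝ := (volume.restrict (Ioc T0 T)).withDensity
    (fun t => ((g t).toNNReal : ℝ≥0∞))
  have hμfin : IsFiniteMeasure μ := isFiniteMeasure_withDensity_ofReal hgint.2
  have hint : ∀ (v : ℝ → E), ∀ t ∈ Icc T0 T,
      ∫ s in Ioc T0 t, v s ∂μ = ∫ s in T0..t, g s • v s := by
    intro v t ht
    rw [setIntegral_withDensity_eq_setIntegral_smul₀ hgae.restrict _ measurableSet_Ioc,
      Measure.restrict_restrict measurableSet_Ioc,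
      inter_eq_left.2 (Ioc_subset_Ioc_right ht.2), intervalIntegral.integral_of_le ht.1]
    refine setIntegral_congr_fun measurableSet_Ioc fun s _ => ?_
    simp only [NNReal.smul_def, Real.coe_toNNReal _ (hg0 s)]
  have hae : ∀ p : ℝ → Prop, (∀ t ∈ Ioc T0 T, p t) → ∀ᵐ t ∂μ, p t := by
    intro p hp
    have h1 : ∀ᵐ t ∂(volume.restrict (Ioc T0 T)), p t :=
      (ae_restrict_iff' measurableSet_Ioc).2 (Eventually.of_forall hp)
    exact (withDensity_absolutelyContinuous _ _).ae_le h1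
  obtain ⟨v, hvint, hvA, hvl⟩ := aux_L2 (μ := μ) (ι := Icc T0 T) w
    (fun n => (hw n).1.aestronglyMeasurable) (fun n => (hw n).2.1) A hAc hAv
    (fun m => (hAmem m).mono fun n hn => hae _ hn)
    (fun t => Ioc T0 t) (fun t => measurableSet_Ioc) (fun t => z t - z0) (by
      rintro ⟨t, ht⟩
      have h1 := (hz t ht).sub_const z0
      refine h1.congr fun n => ?_
      rw [hint _ t ht]
      simp [zz])
  refine ⟨z, fun t => g t • v t, ?_, ?_, hzD, ?_⟩
  · rw [intervalIntegrable_iff_integrableOn_Ioc_of_le hT]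
    have h1 := (integrable_withDensity_iff_integrable_smul₀ hgae).1 hvint
    refine h1.congr (Eventually.of_forall fun s => ?_)
    simp only [NNReal.smul_def, Real.coe_toNNReal _ (hg0 s)]
  · intro t ht
    have h1 := hvl ⟨t, ht⟩
    rw [hint _ t ht] at h1
    rw [h1]; abel
  · have h1 : ∀ᵐ t ∂μ, ∀ m, v t ∈ A m t := ae_all_iff.2 hvA
    have h2 := (ae_withDensity_iff' hgae.coe_nnreal_ennreal).1 h1
    rw [ae_restrict_iff' measurableSet_Ioc] at h2
    have hne : ∀ᵐ t ∂(volume : Measure ℝ), t ≠ T0 := by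
      simp [ae_iff]
    filter_upwards [h2, hne] with t h3 htne ht
    by_cases hgt : g t = 0
    · rw [hgt]
      simp only [zero_smul, neg_zero, norm_zero, le_refl, and_true]
      exact ⟨0, le_rfl, 1, one_pos, by simp⟩
    · have hgpos : 0 < g t := lt_of_le_of_ne (hg0 t) (Ne.symm hgt)
      have h4 := h3 ⟨lt_of_le_of_ne ht.1 (Ne.symm htne), ht.2⟩ (by simpa using hgpos)
      refine ⟨⟨κ * g t, by positivity, 1, one_pos, ?_⟩, ?_⟩
      · rintro y ⟨hy, -⟩
        have h5 : ⟪-v t, y - z t⟫ ≤ κ * (‖y - z t‖ + 0) ^ 2 + 0 := by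
          refine ge_of_tendsto' (f := fun m : ℕ =>
            κ * (‖y - z t‖ + 1 / ((m : ℝ) + 1)) ^ 2 + 1 / ((m : ℝ) + 1)) (x := atTop) ?_
            fun m => (h4 m).2 y hy
          have l := tendsto_one_div_add_atTop_nhds_zero_nat (𝕜 := ℝ)
          exact (((l.const_add _).pow 2).const_mul κ).add l
        rw [add_zero, add_zero] at h5
        have h6 := mul_le_mul_of_nonneg_left h5 hgpos.le
        rw [← smul_neg, real_inner_smul_left]
        linarith
      · rw [norm_smul, Real.norm_of_nonneg hgpos.le]
        exact mul_le_of_le_one_right hgpos.le (h4 0).1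

/-- Proposition 4.1: well-posedness of the sweeping process with time-dependent
integrable perturbation. -/
theorem sweeping_process_time_perturbation
    (T0 T : ℝ) (hT : T0 < T)
    (r : ℝ≥0∞) (hr : 0 < r)
    (C : ℝ → Set H)
    (hC : ∀ t ∈ Icc T0 T, (C t).Nonempty ∧ IsClosed (C t) ∧ IsProxRegular r (C t))
    (υ υ' : ℝ → ℝ)
    (hυint : IntervalIntegrable υ' volume T0 T)
    (hυAC : ∀ t ∈ Icc T0 T, υ t = υ T0 + ∫ s in T0..t, υ' s)
    (hmove : ∀ s ∈ Icc T0 T, ∀ t ∈ Icc T0 T,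
      C t ⊆ C s + |υ s - υ t| • Metric.closedBall (0 : H) 1)
    (h : ℝ → H) (hhint : IntervalIntegrable h volume T0 T)
    (x0 : H) (hx0 : x0 ∈ C T0) :
    (∃ x x' : ℝ → H, x T0 = x0 ∧ IsPerturbedSweepingSol T0 T C h x x' ∧
      ∀ᵐ t ∂volume, t ∈ Icc T0 T → ‖x' t + h t‖ ≤ ‖h t‖ + |υ' t|) ∧
    (∀ x x' y y' : ℝ → H, x T0 = x0 → y T0 = x0 →
      IsPerturbedSweepingSol T0 T C h x x' → IsPerturbedSweepingSol T0 T C h y y' →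
      ∀ t ∈ Icc T0 T, x t = y t) := by
  set κ : ℝ := ((2 * r)⁻¹).toReal with hκdef
  have hκ : 0 ≤ κ := ENNReal.toReal_nonneg
  have hTle : T0 ≤ T := hT.le
  have hT0 : T0 ∈ Icc T0 T := left_mem_Icc.2 hTle
  have hPR : ∀ t ∈ Icc T0 T, AuxPR κ (C t) := fun t ht => aux_pr_of (hC t ht).2.2
  constructor
  · let Hh : ℝ → H := fun t => ∫ s in T0..t, h s
    let D : ℝ → Set H := fun t => {y | y - Hh t ∈ C t}
    let g : ℝ → ℝ := fun t => ‖h t‖ + |υ' t|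
    have hυabs : IntervalIntegrable (fun t => |υ' t|) volume T0 T := hυint.abs
    have hg : IntervalIntegrable g volume T0 T := hhint.norm.add hυabs
    have hg0 : ∀ t, 0 ≤ g t := fun t => by positivity
    have hcone : ∀ t y v, v ∈ proxNormalCone (D t) y ↔ v ∈ proxNormalCone (C t) (y - Hh t) := by
      intro t y v
      constructor
      · rintro ⟨σ, hσ, δ, hδ, hh⟩
        refine ⟨σ, hσ, δ, hδ, ?_⟩
        rintro q ⟨hq1, hq2⟩
        have h1 := hh (q + Hh t) ⟨by simpa [D] using hq1, by
          rw [Metric.mem_ball, dist_eq_norm] at hq2 ⊢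
          have : q + Hh t - y = q - (y - Hh t) := by abel
          rwa [this]⟩
        have : q + Hh t - y = q - (y - Hh t) := by abel
        rwa [this] at h1
      · rintro ⟨σ, hσ, δ, hδ, hh⟩
        refine ⟨σ, hσ, δ, hδ, ?_⟩
        rintro q ⟨hq1, hq2⟩
        have e : q - Hh t - (y - Hh t) = q - y := by abel
        have h1 := hh (q - Hh t) ⟨hq1, by
          rw [Metric.mem_ball, dist_eq_norm] at hq2 ⊢
          rwa [e]⟩
        rwa [e] at h1
    have hD : ∀ t ∈ Icc T0 T, (D t).Nonempty ∧ IsClosed (D t) ∧ AuxPR κ (D t) := by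
      intro t ht
      obtain ⟨⟨c, hc⟩, hcl, -⟩ := hC t ht
      refine ⟨⟨c + Hh t, by simpa [D] using hc⟩, ?_, ?_⟩
      · exact hcl.preimage (by fun_prop : Continuous fun y => y - Hh t)
      · intro y hy v hv q hq
        have h1 := hPR t ht _ hy v ((hcone t y v).1 hv) _ hq
        have e : q - Hh t - (y - Hh t) = q - y := by abel
        rwa [e] at h1
    have hCm : ∀ s ∈ Icc T0 T, ∀ t ∈ Icc T0 T, ∀ y ∈ C t, ∃ y' ∈ C s, ‖y - y'‖ ≤ |υ s - υ t| := by
      intro s hs t ht y hy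
      obtain ⟨y', hy', b, hb, hyb⟩ := Set.mem_add.1 (hmove s hs t ht hy)
      obtain ⟨b', hb', rfl⟩ := Set.mem_smul_set.1 hb
      refine ⟨y', hy', ?_⟩
      rw [← hyb, add_sub_cancel_left, norm_smul, Real.norm_eq_abs, abs_abs]
      exact mul_le_of_le_one_right (abs_nonneg _) (by simpa using hb')
    have hbound : ∀ s ∈ Icc T0 T, ∀ t ∈ Icc T0 T, s ≤ t →
        |υ t - υ s| + ‖Hh t - Hh s‖ ≤ ∫ q in s..t, g q := by
      intro s hs t ht hst
      have e1 : υ t - υ s = ∫ q in s..t, υ' q := by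
        rw [hυAC t ht, hυAC s hs, add_sub_add_left_eq_sub]
        exact intervalIntegral.integral_interval_sub_left (aux_ii_sub hTle hυint _ hT0 _ ht)
          (aux_ii_sub hTle hυint _ hT0 _ hs)
      have e2 : Hh t - Hh s = ∫ q in s..t, h q :=
        intervalIntegral.integral_interval_sub_left (aux_ii_sub hTle hhint _ hT0 _ ht)
          (aux_ii_sub hTle hhint _ hT0 _ hs)
      have e3 : ∫ q in s..t, g q = (∫ q in s..t, ‖h q‖) + ∫ q in s..t, |υ' q| :=
        intervalIntegral.integral_add (aux_ii_sub hTle hhint.norm _ hs _ ht)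
          (aux_ii_sub hTle hυabs _ hs _ ht)
      have e4 : |∫ q in s..t, υ' q| ≤ ∫ q in s..t, |υ' q| :=
        intervalIntegral.abs_integral_le_integral_abs hst
      have e5 : ‖∫ q in s..t, h q‖ ≤ ∫ q in s..t, ‖h q‖ :=
        intervalIntegral.norm_integral_le_integral_norm hst
      rw [e1, e2, e3]
      linarith
    have hDm : ∀ s ∈ Icc T0 T, ∀ t ∈ Icc T0 T, ∀ y ∈ D t, ∃ y' ∈ D s,
        ‖y - y'‖ ≤ |υ s - υ t| + ‖Hh t - Hh s‖ := by
      intro s hs t ht y hy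
      obtain ⟨c, hc, hcn⟩ := hCm s hs t ht _ hy
      refine ⟨c + Hh s, by simpa [D] using hc, ?_⟩
      have : y - (c + Hh s) = (y - Hh t - c) + (Hh t - Hh s) := by abel
      rw [this]
      exact (norm_add_le _ _).trans (by linarith)
    have hDmove : ∀ s ∈ Icc T0 T, ∀ t ∈ Icc T0 T, s ≤ t →
        (∀ y ∈ D t, ∃ y' ∈ D s, ‖y - y'‖ ≤ ∫ q in s..t, g q) ∧
        (∀ y ∈ D s, ∃ y' ∈ D t, ‖y - y'‖ ≤ ∫ q in s..t, g q) := by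
      intro s hs t ht hst
      have hb := hbound s hs t ht hst
      constructor
      · intro y hy
        obtain ⟨y', hy', hn⟩ := hDm s hs t ht y hy
        rw [abs_sub_comm] at hn
        exact ⟨y', hy', hn.trans hb⟩
      · intro y hy
        obtain ⟨y', hy', hn⟩ := hDm t ht s hs y hy
        rw [norm_sub_rev (Hh s)] at hn
        exact ⟨y', hy', hn.trans hb⟩
    have hx0D : x0 ∈ D T0 := by
      show x0 - Hh T0 ∈ C T0
      simpa [Hh] using hx0
    obtain ⟨z, z', hz'int, hzint, hzD, hzae⟩ := aux_exists_sol hTle hg hg0 hκ hD hDmove hx0D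
    have hzT0 : z T0 = x0 := by
      have := hzint T0 hT0
      simpa using this
    have hHT0 : Hh T0 = 0 := by simp [Hh]
    refine ⟨fun t => z t - Hh t, fun t => z' t - h t, ?_, ⟨hz'int.sub hhint, ?_, ?_, ?_⟩, ?_⟩
    · simp only [hzT0, hHT0, sub_zero]
    · intro t ht
      simp only [hzT0, hHT0, sub_zero]
      rw [intervalIntegral.integral_sub (aux_ii_sub hTle hz'int _ hT0 _ ht)
        (aux_ii_sub hTle hhint _ hT0 _ ht), hzint t ht]
      simp only [Hh]
      abel
    · intro t ht
      exact hzD t ht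
    · filter_upwards [hzae] with t h1 ht
      have h2 := (hcone t _ _).1 (h1 ht).1
      have e : -(z' t - h t) - h t = -z' t := by abel
      rw [e]
      exact h2
    · filter_upwards [hzae] with t h1 ht
      have h2 := (h1 ht).2
      simpa using h2
  · rintro x x' y y' hx0' hy0' ⟨hx1, hx2, hx3, hx4⟩ ⟨hy1, hy2, hy3, hy4⟩ t ht
    have hdiff : ∀ t ∈ Icc T0 T, x t - y t = ∫ s in T0..t, (x' s - y' s) := by
      intro t ht
      rw [intervalIntegral.integral_sub (aux_ii_sub hTle hx1 _ hT0 _ ht)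
        (aux_ii_sub hTle hy1 _ hT0 _ ht), hx2 t ht, hy2 t ht, hx0', hy0']
      abel
    have key := aux_gronwall hTle (u' := fun s => x' s - y' s)
      (g := fun s => κ * (‖-x' s - h s‖ + ‖-y' s - h s‖)) (hx1.sub hy1)
      (((hx1.neg.sub hhint).norm.add (hy1.neg.sub hhint).norm).const_mul κ)
      (fun t => by positivity) (b := 0) le_rfl ?_ t ht
    · rw [← hdiff t ht, add_zero, zero_mul] at key
      have h1 : ‖x t - y t‖ = 0 := by
        have := sq_nonneg ‖x t - y t‖
        exact pow_eq_zero_iff (two_ne_zero) |>.1 (le_antisymm key this)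
      exact sub_eq_zero.1 (norm_eq_zero.1 h1)
    · filter_upwards [hx4, hy4] with s h1 h2 hs
      rw [← hdiff s hs, add_zero]
      have k1 := hPR s hs _ (hx3 s hs) _ (h1 hs) _ (hy3 s hs)
      have k2 := hPR s hs _ (hy3 s hs) _ (h2 hs) _ (hx3 s hs)
      rw [norm_sub_rev (y s) (x s)] at k1
      have e : ⟪x s - y s, x' s - y' s⟫ = ⟪-x' s - h s, y s - x s⟫ + ⟪-y' s - h s, x s - y s⟫ := by
        rw [← neg_sub (x s) (y s), inner_neg_right, ← inner_neg_left, ← inner_add_left,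
          real_inner_comm]
        congr 1
        abel
      rw [e]
      linarith
end
end

section
/- Let H be a real Hilbert space and assume that (H1), (H2) and (H3) are satisfied. Then for any initial point x0 ∈ C(T0) there exists a unique absolutely continuous mapping x : [T0,T] → H such that x(T0) = x0, x(t) ∈ C(t) for all t ∈ [T0,T], and −x'(t) ∈ N_{C(t)}(x(t)) + f1(t, x(t)) + ∫_{T0}^t f2(t, s, x(s)) ds for almost every t ∈ [T0,T]. -/
open MeasureTheory Set
open scoped RealInnerProductSpace ENNReal Pointwise NNReal

noncomputable section

variable {H : Type*} [NormedAddCommGroup H] [InnerProductSpace ℝ H]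

variable [CompleteSpace H]

/-- Absolutely continuous solution of the integro-differential sweeping process
`-x'(t) ∈ N_{C(t)}(x(t)) + f1(t, x(t)) + ∫_{T0}^t f2(t, s, x(s)) ds`. -/
def IsIDSweepingSol (T0 T : ℝ) (C : ℝ → Set H) (f1 : ℝ → H → H)
    (f2 : ℝ → ℝ → H → H) (x x' : ℝ → H) : Prop :=
  IntervalIntegrable x' volume T0 T ∧
  (∀ t ∈ Icc T0 T, x t = x T0 + ∫ s in T0..t, x' s) ∧
  (∀ t ∈ Icc T0 T, x t ∈ C t) ∧
  (∀ᵐ t ∂volume, t ∈ Icc T0 T →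
    (-x' t - f1 t (x t) - ∫ s in T0..t, f2 t s (x s)) ∈ proxNormalCone (C t) (x t))

set_option linter.unusedSectionVars false
set_option linter.unusedVariables false

set_option linter.unusedSectionVars false
set_option linter.unusedVariables false

theorem ac_of_dist_le {X : Type*} [PseudoMetricSpace X] {f : ℝ → X} {U : ℝ → ℝ} {a b : ℝ}
    (hU : AbsolutelyContinuousOnInterval U a b)
    (h : ∀ s ∈ uIcc a b, ∀ t ∈ uIcc a b, dist (f s) (f t) ≤ dist (U s) (U t)) :
    AbsolutelyContinuousOnInterval f a b := by
  rw [absolutelyContinuousOnInterval_iff] at hU ⊢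
  intro ε hε
  obtain ⟨δ, hδ, hh⟩ := hU ε hε
  refine ⟨δ, hδ, fun E hE hlt => lt_of_le_of_lt ?_ (hh E hE hlt)⟩
  refine Finset.sum_le_sum fun i hi => ?_
  have := hE.1 i hi
  exact h _ this.1 _ this.2

theorem ftc_ac {f f' : ℝ → ℝ} {a b : ℝ} (hf : AbsolutelyContinuousOnInterval f a b)
    (h : ∀ᵐ t ∂volume, t ∈ uIcc a b → HasDerivAt f (f' t) t) :
    ∫ t in a..b, f' t = f b - f a := by
  rw [← hf.integral_deriv_eq_sub]
  apply intervalIntegral.integral_congr_ae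
  filter_upwards [h] with t ht htm
  exact ((ht (uIoc_subset_uIcc htm)).deriv).symm

theorem integral_mono_W {ω : ℝ → ℝ} {a b : ℝ}
    (hω : IntervalIntegrable ω volume a b) (hnn : ∀ t ∈ Icc a b, 0 ≤ ω t)
    {s t : ℝ} (hs : a ≤ s) (hst : s ≤ t) (ht : t ≤ b) :
    ∫ u in a..s, ω u ≤ ∫ u in a..t, ω u := by
  have hab : a ≤ b := by linarith
  have h1 : IntervalIntegrable ω volume a s :=
    hω.mono_set (by rw [uIcc_of_le hs, uIcc_of_le hab]; exact Icc_subset_Icc le_rfl (by linarith))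
  have h2 : IntervalIntegrable ω volume s t :=
    hω.mono_set (by rw [uIcc_of_le hst, uIcc_of_le hab]; exact Icc_subset_Icc hs ht)
  rw [← intervalIntegral.integral_add_adjacent_intervals h1 h2]
  have : 0 ≤ ∫ u in s..t, ω u := intervalIntegral.integral_nonneg hst
    fun u hu => hnn u ⟨by linarith [hu.1], by linarith [hu.2]⟩
  linarith

theorem ii_mono {E : Type*} [NormedAddCommGroup E] {f : ℝ → E} {a b s t : ℝ}
    (hf : IntervalIntegrable f volume a b) (hs : a ≤ s) (hst : s ≤ t) (ht : t ≤ b) :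
    IntervalIntegrable f volume s t :=
  hf.mono_set (by
    rw [uIcc_of_le hst, uIcc_of_le (by linarith)]; exact Icc_subset_Icc hs ht)

theorem exp_sub_le {a b M : ℝ} (ha : a ≤ M) (hb : b ≤ M) :
    |Real.exp a - Real.exp b| ≤ Real.exp M * |a - b| := by
  wlog hab : a ≤ b generalizing a b
  · rw [abs_sub_comm, abs_sub_comm a]; exact this hb ha (by linarith)
  have h1 : Real.exp a ≤ Real.exp b := Real.exp_le_exp.2 hab
  rw [abs_sub_comm, abs_sub_comm a, abs_of_nonneg (by linarith), abs_of_nonneg (by linarith)]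
  have h2 := Real.add_one_le_exp (a - b)
  have h3 : Real.exp a = Real.exp b * Real.exp (a - b) := by rw [← Real.exp_add]; ring_nf
  have h4 : Real.exp b ≤ Real.exp M := Real.exp_le_exp.2 hb
  have h5 := Real.exp_pos b
  calc Real.exp b - Real.exp a = Real.exp b * (1 - Real.exp (a - b)) := by rw [h3]; ring
    _ ≤ Real.exp b * (b - a) := mul_le_mul_of_nonneg_left (by linarith) h5.le
    _ ≤ _ := mul_le_mul_of_nonneg_right h4 (by linarith)

theorem integral_exp_W {ω : ℝ → ℝ} {a b : ℝ} (hab : a ≤ b) {κ : ℝ} (hκ : 0 < κ)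
    (hω : IntervalIntegrable ω volume a b) (hnn : ∀ t ∈ Icc a b, 0 ≤ ω t) {t : ℝ}
    (ht : t ∈ Icc a b) :
    ∫ s in a..t, ω s * Real.exp (κ * ∫ u in a..s, ω u)
      = (Real.exp (κ * ∫ u in a..t, ω u) - 1) / κ := by
  set W : ℝ → ℝ := fun s => ∫ u in a..s, ω u with hW
  have hωt : IntervalIntegrable ω volume a t := ii_mono hω le_rfl ht.1 ht.2
  have hWac : AbsolutelyContinuousOnInterval W a t :=
    hωt.absolutelyContinuousOnInterval_intervalIntegral (by simp)
  have hac : AbsolutelyContinuousOnInterval (fun s => Real.exp (κ * W s) / κ) a t := by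
    refine ac_of_dist_le (hWac.const_mul (Real.exp (κ * W t))) ?_
    rw [uIcc_of_le ht.1]
    intro s hs u hu
    have hs' : W s ≤ W t := integral_mono_W hω hnn hs.1 hs.2 ht.2
    have hu' : W u ≤ W t := integral_mono_W hω hnn hu.1 hu.2 ht.2
    simp only [Real.dist_eq]
    rw [← sub_div, abs_div, abs_of_pos hκ, ← mul_sub, abs_mul, abs_of_pos (Real.exp_pos _),
      div_le_iff₀ hκ]
    have := exp_sub_le (a := κ * W s) (b := κ * W u) (M := κ * W t) (by gcongr) (by gcongr)
    rw [← mul_sub, abs_mul, abs_of_pos hκ] at this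
    linarith
  have := ftc_ac (f' := fun s => ω s * Real.exp (κ * W s)) hac (by
    filter_upwards [hωt.ae_hasDerivAt_integral] with s hs hsm
    have h1 := hs hsm a (by simp)
    have h2 := ((h1.const_mul κ).exp).div_const κ
    have e : ω s * Real.exp (κ * W s)
        = Real.exp (κ * ∫ (t : ℝ) in a..s, ω t) * (κ * ω s) / κ := by
      rw [eq_div_iff hκ.ne']; simp only [hW]; ring
    simp only [e]
    exact h2)
  rw [this]
  simp [hW, sub_div]

/-- L¹ Gronwall in the form used here. -/
theorem gronwall_W {ω p : ℝ → ℝ} {a b c : ℝ} (hab : a ≤ b) (hc : 0 ≤ c)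
    (hω : IntervalIntegrable ω volume a b) (hnn : ∀ t ∈ Icc a b, 0 ≤ ω t)
    (hp : ContinuousOn p (Icc a b))
    (h : ∀ t ∈ Icc a b, p t ≤ ∫ s in a..t, ω s * (3 * p s + c * Real.exp (7 * ∫ u in a..s, ω u))) :
    ∀ t ∈ Icc a b, p t ≤ c / 4 * Real.exp (7 * ∫ u in a..t, ω u) := by
  set W : ℝ → ℝ := fun s => ∫ u in a..s, ω u with hW
  have hWc : ContinuousOn W (Icc a b) := by
    have := (hω.absolutelyContinuousOnInterval_intervalIntegral (c := a) (by simp)).continuousOn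
    rwa [uIcc_of_le hab] at this
  have hEc : ContinuousOn (fun t => Real.exp (7 * W t)) (Icc a b) :=
    Real.continuous_exp.comp_continuousOn (continuousOn_const.mul hWc)
  have hqc : ContinuousOn (fun t => p t * Real.exp (-(7 * W t))) (Icc a b) :=
    hp.mul (Real.continuous_exp.comp_continuousOn (continuousOn_const.mul hWc).neg)
  obtain ⟨t1, ht1, hmax⟩ := isCompact_Icc.exists_isMaxOn (nonempty_Icc.2 hab) hqc
  set M := p t1 * Real.exp (-(7 * W t1)) with hM
  have hle : ∀ t ∈ Icc a b, p t ≤ M * Real.exp (7 * W t) := by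
    intro t ht
    have := hmax ht
    simp only [mem_ofPred_eq] at this
    calc p t = p t * Real.exp (-(7 * W t)) * Real.exp (7 * W t) := by
          rw [mul_assoc, ← Real.exp_add]; simp
      _ ≤ _ := by gcongr
  have hpt1 : p t1 = M * Real.exp (7 * W t1) := by
    rw [hM, mul_assoc, ← Real.exp_add]; simp
  have key : M ≤ c / 4 := by
    by_contra hcon
    push Not at hcon
    have hωt : IntervalIntegrable ω volume a t1 := ii_mono hω le_rfl ht1.1 ht1.2
    have hsub : Icc a t1 ⊆ Icc a b := Icc_subset_Icc le_rfl ht1.2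
    have h1 : p t1 ≤ ∫ s in a..t1, (3 * M + c) * (ω s * Real.exp (7 * W s)) := by
      refine (h t1 ht1).trans ?_
      refine intervalIntegral.integral_mono_on ht1.1 ?_ ?_ ?_
      · refine hωt.mul_continuousOn ?_
        rw [uIcc_of_le ht1.1]
        exact ((continuousOn_const.mul hp).add (continuousOn_const.mul hEc)).mono hsub
      · refine IntervalIntegrable.const_mul (hωt.mul_continuousOn ?_) _
        rw [uIcc_of_le ht1.1]
        exact hEc.mono hsub
      · intro s hs
        have h0 := hnn s (hsub hs)
        have h2 := hle s (hsub hs)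
        calc ω s * (3 * p s + c * Real.exp (7 * W s))
            ≤ ω s * (3 * (M * Real.exp (7 * W s)) + c * Real.exp (7 * W s)) := by gcongr
          _ = _ := by ring
    rw [intervalIntegral.integral_const_mul, integral_exp_W hab (by norm_num) hω hnn ht1, hpt1] at h1
    change M * Real.exp (7 * W t1) ≤ (3 * M + c) * ((Real.exp (7 * W t1) - 1) / 7) at h1
    have h3 : 0 < 3 * M + c := by linarith
    have h4 := Real.exp_pos (7 * W t1)
    nlinarith
  intro t ht
  exact (hle t ht).trans (by gcongr)

/-- pieces of the AC-path API -/
theorem path_restart {E : Type*} [NormedAddCommGroup E] [NormedSpace ℝ E] {z z' : ℝ → E} {a b : ℝ}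
    (hz' : IntervalIntegrable z' volume a b)
    (hz : ∀ t ∈ Icc a b, z t = z a + ∫ s in a..t, z' s) {s t : ℝ} (hs : a ≤ s) (hst : s ≤ t)
    (ht : t ≤ b) : z t = z s + ∫ u in s..t, z' u := by
  rw [hz t ⟨hs.trans hst, ht⟩, hz s ⟨hs, hst.trans ht⟩,
    ← intervalIntegral.integral_add_adjacent_intervals (ii_mono hz' le_rfl hs (by linarith))
      (ii_mono hz' hs hst ht), add_assoc]

theorem path_hasDerivAt {E : Type*} [NormedAddCommGroup E] [NormedSpace ℝ E] [CompleteSpace E]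
    {z z' : ℝ → E} {a b : ℝ}
    (hab : a ≤ b) (hz' : IntervalIntegrable z' volume a b)
    (hz : ∀ t ∈ Icc a b, z t = z a + ∫ s in a..t, z' s) :
    ∀ᵐ t ∂volume, t ∈ Icc a b → t ∈ Ioo a b ∧ HasDerivAt z (z' t) t := by
  have h₁ : ∀ᵐ x : ℝ ∂volume, x ≠ a := by simp [ae_iff, measure_singleton]
  have h₂ : ∀ᵐ x : ℝ ∂volume, x ≠ b := by simp [ae_iff, measure_singleton]
  filter_upwards [h₁, h₂, hz'.ae_hasDerivAt_integral] with t h1 h2 h3 ht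
  have hto : t ∈ Ioo a b := ⟨lt_of_le_of_ne ht.1 (Ne.symm h1), lt_of_le_of_ne ht.2 h2⟩
  refine ⟨hto, ?_⟩
  rw [uIcc_of_le hab] at h3
  have h4 := (h3 ht a ⟨le_rfl, hab⟩).const_add (z a)
  refine h4.congr_of_eventuallyEq ?_
  filter_upwards [Icc_mem_nhds hto.1 hto.2] with s hs using hz s hs

theorem path_dist {E : Type*} [NormedAddCommGroup E] [NormedSpace ℝ E] {z z' : ℝ → E} {g : ℝ → ℝ}
    {a b : ℝ}
    (hz' : IntervalIntegrable z' volume a b) (hg : IntervalIntegrable g volume a b)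
    (hz : ∀ t ∈ Icc a b, z t = z a + ∫ s in a..t, z' s)
    (hle : ∀ᵐ t ∂volume, t ∈ Icc a b → ‖z' t‖ ≤ g t) {s t : ℝ} (hs : a ≤ s) (hst : s ≤ t)
    (ht : t ≤ b) : ‖z t - z s‖ ≤ (∫ u in a..t, g u) - ∫ u in a..s, g u := by
  have h1 := path_restart hz' hz hs hst ht
  have h2 : (∫ u in a..t, g u) - ∫ u in a..s, g u = ∫ u in s..t, g u := by
    rw [← intervalIntegral.integral_add_adjacent_intervals (ii_mono hg le_rfl hs (by linarith))
      (ii_mono hg hs hst ht)]; ring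
  rw [h2, h1, add_sub_cancel_left]
  refine intervalIntegral.norm_integral_le_of_norm_le hst ?_ (ii_mono hg hs hst ht)
  filter_upwards [hle] with u hu hum
  exact hu ⟨hs.trans hum.1.le, hum.2.trans ht⟩

theorem path_continuousOn {E : Type*} [NormedAddCommGroup E] [NormedSpace ℝ E] {z z' : ℝ → E}
    {a b : ℝ} (hab : a ≤ b)
    (hz' : IntervalIntegrable z' volume a b)
    (hz : ∀ t ∈ Icc a b, z t = z a + ∫ s in a..t, z' s) : ContinuousOn z (Icc a b) := by
  have h := intervalIntegral.continuousOn_primitive_interval' hz' (a := a) (by simp)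
  rw [uIcc_of_le hab] at h
  exact (continuousOn_const.add h).congr hz

theorem path_normSq {z z' : ℝ → H} {a b : ℝ} (hab : a ≤ b)
    (hz' : IntervalIntegrable z' volume a b)
    (hz : ∀ t ∈ Icc a b, z t = z a + ∫ s in a..t, z' s) :
    ∀ t ∈ Icc a b, ‖z t‖ ^ 2 = ‖z a‖ ^ 2 + ∫ s in a..t, 2 * ⟪z' s, z s⟫ := by
  intro t ht
  have hc := path_continuousOn hab hz' hz
  obtain ⟨K, hK⟩ := isCompact_Icc.exists_bound_of_continuousOn hc
  have hK0 : 0 ≤ K := (norm_nonneg _).trans (hK t ht)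
  have hV := hz'.norm.absolutelyContinuousOnInterval_intervalIntegral (c := a) (by simp)
  have hac : AbsolutelyContinuousOnInterval (fun s => ‖z s‖ ^ 2) a b := by
    refine ac_of_dist_le (hV.const_mul (2 * K)) ?_
    rw [uIcc_of_le hab]
    have main : ∀ s ∈ Icc a b, ∀ u ∈ Icc a b, s ≤ u →
        dist (‖z s‖ ^ 2) (‖z u‖ ^ 2) ≤ dist (2 * K * ∫ v in a..s, ‖z' v‖)
          (2 * K * ∫ v in a..u, ‖z' v‖) := by
      intro s hs u hu hsu
      have h1 := path_dist hz' hz'.norm hz (by simp) hs.1 hsu hu.2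
      rw [dist_comm, dist_comm (2 * K * _), Real.dist_eq, Real.dist_eq, ← mul_sub, abs_mul,
        abs_of_nonneg (by positivity : 0 ≤ 2 * K), abs_of_nonneg ((norm_nonneg _).trans h1)]
      have h2 : ‖z u‖ ^ 2 - ‖z s‖ ^ 2 = (‖z u‖ + ‖z s‖) * (‖z u‖ - ‖z s‖) := by ring
      rw [h2, abs_mul, abs_of_nonneg (by positivity)]
      have h3 := abs_norm_sub_norm_le (z u) (z s)
      have := hK s hs
      have := hK u hu
      exact mul_le_mul (by linarith) (h3.trans h1) (abs_nonneg _) (by linarith)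
    intro s hs u hu
    rcases le_total s u with h | h
    · exact main s hs u hu h
    · rw [dist_comm, dist_comm (2 * K * _)]; exact main u hu s hs h
  have hsub : uIcc a t ⊆ uIcc a b := by
    rw [uIcc_of_le ht.1, uIcc_of_le hab]; exact Icc_subset_Icc le_rfl ht.2
  have := ftc_ac (f' := fun s => 2 * ⟪z' s, z s⟫) (hac.mono hsub) (by
    filter_upwards [path_hasDerivAt hab hz' hz] with s hs hsm
    have h1 := (hs (by rw [uIcc_of_le ht.1] at hsm; exact ⟨hsm.1, hsm.2.trans ht.2⟩)).2
    have h2 := h1.norm_sq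
    rw [real_inner_comm]
    exact h2)
  rw [this]; ring

/-- Lens estimate. -/
theorem lens_estimate (x y1 y : H) {e δ η : ℝ} (he0 : 0 < e) (he1 : e ≤ 1)
    (hδ : ‖y1 - x‖ ^ 2 ≤ ‖y - x‖ ^ 2 + δ)
    (hη : ‖y - (x + e • (y1 - x))‖ ^ 2 ≤ ‖y1 - (x + e • (y1 - x))‖ ^ 2 + η) (hδ0 : 0 ≤ δ) :
    e * ‖y - y1‖ ^ 2 ≤ δ + η := by
  set a := y - x with ha
  set b := y1 - x with hb
  have e1 : y - (x + e • b) = a - e • b := by rw [ha]; abel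
  have e2 : y1 - (x + e • b) = b - e • b := by rw [hb]; abel
  have e3 : y - y1 = a - b := by rw [ha, hb]; abel
  rw [e1, e2] at hη
  rw [e3]
  rw [norm_sub_sq_real a (e • b), norm_sub_sq_real b (e • b)] at hη
  rw [norm_sub_sq_real a b]
  simp only [norm_smul, inner_smul_right, real_inner_self_eq_norm_sq, Real.norm_eq_abs,
    abs_of_pos he0] at hη
  nlinarith

theorem dense_nearest {S : Set H} (hS : IsClosed S) (hne : S.Nonempty) (x : H) {ε : ℝ}
    (hε : 0 < ε) : ∃ w, ‖w - x‖ ≤ ε ∧ ∃ u ∈ S, ∀ y ∈ S, ‖w - u‖ ≤ ‖w - y‖ := by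
  let U : ℕ → Set H := fun n => {w | ∃ η : ℝ, 0 < η ∧ ∀ y ∈ S, ∀ y' ∈ S,
    dist w y ≤ Metric.infDist w S + η → dist w y' ≤ Metric.infDist w S + η →
      dist y y' ≤ 1 / ((n : ℝ) + 1)}
  have hopen : ∀ n, IsOpen (U n) := by
    intro n
    rw [Metric.isOpen_iff]
    rintro w ⟨η, hη, h⟩
    refine ⟨η / 4, by positivity, fun w' hw' => ⟨η / 4, by positivity, fun y hy y' hy' h1 h2 => ?_⟩⟩
    have hd : dist w w' < η / 4 := by rw [dist_comm]; exact hw'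
    have hi : Metric.infDist w' S ≤ Metric.infDist w S + dist w' w :=
      Metric.infDist_le_infDist_add_dist
    rw [dist_comm w' w] at hi
    have t1 := dist_triangle w w' y
    have t2 := dist_triangle w w' y'
    exact h y hy y' hy' (by linarith) (by linarith)
  have hdense : ∀ n, Dense (U n) := by
    intro n
    rw [Metric.dense_iff]
    intro x ε0 hε0
    set d := Metric.infDist x S with hd
    have hd0 : 0 ≤ d := Metric.infDist_nonneg
    set e := min (1 / 2) (ε0 / (2 * (d + 1))) with he
    have he0 : 0 < e := by rw [he]; positivity
    have he1 : e ≤ 1 := (min_le_left _ _).trans (by norm_num)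
    have he2 : e * (2 * (d + 1)) ≤ ε0 := by
      rw [← le_div_iff₀ (by positivity)]; exact min_le_right _ _
    set κ := (1 / (2 * ((n : ℝ) + 1))) ^ 2 with hκ
    have hκ0 : 0 < κ := by positivity
    set δ := min 1 (κ * e / 2 / (2 * d + 3)) with hδ
    have hδ0 : 0 < δ := by rw [hδ]; positivity
    have hδ1 : δ ≤ 1 := min_le_left _ _
    have hδ2 : δ * (2 * d + 3) ≤ κ * e / 2 := by
      rw [← le_div_iff₀ (by positivity)]; exact min_le_right _ _
    obtain ⟨y1, hy1, hy1d⟩ := (Metric.infDist_lt_iff hne).1 (lt_add_of_pos_right d hδ0)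
    have hn1 : ‖y1 - x‖ < d + δ := by rwa [dist_comm, dist_eq_norm] at hy1d
    set x1 := x + e • (y1 - x) with hx1
    refine ⟨x1, ?_, δ, hδ0, ?_⟩
    · rw [Metric.mem_ball, dist_eq_norm, hx1, add_sub_cancel_left, norm_smul, Real.norm_eq_abs,
        abs_of_pos he0]
      nlinarith
    · have hsd : ‖y1 - x1‖ ≤ d + 1 := by
        have : y1 - x1 = (1 - e) • (y1 - x) := by rw [hx1, sub_smul, one_smul]; abel
        rw [this, norm_smul, Real.norm_eq_abs, abs_of_nonneg (by linarith)]
        nlinarith [norm_nonneg (y1 - x)]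
      have hid : Metric.infDist x1 S ≤ ‖y1 - x1‖ := by
        have := Metric.infDist_le_dist_of_mem (x := x1) hy1
        rwa [dist_comm, dist_eq_norm] at this
      have key : ∀ y ∈ S, dist x1 y ≤ Metric.infDist x1 S + δ →
          dist y y1 ≤ 1 / (2 * ((n : ℝ) + 1)) := by
        intro y hy hyd
        rw [dist_comm, dist_eq_norm] at hyd
        have hyx : d ≤ ‖y - x‖ := by
          have := Metric.infDist_le_dist_of_mem (x := x) hy
          rwa [dist_comm, dist_eq_norm] at this
        have h1 : ‖y1 - x‖ ^ 2 ≤ ‖y - x‖ ^ 2 + κ * e / 2 := by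
          nlinarith [norm_nonneg (y1 - x)]
        have h2 : ‖y - x1‖ ^ 2 ≤ ‖y1 - x1‖ ^ 2 + κ * e / 2 := by
          have h3 : ‖y - x1‖ ≤ ‖y1 - x1‖ + δ := by linarith
          have h4 : ‖y - x1‖ ^ 2 ≤ (‖y1 - x1‖ + δ) ^ 2 := by gcongr
          nlinarith
        have h5 := lens_estimate x y1 y he0 he1 h1 h2 (by positivity)
        have h6 : ‖y - y1‖ ^ 2 ≤ κ := by
          have : e * ‖y - y1‖ ^ 2 ≤ e * κ := by linarith
          exact le_of_mul_le_mul_left this he0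
        rw [dist_eq_norm]
        exact abs_le_of_sq_le_sq' (by rw [hκ] at h6; exact h6) (by positivity) |>.2
      intro y hy y' hy' h1 h2
      have a1 := key y hy h1
      have a2 := key y' hy' h2
      have a3 := dist_triangle_right y y' y1
      have a4 : 1 / ((n : ℝ) + 1) = 1 / (2 * ((n : ℝ) + 1)) + 1 / (2 * ((n : ℝ) + 1)) := by
        field_simp; norm_num
      linarith
  obtain ⟨w, hwb, hw⟩ := Metric.dense_iff.1 (dense_iInter_of_isOpen_nat hopen hdense) x ε hε
  rw [Metric.mem_ball, dist_eq_norm] at hwb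
  refine ⟨w, hwb.le, ?_⟩
  rw [mem_iInter] at hw
  have hseq : ∀ k : ℕ, ∃ y ∈ S, dist w y < Metric.infDist w S + 1 / ((k : ℝ) + 1) := fun k =>
    (Metric.infDist_lt_iff hne).1 (lt_add_of_pos_right _ (by positivity))
  choose y hyS hyd using hseq
  have hcau : CauchySeq y := by
    rw [Metric.cauchySeq_iff']
    intro ε hε
    obtain ⟨n, hn⟩ := exists_nat_one_div_lt hε
    obtain ⟨η, hη, h⟩ := hw n
    obtain ⟨N, hN⟩ := exists_nat_one_div_lt hη
    refine ⟨N, fun m hm => lt_of_le_of_lt (h _ (hyS m) _ (hyS N) ?_ ?_) hn⟩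
    · have : 1 / ((m : ℝ) + 1) ≤ 1 / ((N : ℝ) + 1) := by gcongr
      linarith [hyd m]
    · linarith [hyd N]
  obtain ⟨u, hu⟩ := cauchySeq_tendsto_of_complete hcau
  have huS : u ∈ S := hS.mem_of_tendsto hu (Filter.Eventually.of_forall hyS)
  refine ⟨u, huS, fun y' hy' => ?_⟩
  have h1 : dist w u ≤ Metric.infDist w S := by
    have l1 : Filter.Tendsto (fun k => dist w (y k)) Filter.atTop (nhds (dist w u)) :=
      tendsto_const_nhds.dist hu
    have l2 : Filter.Tendsto (fun k : ℕ => Metric.infDist w S + 1 / ((k : ℝ) + 1)) Filter.atTop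
        (nhds (Metric.infDist w S + 0)) :=
      tendsto_const_nhds.add tendsto_one_div_add_atTop_nhds_zero_nat
    rw [add_zero] at l2
    exact le_of_tendsto_of_tendsto' l1 l2 fun k => (hyd k).le
  rw [← dist_eq_norm, ← dist_eq_norm]
  exact h1.trans (Metric.infDist_le_dist_of_mem hy')

theorem weak_limit {E : Type*} [NormedAddCommGroup E] [InnerProductSpace ℝ E] [CompleteSpace E]
    (G : ℕ → E) (K : ℝ) (hG : ∀ n, ‖G n‖ ≤ K) :
    ∃ g : E, ∀ (φ : E) (a : ℝ), Filter.Tendsto (fun n => ⟪φ, G n⟫) Filter.atTop (nhds a) →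
      ⟪φ, g⟫ = a := by
  let F : ℕ → WeakDual ℝ E := fun n => StrongDual.toWeakDual (InnerProductSpace.toDual ℝ E (G n))
  have hcomp := WeakDual.isCompact_closedBall (𝕜 := ℝ) (0 : StrongDual ℝ E) K
  have hmem : ∀ n, F n ∈ (WeakDual.toStrongDual ⁻¹' Metric.closedBall (0 : StrongDual ℝ E) K) := by
    intro n
    simp only [mem_preimage, Metric.mem_closedBall, dist_zero_right]
    change ‖InnerProductSpace.toDual ℝ E (G n)‖ ≤ K
    rw [LinearIsometryEquiv.norm_map]; exact hG n
  obtain ⟨f, -, hf⟩ := hcomp.exists_mapClusterPt (f := Filter.atTop) (u := F)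
    (by simp only [Filter.le_principal_iff, Filter.mem_map]; exact Filter.univ_mem' hmem)
  refine ⟨(InnerProductSpace.toDual ℝ E).symm (WeakDual.toStrongDual f), fun φ a h => ?_⟩
  rw [real_inner_comm, InnerProductSpace.toDual_symm_apply]
  have hc : MapClusterPt (f φ) Filter.atTop (fun n => F n φ) :=
    hf.continuousAt_comp (WeakDual.eval_continuous φ).continuousAt
  have he : (fun n => F n φ) = fun n => ⟪φ, G n⟫ := by
    funext n
    rw [real_inner_comm]
    rfl
  rw [he] at hc
  have : (nhds (f φ) ⊓ nhds a).NeBot := Filter.NeBot.mono hc (inf_le_inf le_rfl h)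
  exact eq_of_nhds_neBot this

theorem proxReg_ineq {r : ℝ≥0∞} {S : Set H} (h : IsProxRegular r S) {x v y : H} (hx : x ∈ S)
    (hv : v ∈ proxNormalCone S x) (hy : y ∈ S) :
    ⟪v, y - x⟫ ≤ ((2 * r)⁻¹).toReal * ‖v‖ * ‖y - x‖ ^ 2 := by
  by_cases h0 : v = 0
  · simp [h0]
  have h1 := h x hx v hv h0 y hy
  have hn : 0 < ‖v‖ := norm_pos_iff.2 h0
  rw [real_inner_smul_left, inv_mul_le_iff₀ hn] at h1
  linarith

theorem mem_proxNormalCone_of_nearest {S : Set H} {w u : H}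
    (h : ∀ y ∈ S, ‖w - u‖ ≤ ‖w - y‖) : w - u ∈ proxNormalCone S u := by
  refine ⟨1 / 2, by norm_num, 1, one_pos, fun y hy => ?_⟩
  have h1 := h y hy.1
  have h2 : w - y = (w - u) - (y - u) := by abel
  have h3 : ‖w - u‖ ^ 2 ≤ ‖w - y‖ ^ 2 := by gcongr
  rw [h2, norm_sub_sq_real (w - u) (y - u)] at h3
  linarith

theorem mem_proxNormalCone_of_le {S : Set H} {x v : H} {σ : ℝ}
    (h : ∀ y ∈ S, ⟪v, y - x⟫ ≤ σ * ‖y - x‖ ^ 2) : v ∈ proxNormalCone S x := by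
  refine ⟨|σ|, abs_nonneg _, 1, one_pos, fun y hy => (h y hy.1).trans ?_⟩
  gcongr
  exact le_abs_self σ

theorem step_geom {A ε δ : ℝ} (hA : 0 ≤ A) (hδ0 : 0 < δ) (hδε : δ ≤ ε) (hε1 : ε ≤ 1)
    {S' : Set H} (hcl : IsClosed S')
    (hpr : ∀ x ∈ S', ∀ v ∈ proxNormalCone S' x, ∀ y ∈ S', ⟪v, y - x⟫ ≤ A * ‖v‖ * ‖y - x‖ ^ 2)
    (u : H) (hu : ∃ y ∈ S', ‖u - y‖ ≤ δ) :
    ∃ q : H, ‖q‖ ≤ 3 ∧ u + δ • q ∈ S' ∧ ∀ S : Set H,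
      (∀ y ∈ S, ∃ y' ∈ S', ‖y - y'‖ ≤ δ) → (∀ y ∈ S', ∃ y' ∈ S, ‖y - y'‖ ≤ δ) →
      ∀ τ : ℝ, 0 ≤ τ → τ ≤ δ →
        (∃ y ∈ S, ‖u + τ • q - y‖ ≤ 4 * ε) ∧
        ∀ y ∈ S, ⟪-q, y - (u + τ • q)⟫ ≤ (4 * A + 2) * ‖y - (u + τ • q)‖ ^ 2 + (64 * A + 45) * ε := by
  obtain ⟨y0, hy0, hy0d⟩ := hu
  have hε0 : 0 < ε := lt_of_lt_of_le hδ0 hδε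
  obtain ⟨w, hw, u', hu', hnear⟩ := dense_nearest hcl ⟨y0, hy0⟩ u (mul_pos hε0 hδ0)
  have hwδ : ‖w - u‖ ≤ δ := hw.trans (by nlinarith)
  have hwu' : ‖w - u'‖ ≤ 2 * δ := by
    have h1 := hnear y0 hy0
    have h2 : w - y0 = (w - u) + (u - y0) := by abel
    have h3 := norm_add_le (w - u) (u - y0)
    rw [← h2] at h3
    linarith
  have huu' : ‖u' - u‖ ≤ 3 * δ := by
    have h2 : u' - u = (w - u) - (w - u') := by abel
    rw [h2]
    exact (norm_sub_le _ _).trans (by linarith)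
  set q := δ⁻¹ • (u' - u) with hq
  have hδq : δ • q = u' - u := by rw [hq, smul_smul, mul_inv_cancel₀ hδ0.ne', one_smul]
  have hqn : ‖q‖ ≤ 3 := by
    rw [hq, norm_smul, norm_inv, Real.norm_eq_abs, abs_of_pos hδ0, inv_mul_le_iff₀ hδ0]
    linarith
  have hnorm : ∀ y ∈ S', ⟪-q, y - u'⟫ ≤ (2 * A + 1) * ‖y - u'‖ ^ 2 + ε := by
    intro y hy
    have h1 := hpr u' hu' (w - u') (mem_proxNormalCone_of_nearest hnear) y hy
    have h2 : -q = δ⁻¹ • (w - u') + δ⁻¹ • (u - w) := by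
      rw [hq, ← smul_add, ← smul_neg]; congr 1; abel
    rw [h2, inner_add_left, real_inner_smul_left, real_inner_smul_left]
    have h3 : δ⁻¹ * ⟪w - u', y - u'⟫ ≤ 2 * A * ‖y - u'‖ ^ 2 := by
      rw [inv_mul_le_iff₀ hδ0]
      have : A * ‖w - u'‖ * ‖y - u'‖ ^ 2 ≤ A * (2 * δ) * ‖y - u'‖ ^ 2 := by gcongr
      linarith
    have h4 : δ⁻¹ * ⟪u - w, y - u'⟫ ≤ ε * ‖y - u'‖ := by
      rw [inv_mul_le_iff₀ hδ0]
      have h5 := real_inner_le_norm (u - w) (y - u')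
      rw [norm_sub_rev u w] at h5
      have : ‖w - u‖ * ‖y - u'‖ ≤ ε * δ * ‖y - u'‖ := by gcongr
      linarith
    nlinarith [sq_nonneg (‖y - u'‖ - 1), sq_nonneg ‖y - u'‖, sq_nonneg (‖y - u'‖)]
  refine ⟨q, hqn, by rw [hδq]; simpa using hu', fun S hS1 hS2 τ hτ0 hτδ => ?_⟩
  set x := u + τ • q with hx
  have hxu' : ‖x - u'‖ ≤ 3 * δ := by
    have : x - u' = (τ - δ) • q := by
      rw [hx, sub_smul, hδq]; abel
    rw [this, norm_smul, Real.norm_eq_abs, abs_of_nonpos (by linarith)]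
    nlinarith [norm_nonneg q]
  constructor
  · obtain ⟨y', hy', hd⟩ := hS2 u' hu'
    refine ⟨y', hy', ?_⟩
    have : x - y' = (x - u') + (u' - y') := by abel
    rw [this]
    exact (norm_add_le _ _).trans (by linarith)
  · intro y hy
    obtain ⟨y', hy', hd⟩ := hS1 y hy
    have h1 := hnorm y' hy'
    have h2 : y - x = (y' - u') + ((y - y') + (u' - x)) := by abel
    have h3 : ‖(y - y') + (u' - x)‖ ≤ 4 * δ := by
      have := norm_add_le (y - y') (u' - x)
      rw [norm_sub_rev u' x] at this
      linarith
    have h4 : ⟪-q, y - x⟫ ≤ ⟪-q, y' - u'⟫ + 12 * δ := by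
      rw [h2, inner_add_right]
      have := real_inner_le_norm (-q) ((y - y') + (u' - x))
      rw [norm_neg] at this
      have : ‖q‖ * ‖(y - y') + (u' - x)‖ ≤ 3 * (4 * δ) := by gcongr
      linarith
    have h5 : ‖y' - u'‖ ≤ ‖y - x‖ + 4 * δ := by
      have e : y' - u' = (y - x) - ((y - y') + (u' - x)) := by abel
      rw [e]
      exact (norm_sub_le _ _).trans (by linarith)
    have h6 : ‖y' - u'‖ ^ 2 ≤ 2 * ‖y - x‖ ^ 2 + 32 * ε := by
      have : ‖y' - u'‖ ^ 2 ≤ (‖y - x‖ + 4 * δ) ^ 2 := by gcongr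
      nlinarith [sq_nonneg (‖y - x‖ - 4 * δ)]
    have h7 : (2 * A + 1) * ‖y' - u'‖ ^ 2 ≤ (2 * A + 1) * (2 * ‖y - x‖ ^ 2 + 32 * ε) := by gcongr
    nlinarith

/-- Path with velocity `γ • g`. -/
def pathOf (T0 : ℝ) (γ : ℝ → ℝ) (x0 : H) (g : ℝ → H) (t : ℝ) : H :=
  x0 + ∫ s in T0..t, γ s • g s

/-- `ε`-approximate solutions on `[T0, b]`. -/
def ApproxSol (T0 : ℝ) (D : ℝ → Set H) (γ : ℝ → ℝ) (A ε : ℝ) (x0 : H) (b : ℝ) (g : ℝ → H) : Prop :=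
  StronglyMeasurable g ∧ (∀ t, ‖g t‖ ≤ 3) ∧
  (∀ t ∈ Icc T0 b, ∃ y ∈ D t, ‖pathOf T0 γ x0 g t - y‖ ≤ ε) ∧
  (∀ t ∈ Ioc T0 b, ∀ y ∈ D t, ⟪-g t, y - pathOf T0 γ x0 g t⟫
    ≤ A * ‖y - pathOf T0 γ x0 g t‖ ^ 2 + ε)

/-- Hypotheses on the moving set. -/
structure MovingSet (T0 T : ℝ) (D : ℝ → Set H) (γ : ℝ → ℝ) (A : ℝ) : Prop where
  hA : 0 ≤ A
  closed : ∀ t ∈ Icc T0 T, IsClosed (D t)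
  pr : ∀ t ∈ Icc T0 T, ∀ x ∈ D t, ∀ v ∈ proxNormalCone (D t) x, ∀ y ∈ D t,
    ⟪v, y - x⟫ ≤ A * ‖v‖ * ‖y - x‖ ^ 2
  int : IntervalIntegrable γ volume T0 T
  one_le : ∀ t, 1 ≤ γ t
  move : ∀ s ∈ Icc T0 T, ∀ t ∈ Icc T0 T, ∀ y ∈ D t, ∃ y' ∈ D s,
    ‖y - y'‖ ≤ |(∫ u in T0..s, γ u) - ∫ u in T0..t, γ u|

theorem ii_smul_bdd {γ : ℝ → ℝ} {g : ℝ → H} {a b K : ℝ} (hγ : IntervalIntegrable γ volume a b)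
    (hg : StronglyMeasurable g) (hb : ∀ t, ‖g t‖ ≤ K) :
    IntervalIntegrable (fun s => γ s • g s) volume a b := by
  rw [intervalIntegrable_iff] at hγ ⊢
  exact hγ.smul_bdd K hg.aestronglyMeasurable (Filter.Eventually.of_forall hb)

theorem V_sub {γ : ℝ → ℝ} {T0 T s t : ℝ} (hγ : IntervalIntegrable γ volume T0 T)
    (hs : T0 ≤ s) (hst : s ≤ t) (ht : t ≤ T) :
    (∫ u in T0..t, γ u) - ∫ u in T0..s, γ u = ∫ u in s..t, γ u := by
  rw [← intervalIntegral.integral_add_adjacent_intervals (ii_mono hγ le_rfl hs (by linarith))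
      (ii_mono hγ hs hst ht)]; ring

theorem V_lt {γ : ℝ → ℝ} {T0 T s t : ℝ} (hγ : IntervalIntegrable γ volume T0 T)
    (h1 : ∀ t, 1 ≤ γ t) (hs : T0 ≤ s) (hst : s ≤ t) (ht : t ≤ T) :
    t - s ≤ (∫ u in T0..t, γ u) - ∫ u in T0..s, γ u := by
  rw [V_sub hγ hs hst ht]
  have : ∫ u in s..t, (1 : ℝ) = t - s := by simp
  rw [← this]
  exact intervalIntegral.integral_mono_on hst (by simp) (ii_mono hγ hs hst ht) fun u _ => h1 u

theorem approx_extend {T0 T A ε : ℝ} {D : ℝ → Set H} {γ : ℝ → ℝ} (hD : MovingSet T0 T D γ A)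
    (hε1 : ε ≤ 1) {x0 : H} {b b' : ℝ} {g : ℝ → H} (hb : T0 ≤ b) (hbb' : b < b')
    (hb' : b' ≤ T) (hV : (∫ u in T0..b', γ u) - ∫ u in T0..b, γ u ≤ ε)
    (hg : ApproxSol T0 D γ (4 * A + 2) ((64 * A + 45) * ε) x0 b g)
    (hgb : pathOf T0 γ x0 g b ∈ D b) :
    ∃ g', ApproxSol T0 D γ (4 * A + 2) ((64 * A + 45) * ε) x0 b' g' ∧
      pathOf T0 γ x0 g' b' ∈ D b' := by
  obtain ⟨hgm, hg3, hgd, hgn⟩ := hg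
  set V : ℝ → ℝ := fun t => ∫ u in T0..t, γ u with hVd
  have hbm : b ∈ Icc T0 T := ⟨hb, by linarith⟩
  have hbm' : b' ∈ Icc T0 T := ⟨by linarith, hb'⟩
  set u := pathOf T0 γ x0 g b with hu
  have hδ0 : 0 < V b' - V b := by
    have := V_lt hD.int hD.one_le hb hbb'.le hb'
    simp only [hVd]; linarith
  have hε0 : 0 < ε := lt_of_lt_of_le hδ0 hV
  obtain ⟨q, hq3, hq', hstep⟩ := step_geom hD.hA hδ0 hV hε1 (hD.closed b' hbm') (hD.pr b' hbm') u (by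
    obtain ⟨y', hy', h⟩ := hD.move b' hbm' b hbm u hgb
    exact ⟨y', hy', h.trans (by rw [abs_of_pos hδ0])⟩)
  set g' : ℝ → H := fun t => if t ≤ b then g t else q with hg'
  have hgm' : StronglyMeasurable g' := StronglyMeasurable.ite measurableSet_Iic hgm
    stronglyMeasurable_const
  have hg3' : ∀ t, ‖g' t‖ ≤ 3 := by
    intro t; simp only [hg']; split_ifs
    · exact hg3 t
    · exact hq3
  have hp1 : ∀ t ∈ Icc T0 b, pathOf T0 γ x0 g' t = pathOf T0 γ x0 g t := by
    intro t ht
    unfold pathOf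
    congr 1
    apply intervalIntegral.integral_congr
    intro s hs
    rw [uIcc_of_le ht.1] at hs
    simp only [hg', if_pos (hs.2.trans ht.2)]
  have hp2 : ∀ t ∈ Icc b b', pathOf T0 γ x0 g' t = u + (V t - V b) • q := by
    intro t ht
    have e1 : u = x0 + ∫ s in T0..b, γ s • g' s := (hp1 b ⟨hb, le_rfl⟩).symm
    have hi := ii_smul_bdd hD.int hgm' hg3'
    have e2 : ∫ s in b..t, γ s • g' s = (V t - V b) • q := by
      have : ∫ s in b..t, γ s • g' s = ∫ s in b..t, γ s • q := by
        apply intervalIntegral.integral_congr_ae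
        refine Filter.Eventually.of_forall fun s hs => ?_
        rw [uIoc_of_le ht.1] at hs
        simp only [hg', if_neg (not_le.2 hs.1)]
      rw [this, intervalIntegral.integral_smul_const, V_sub hD.int hb ht.1 (ht.2.trans hb')]
    rw [e1, ← e2, add_assoc, intervalIntegral.integral_add_adjacent_intervals
      (ii_mono hi le_rfl hb hbm.2) (ii_mono hi hb ht.1 (ht.2.trans hb'))]
    rfl
  have hext : ∀ t ∈ Ioc b b', (∃ y ∈ D t, ‖u + (V t - V b) • q - y‖ ≤ 4 * ε) ∧
        ∀ y ∈ D t, ⟪-q, y - (u + (V t - V b) • q)⟫ ≤ (4 * A + 2) * ‖y - (u + (V t - V b) • q)‖ ^ 2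
          + (64 * A + 45) * ε := by
    intro t ht
    have htm : t ∈ Icc T0 T := ⟨by linarith [ht.1], ht.2.trans hb'⟩
    have m1 := V_lt hD.int hD.one_le hb ht.1.le htm.2
    have m2 := V_lt hD.int hD.one_le htm.1 ht.2 hb'
    have l1 := ht.1
    have l2 := ht.2
    have m1' : t - b ≤ V t - V b := m1
    have m2' : b' - t ≤ V b' - V t := m2
    refine hstep (D t) ?_ ?_ _ (by linarith) (by linarith)
    · intro y hy
      obtain ⟨y', hy', h⟩ := hD.move b' hbm' t htm y hy
      refine ⟨y', hy', h.trans ?_⟩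
      change |V b' - V t| ≤ _
      rw [abs_of_nonneg (by linarith)]; linarith
    · intro y hy
      obtain ⟨y', hy', h⟩ := hD.move t htm b' hbm' y hy
      refine ⟨y', hy', h.trans ?_⟩
      change |V t - V b'| ≤ _
      rw [abs_of_nonpos (by linarith)]; linarith
  refine ⟨g', ⟨hgm', hg3', ?_, ?_⟩, ?_⟩
  · intro t ht
    rcases le_or_gt t b with h | h
    · rw [hp1 t ⟨ht.1, h⟩]; exact hgd t ⟨ht.1, h⟩
    · rw [hp2 t ⟨h.le, ht.2⟩]
      obtain ⟨y, hy, hd⟩ := (hext t ⟨h, ht.2⟩).1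
      exact ⟨y, hy, hd.trans (by nlinarith [hD.hA])⟩
  · intro t ht y hy
    rcases le_or_gt t b with h | h
    · rw [hp1 t ⟨ht.1.le, h⟩]
      simp only [hg', if_pos h]
      exact hgn t ⟨ht.1, h⟩ y hy
    · rw [hp2 t ⟨h.le, ht.2⟩]
      simp only [hg', if_neg (not_le.2 h)]
      exact (hext t ⟨h, ht.2⟩).2 y hy
  · rw [hp2 b' ⟨hbb'.le, le_rfl⟩]
    exact hq'

theorem approx_exists {T0 T A : ℝ} (hT : T0 < T) {D : ℝ → Set H} {γ : ℝ → ℝ}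
    (hD : MovingSet T0 T D γ A) {x0 : H} (hx0 : x0 ∈ D T0) {ε : ℝ} (hε : 0 < ε) :
    ∃ g, ApproxSol T0 D γ (4 * A + 2) ε x0 T g := by
  have hA := hD.hA
  set ε' := min 1 (ε / (64 * A + 45)) with hε'
  have hε'0 : 0 < ε' := by rw [hε']; positivity
  have hε'1 : ε' ≤ 1 := min_le_left _ _
  have hε'2 : (64 * A + 45) * ε' ≤ ε := by
    rw [mul_comm, ← le_div_iff₀ (by positivity)]; exact min_le_right _ _
  have huc := (hD.int.absolutelyContinuousOnInterval_intervalIntegral (c := T0)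
    (by simp)).uniformContinuousOn
  rw [uIcc_of_le hT.le, Metric.uniformContinuousOn_iff] at huc
  obtain ⟨δ, hδ, huc⟩ := huc ε' hε'0
  obtain ⟨N, hN⟩ := exists_nat_gt ((T - T0) / δ)
  have hN0 : (0 : ℝ) < N := lt_trans (div_pos (by linarith) hδ) hN
  have hh : (T - T0) / N < δ := by
    rw [div_lt_iff₀ hN0]; rw [div_lt_iff₀ hδ] at hN; linarith
  set h := (T - T0) / N with hhd
  have hh0 : 0 < h := div_pos (by linarith) hN0
  have hNh : N * h = T - T0 := by rw [hhd]; field_simp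
  have main : ∀ i : ℕ, i ≤ N → ∃ g, ApproxSol T0 D γ (4 * A + 2) ((64 * A + 45) * ε') x0
      (T0 + i * h) g ∧ pathOf T0 γ x0 g (T0 + i * h) ∈ D (T0 + i * h) := by
    intro i
    induction i with
    | zero =>
      intro _
      have hp : pathOf T0 γ x0 (fun _ => 0) T0 = x0 := by simp [pathOf]
      refine ⟨fun _ => 0, ⟨stronglyMeasurable_const, by simp, ?_, ?_⟩, ?_⟩
      · intro t ht
        have : t = T0 := by simpa using ht
        subst this
        refine ⟨x0, hx0, ?_⟩
        rw [hp, sub_self, norm_zero]; positivity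
      · intro t ht
        simp at ht
      · simpa [pathOf] using hx0
    | succ i ih =>
      intro hi
      obtain ⟨g, hg, hgb⟩ := ih (by omega)
      have hi' : ((i + 1 : ℕ) : ℝ) ≤ N := by exact_mod_cast hi
      push_cast at hi' ⊢
      have hi0 : (0 : ℝ) ≤ i := by positivity
      have b1 : T0 ≤ T0 + i * h := by nlinarith
      have b2 : T0 + (i + 1) * h ≤ T := by nlinarith
      refine approx_extend hD hε'1 b1 (by nlinarith) b2 ?_ hg hgb
      have := huc (T0 + (i + 1) * h) ⟨by nlinarith, b2⟩ (T0 + i * h) ⟨b1, by nlinarith⟩ (by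
        rw [Real.dist_eq]
        have : T0 + (i + 1) * h - (T0 + i * h) = h := by ring
        rw [this, abs_of_pos hh0]; exact hh)
      rw [Real.dist_eq] at this
      exact (le_abs_self _).trans this.le
  obtain ⟨g, ⟨h1, h2, h3, h4⟩, -⟩ := main N le_rfl
  have hTe : T0 + N * h = T := by linarith
  rw [hTe] at h3 h4
  refine ⟨g, h1, h2, fun t ht => ?_, fun t ht y hy => ?_⟩
  · obtain ⟨y, hy, hd⟩ := h3 t ht
    exact ⟨y, hy, hd.trans hε'2⟩
  · exact (h4 t ht y hy).trans (by linarith)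

theorem ii_inner {z z' : ℝ → H} {a b : ℝ} (hab : a ≤ b) (hz' : IntervalIntegrable z' volume a b)
    (hc : ContinuousOn z (Icc a b)) :
    IntervalIntegrable (fun s => ⟪z' s, z s⟫) volume a b := by
  obtain ⟨K, hK⟩ := isCompact_Icc.exists_bound_of_continuousOn hc
  have h1 := hz'.norm.mul_const K
  rw [intervalIntegrable_iff_integrableOn_Ioc_of_le hab] at hz' h1 ⊢
  refine Integrable.mono' h1 (hz'.aestronglyMeasurable.inner ?_) ?_
  · exact ((hc.mono Ioc_subset_Icc_self).aestronglyMeasurable measurableSet_Ioc)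
  · rw [ae_restrict_iff' measurableSet_Ioc]
    refine Filter.Eventually.of_forall fun s hs => ?_
    refine (norm_inner_le_norm _ _).trans ?_
    exact mul_le_mul_of_nonneg_left (hK s (Ioc_subset_Icc_self hs)) (norm_nonneg _)

theorem pathOf_T0 (T0 : ℝ) (γ : ℝ → ℝ) (x0 : H) (g : ℝ → H) : pathOf T0 γ x0 g T0 = x0 := by
  simp [pathOf]

theorem approx_compare {T0 T A ε1 ε2 : ℝ} (hT : T0 < T) {D : ℝ → Set H} {γ : ℝ → ℝ}
    (hA : 0 ≤ A) (hγ : IntervalIntegrable γ volume T0 T) (hγ1 : ∀ t, 1 ≤ γ t)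
    {x0 : H} {g1 g2 : ℝ → H} (h1 : ApproxSol T0 D γ A ε1 x0 T g1)
    (h2 : ApproxSol T0 D γ A ε2 x0 T g2) (he1 : 0 ≤ ε1) (he1' : ε1 ≤ 1) (he2 : 0 ≤ ε2)
    (he2' : ε2 ≤ 1) : ∀ t ∈ Icc T0 T,
    ‖pathOf T0 γ x0 g1 t - pathOf T0 γ x0 g2 t‖ ^ 2 ≤
      (ε1 + ε2) / 4 * Real.exp (7 * ∫ u in T0..T, (4 * A + 8) * γ u) := by
  set z : ℝ → H := fun t => pathOf T0 γ x0 g1 t - pathOf T0 γ x0 g2 t with hz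
  set z' : ℝ → H := fun t => γ t • g1 t - γ t • g2 t with hz'
  have i1 := ii_smul_bdd hγ h1.1 h1.2.1
  have i2 := ii_smul_bdd hγ h2.1 h2.2.1
  have hi : IntervalIntegrable z' volume T0 T := i1.sub i2
  have z0 : z T0 = 0 := by simp [hz, pathOf_T0]
  have hzz : ∀ t ∈ Icc T0 T, z t = z T0 + ∫ s in T0..t, z' s := by
    intro t ht
    rw [z0, zero_add, hz', intervalIntegral.integral_sub (ii_mono i1 le_rfl ht.1 ht.2)
      (ii_mono i2 le_rfl ht.1 ht.2)]
    simp [hz, pathOf]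
  have hzc := path_continuousOn hT.le hi hzz
  have hsq := path_normSq hT.le hi hzz
  have hω : IntervalIntegrable (fun u => (4 * A + 8) * γ u) volume T0 T := hγ.const_mul _
  have hnn : ∀ t ∈ Icc T0 T, 0 ≤ (4 * A + 8) * γ t := by
    intro t _; have := hγ1 t; positivity
  have hzc2 : ContinuousOn (fun t => ‖z t‖ ^ 2) (Icc T0 T) := hzc.norm.pow 2
  have hWc : ContinuousOn (fun t => ∫ u in T0..t, (4 * A + 8) * γ u) (Icc T0 T) := by
    have := (hω.absolutelyContinuousOnInterval_intervalIntegral (c := T0) (by simp)).continuousOn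
    rwa [uIcc_of_le hT.le] at this
  have hmain := gronwall_W (c := ε1 + ε2) hT.le (by linarith) hω hnn hzc2 (by
    intro t ht
    rw [hsq t ht, z0]
    simp only [norm_zero, ne_eq, OfNat.ofNat_ne_zero, not_false_eq_true, zero_pow, zero_add]
    refine intervalIntegral.integral_mono_on_of_le_Ioo ht.1
      (ii_mono ((ii_inner hT.le hi hzc).const_mul 2) le_rfl ht.1 ht.2) ?_ ?_
    · refine ii_mono (hω.mul_continuousOn ?_) le_rfl ht.1 ht.2
      rw [uIcc_of_le hT.le]
      exact (hzc2.const_mul 3).add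
        (continuousOn_const.mul (Real.continuous_exp.comp_continuousOn (hWc.const_mul 7)))
    intro s hs
    have hsI : s ∈ Icc T0 T := ⟨hs.1.le, hs.2.le.trans ht.2⟩
    have hsO : s ∈ Ioc T0 T := ⟨hs.1, hs.2.le.trans ht.2⟩
    have key : ∀ (e e' : ℝ) (g g' p p' : H), 0 ≤ e → e ≤ 1 → 0 ≤ e' → e' ≤ 1 → ‖g‖ ≤ 3 →
        (∃ y ∈ D s, ‖p' - y‖ ≤ e') → (∀ y ∈ D s, ⟪-g, y - p⟫ ≤ A * ‖y - p‖ ^ 2 + e) →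
        ⟪g, p - p'⟫ ≤ 2 * A * ‖p - p'‖ ^ 2 + (2 * A + 3) * e' + e := by
      rintro e e' g g' p p' k1 k2 k3 k4 hg ⟨y, hy, hd⟩ hn
      have h := hn y hy
      have e1 : y - p = -(p - p') + (y - p') := by abel
      have e2 : ⟪-g, y - p⟫ = ⟪g, p - p'⟫ - ⟪g, y - p'⟫ := by
        rw [e1, inner_add_right, inner_neg_neg, inner_neg_left]; ring
      have e3 : ⟪g, y - p'⟫ ≤ 3 * e' := by
        refine (real_inner_le_norm _ _).trans ?_
        rw [norm_sub_rev]; gcongr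
      have e4 : ‖y - p‖ ≤ ‖p - p'‖ + e' := by
        rw [e1]; refine (norm_add_le _ _).trans ?_
        rw [norm_neg, norm_sub_rev y]; linarith
      have e5 : ‖y - p‖ ^ 2 ≤ 2 * ‖p - p'‖ ^ 2 + 2 * e' := by
        have : ‖y - p‖ ^ 2 ≤ (‖p - p'‖ + e') ^ 2 := by gcongr
        nlinarith [sq_nonneg (‖p - p'‖ - e')]
      have e6 : A * ‖y - p‖ ^ 2 ≤ A * (2 * ‖p - p'‖ ^ 2 + 2 * e') := by gcongr
      nlinarith
    have k1 := key ε1 ε2 _ 0 _ _ he1 he1' he2 he2' (h1.2.1 s) (h2.2.2.1 s hsI) (h1.2.2.2 s hsO)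
    have k2 := key ε2 ε1 _ 0 _ _ he2 he2' he1 he1' (h2.2.1 s) (h1.2.2.1 s hsI) (h2.2.2.2 s hsO)
    rw [norm_sub_rev] at k2
    have e1 : ⟪z' s, z s⟫ = γ s * (⟪g1 s, z s⟫ + ⟪g2 s, pathOf T0 γ x0 g2 s - pathOf T0 γ x0 g1 s⟫) := by
      have : pathOf T0 γ x0 g2 s - pathOf T0 γ x0 g1 s = -z s := by simp [hz]
      rw [this, hz']
      simp only [inner_sub_left, real_inner_smul_left, inner_neg_right]; ring
    have hγs := hγ1 s
    have hexp : 1 ≤ Real.exp (7 * ∫ u in T0..s, (4 * A + 8) * γ u) := by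
      apply Real.one_le_exp
      have := integral_mono_W hω hnn le_rfl hs.1.le (hs.2.le.trans ht.2)
      rw [intervalIntegral.integral_same] at this
      linarith
    have e2 : ⟪g1 s, z s⟫ + ⟪g2 s, pathOf T0 γ x0 g2 s - pathOf T0 γ x0 g1 s⟫ ≤
      4 * A * ‖z s‖ ^ 2 + (2 * A + 4) * (ε1 + ε2) := by
      have : (2 * A + 4) * (ε1 + ε2) ≥ (2 * A + 3) * (ε1 + ε2) + (ε1 + ε2) := by nlinarith
      simp only [hz]
      nlinarith
    have e3 : (ε1 + ε2) ≤ (ε1 + ε2) * Real.exp (7 * ∫ u in T0..s, (4 * A + 8) * γ u) :=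
      le_mul_of_one_le_right (by linarith) hexp
    have hzn := sq_nonneg ‖z s‖
    have e4 : 2 * (4 * A * ‖z s‖ ^ 2 + (2 * A + 4) * (ε1 + ε2)) ≤
      (4 * A + 8) * (3 * ‖z s‖ ^ 2 + (ε1 + ε2) * Real.exp (7 * ∫ u in T0..s, (4 * A + 8) * γ u)) := by
      have : (4 * A + 8) * (ε1 + ε2) ≤ (4 * A + 8) * ((ε1 + ε2) * Real.exp (7 * ∫ u in T0..s, (4 * A + 8) * γ u)) := by gcongr
      have : 0 ≤ A * ‖z s‖ ^ 2 := by positivity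
      nlinarith
    rw [e1]
    calc 2 * (γ s * _) = γ s * (2 * _) := by ring
      _ ≤ γ s * _ := mul_le_mul_of_nonneg_left ((mul_le_mul_of_nonneg_left e2 zero_le_two).trans e4) (by linarith)
      _ = _ := by ring)
  intro t ht
  refine (hmain t ht).trans ?_
  have := integral_mono_W hω hnn ht.1 ht.2 le_rfl
  gcongr

theorem rnp_limit {T0 T : ℝ} (hT : T0 < T) {γ : ℝ → ℝ}
    (hγ : IntervalIntegrable γ volume T0 T) (hγ1 : ∀ t, 1 ≤ γ t) {x0 : H} {g : ℕ → ℝ → H}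
    (hgm : ∀ n, StronglyMeasurable (g n)) (hg3 : ∀ n t, ‖g n t‖ ≤ 3) {x : ℝ → H}
    (hx : ∀ t ∈ Icc T0 T, Filter.Tendsto (fun n => pathOf T0 γ x0 (g n) t) Filter.atTop (nhds (x t))) :
    ∃ x' : ℝ → H, IntervalIntegrable x' volume T0 T ∧
      ∀ t ∈ Icc T0 T, x t = x T0 + ∫ s in T0..t, x' s := by
  set μ : Measure ℝ := volume.restrict (Ioc T0 T) with hμ
  have hγi : Integrable γ μ := by
    rwa [intervalIntegrable_iff_integrableOn_Ioc_of_le hT.le] at hγ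
  have hsqm : AEStronglyMeasurable (fun t => √(γ t)) μ :=
    Real.continuous_sqrt.comp_aestronglyMeasurable hγi.aestronglyMeasurable
  have hγ0 : ∀ t, 0 ≤ γ t := fun t => zero_le_one.trans (hγ1 t)
  have memLp_bdd : ∀ (f : ℝ → H) (K : ℝ), StronglyMeasurable f → (∀ t, ‖f t‖ ≤ K) →
      MemLp (fun t => √(γ t) • f t) 2 μ := by
    intro f K hf hK
    have hm : AEStronglyMeasurable (fun t => √(γ t) • f t) μ := hsqm.smul hf.aestronglyMeasurable
    rw [memLp_two_iff_integrable_sq_norm hm]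
    refine Integrable.mono' (hγi.mul_const (K ^ 2)) (hm.norm.pow 2) (Filter.Eventually.of_forall fun t => ?_)
    rw [norm_smul, mul_pow, Real.norm_of_nonneg (Real.sqrt_nonneg _), Real.sq_sqrt (hγ0 t),
      Real.norm_of_nonneg (mul_nonneg (hγ0 t) (sq_nonneg _))]
    have := hγ0 t
    have := hK t
    gcongr
  have hGm := fun n => memLp_bdd (g n) 3 (hgm n) (hg3 n)
  have hGb : ∀ n, ‖(hGm n).toLp‖ ≤ √(∫ t, γ t * 9 ∂μ) := by
    intro n
    apply Real.le_sqrt_of_sq_le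
    rw [← real_inner_self_eq_norm_sq, L2.inner_def]
    refine integral_mono_ae (L2.integrable_inner _ _) (hγi.mul_const 9) ?_
    filter_upwards [(hGm n).coeFn_toLp] with t ht
    rw [ht, real_inner_self_eq_norm_sq, norm_smul, mul_pow, Real.norm_of_nonneg (Real.sqrt_nonneg _), Real.sq_sqrt (hγ0 t)]
    have := hγ0 t
    have := hg3 n t
    have : ‖g n t‖ ^ 2 ≤ 3 ^ 2 := by gcongr
    nlinarith
  obtain ⟨G, hG⟩ := weak_limit _ _ hGb
  have hGL : MemLp (fun t => G t) 2 μ := Lp.memLp G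
  have hsqL : MemLp (fun t => √(γ t)) 2 μ := by
    rw [memLp_two_iff_integrable_sq_norm hsqm]
    refine hγi.congr (Filter.Eventually.of_forall fun t => ?_)
    simp only [Real.norm_of_nonneg (Real.sqrt_nonneg _), Real.sq_sqrt (hγ0 t)]
  have hx'i : Integrable (fun t => √(γ t) • G t) μ := by
    have := hGL.smul (p := 2) (q := 2) (r := 1) hsqL
    exact memLp_one_iff_integrable.1 this
  have hx'ii : IntervalIntegrable (fun t => √(γ t) • G t) volume T0 T := by
    rwa [intervalIntegrable_iff_integrableOn_Ioc_of_le hT.le]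
  have hxT0 : x T0 = x0 := by
    have := hx T0 ⟨le_rfl, hT.le⟩
    simp only [pathOf_T0] at this
    exact (tendsto_nhds_unique this tendsto_const_nhds)
  refine ⟨fun t => √(γ t) • G t, hx'ii, fun t ht => ?_⟩
  -- testing against indicator functions
  have hsub : Ioc T0 t ⊆ Ioc T0 T := Ioc_subset_Ioc_right ht.2
  have hres : μ.restrict (Ioc T0 t) = volume.restrict (Ioc T0 t) := by
    rw [hμ, Measure.restrict_restrict measurableSet_Ioc, inter_eq_left.2 hsub]
  have htest : ∀ (c : H) (F : Lp H 2 μ) (f : ℝ → H) (hF : F =ᵐ[μ] f)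
      (hfi : IntervalIntegrable (fun s => √(γ s) • f s) volume T0 t)
      (hφ : MemLp (fun s => √(γ s) • (Ioc T0 t).indicator (fun _ => c) s) 2 μ),
      ⟪hφ.toLp, F⟫ = ⟪c, ∫ s in T0..t, √(γ s) • f s⟫ := by
    intro c F f hF hfi hφ
    rw [L2.inner_def, intervalIntegral.integral_of_le ht.1, ← integral_inner, ← hres,
      ← integral_indicator (μ := μ) (s := Ioc T0 t) measurableSet_Ioc]
    · apply integral_congr_ae
      filter_upwards [hF, hφ.coeFn_toLp] with s h1 h2
      rw [h1, h2]
      by_cases hs : s ∈ Ioc T0 t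
      · simp only [indicator_of_mem hs, real_inner_smul_left, real_inner_smul_right]
      · simp [indicator_of_notMem hs]
    · rw [intervalIntegrable_iff_integrableOn_Ioc_of_le ht.1] at hfi
      exact hfi
  have hφ : ∀ c : H, MemLp (fun s => √(γ s) • (Ioc T0 t).indicator (fun _ => c) s) 2 μ := fun c =>
    memLp_bdd _ ‖c‖ (stronglyMeasurable_const.indicator measurableSet_Ioc)
      (fun s => norm_indicator_le_norm_self _ _)
  rw [hxT0]
  refine ext_inner_left ℝ fun c => ?_
  have hlim := hG (hφ c).toLp ⟪c, x t - x0⟫ (by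
    have h1 : ∀ n, ⟪(hφ c).toLp, (hGm n).toLp⟫ = ⟪c, pathOf T0 γ x0 (g n) t - x0⟫ := by
      intro n
      have e : (fun s => √(γ s) • √(γ s) • g n s) = fun s => γ s • g n s := by
        funext s; rw [smul_smul, Real.mul_self_sqrt (hγ0 s)]
      rw [htest c _ _ (hGm n).coeFn_toLp (by
        rw [e]; exact ii_mono (ii_smul_bdd hγ (hgm n) (hg3 n)) le_rfl ht.1 ht.2)]
      rw [e]; simp [pathOf]
    simp only [h1]
    exact (tendsto_const_nhds).inner ((hx t ht).sub_const x0))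
  rw [htest c G _ (Filter.EventuallyEq.rfl) (ii_mono hx'ii le_rfl ht.1 ht.2)] at hlim
  rw [inner_add_right, hlim, inner_sub_right]; ring

theorem right_deriv_nonpos {Φ : ℝ → ℝ} {d a b : ℝ} (hab : a < b) (h : HasDerivAt Φ d a)
    (hle : ∀ t ∈ Ioo a b, Φ t ≤ Φ a) : d ≤ 0 := by
  have h1 := (hasDerivWithinAt_iff_tendsto_slope' (s := Ioi a) (by simp)).1 h.hasDerivWithinAt
  refine le_of_tendsto h1 ?_
  filter_upwards [Ioo_mem_nhdsGT hab] with t ht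
  rw [slope_def_field]
  exact div_nonpos_of_nonpos_of_nonneg (by linarith [hle t ht]) (by linarith [ht.1])

theorem right_deriv_norm_le {z : ℝ → H} {V : ℝ → ℝ} {z' : H} {v a b : ℝ} (hab : a < b)
    (h : HasDerivAt z z' a) (hV : HasDerivAt V v a)
    (hle : ∀ t ∈ Ioo a b, ‖z t - z a‖ ≤ V t - V a) : ‖z'‖ ≤ v := by
  have h1 := (hasDerivWithinAt_iff_tendsto_slope' (s := Ioi a) (by simp)).1 h.hasDerivWithinAt
  have h2 := (hasDerivWithinAt_iff_tendsto_slope' (s := Ioi a) (by simp)).1 hV.hasDerivWithinAt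
  refine le_of_tendsto_of_tendsto h1.norm h2 ?_
  filter_upwards [Ioo_mem_nhdsGT hab] with t ht
  have h3 : 0 < t - a := by linarith [ht.1]
  rw [slope_def_field, slope_def_module, norm_smul, norm_inv, Real.norm_of_nonneg h3.le,
    inv_mul_eq_div]
  exact div_le_div_of_nonneg_right (hle t ht) h3.le

theorem V_hasDerivAt {T0 T : ℝ} (hT : T0 < T) {γ : ℝ → ℝ} (hγ : IntervalIntegrable γ volume T0 T) :
    ∀ᵐ t ∂volume, t ∈ Icc T0 T → t ∈ Ioo T0 T ∧ HasDerivAt (fun t => ∫ u in T0..t, γ u) (γ t) t :=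
  path_hasDerivAt hT.le hγ (by intro t ht; simp)

theorem approx_lipschitz {T0 T A ε : ℝ} (hT : T0 < T) {D : ℝ → Set H} {γ : ℝ → ℝ}
    (hγ : IntervalIntegrable γ volume T0 T) (hγ1 : ∀ t, 1 ≤ γ t)
    {x0 : H} {g : ℝ → H} (h1 : ApproxSol T0 D γ A ε x0 T g) {s t : ℝ} (hs : T0 ≤ s) (hst : s ≤ t)
    (ht : t ≤ T) : ‖pathOf T0 γ x0 g t - pathOf T0 γ x0 g s‖
      ≤ 3 * ((∫ u in T0..t, γ u) - ∫ u in T0..s, γ u) := by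
  have i1 := ii_smul_bdd hγ h1.1 h1.2.1
  have := path_dist i1 (hγ.const_mul 3) (z := pathOf T0 γ x0 g) (by
    intro t ht; rw [pathOf_T0]; rfl) (Filter.Eventually.of_forall (by
      intro u _
      have := h1.2.1 u
      have h0 := hγ1 u
      rw [norm_smul, Real.norm_of_nonneg (by linarith)]
      nlinarith)) hs hst ht
  rw [intervalIntegral.integral_const_mul, intervalIntegral.integral_const_mul] at this
  linarith

theorem approx_energy {T0 T A A' ε : ℝ} (hT : T0 < T) {D : ℝ → Set H} {γ : ℝ → ℝ}
    (hD : MovingSet T0 T D γ A) (hA' : 0 ≤ A')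
    {x0 : H} {g : ℝ → H} (h1 : ApproxSol T0 D γ A' ε x0 T g) {a t : ℝ} (ha : T0 ≤ a) (hat : a ≤ t)
    (ht : t ≤ T) {y : H} (hy : y ∈ D a) {ρ : ℝ} (hρ : ρ = (∫ u in T0..t, γ u) - ∫ u in T0..a, γ u) :
    ‖y - pathOf T0 γ x0 g t‖ ^ 2 - ‖y - pathOf T0 γ x0 g a‖ ^ 2 ≤
      2 * ρ * (A' * (‖y - pathOf T0 γ x0 g a‖ + 4 * ρ) ^ 2 + ε + 3 * ρ) := by
  have hγ := hD.int
  have i1 := ii_smul_bdd hγ h1.1 h1.2.1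
  have hpz : ∀ t ∈ Icc T0 T, pathOf T0 γ x0 g t = pathOf T0 γ x0 g T0 + ∫ s in T0..t, γ s • g s := by
    intro t ht; rw [pathOf_T0]; rfl
  set z : ℝ → H := fun s => y - pathOf T0 γ x0 g s with hz
  set z' : ℝ → H := fun s => -(γ s • g s) with hz'
  have hi : IntervalIntegrable z' volume a t := (ii_mono i1 ha hat ht).neg
  have hzz : ∀ s ∈ Icc a t, z s = z a + ∫ u in a..s, z' u := by
    intro s hs
    simp only [hz, hz', intervalIntegral.integral_neg]
    rw [path_restart i1 hpz ha hs.1 (hs.2.trans ht)]; abel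
  have hsq := path_normSq hat hi hzz t ⟨hat, le_rfl⟩
  have hzc := path_continuousOn hat hi hzz
  have hb : ∫ s in a..t, 2 * ⟪z' s, z s⟫ ≤ ∫ s in a..t, γ s * (2 * (A' * (‖z a‖ + 4 * ρ) ^ 2 + ε + 3 * ρ)) := by
    refine intervalIntegral.integral_mono_on_of_le_Ioo hat ((ii_inner hat hi hzc).const_mul 2)
      ((ii_mono hγ ha hat ht).mul_const _) ?_
    intro s hs
    have hsT : s ≤ T := hs.2.le.trans ht
    have haT : a ≤ T := hat.trans ht
    have hTs : T0 < s := lt_of_le_of_lt ha hs.1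
    have m1 : ∀ {p q : ℝ}, T0 ≤ p → p ≤ q → q ≤ T →
        ∫ u in T0..p, γ u ≤ ∫ u in T0..q, γ u := fun h1 h2 h3 =>
      integral_mono_W hγ (fun u _ => zero_le_one.trans (hD.one_le u)) h1 h2 h3
    have m2 := m1 ha hs.1.le hsT
    have m3 := m1 hTs.le hs.2.le ht
    obtain ⟨y', hy', hd⟩ := hD.move s ⟨hTs.le, hsT⟩ a ⟨ha, haT⟩ y hy
    rw [abs_of_nonneg (by linarith)] at hd
    have hd' : ‖y - y'‖ ≤ ρ := by linarith
    have hρ0 : 0 ≤ ρ := (norm_nonneg _).trans hd'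
    have hl := approx_lipschitz hT hγ hD.one_le h1 ha hs.1.le hsT
    have hn := h1.2.2.2 s ⟨hTs, hsT⟩ y' hy'
    set p := pathOf T0 γ x0 g with hp
    have hg := h1.2.1 s
    have e1 : y' - p s = (y - p s) - (y - y') := by abel
    have e2 : ⟪-g s, y' - p s⟫ = ⟪-g s, z s⟫ + ⟪g s, y - y'⟫ := by
      rw [e1, inner_sub_right, inner_neg_left (g s) (y - y')]; simp only [hz]; ring
    have e3 : -(3 * ρ) ≤ ⟪g s, y - y'⟫ := by
      have := (abs_le.1 (abs_real_inner_le_norm (g s) (y - y'))).1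
      have : ‖g s‖ * ‖y - y'‖ ≤ 3 * ρ := by gcongr
      linarith
    have e4 : ‖y' - p s‖ ≤ ‖z a‖ + 4 * ρ := by
      have e : y' - p s = z a - (y - y') - (p s - p a) := by simp only [hz]; abel
      rw [e]
      have := norm_sub_le (z a - (y - y')) (p s - p a)
      have := norm_sub_le (z a) (y - y')
      linarith
    have e5 : A' * ‖y' - p s‖ ^ 2 ≤ A' * (‖z a‖ + 4 * ρ) ^ 2 := by gcongr
    have e6 : ⟪-g s, z s⟫ ≤ A' * (‖z a‖ + 4 * ρ) ^ 2 + ε + 3 * ρ := by linarith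
    have e7 : ⟪z' s, z s⟫ = γ s * ⟪-g s, z s⟫ := by
      simp only [hz']; rw [← smul_neg, real_inner_smul_left]
    rw [e7]
    have := hD.one_le s
    nlinarith
  rw [intervalIntegral.integral_mul_const, ← V_sub hγ ha hat ht, ← hρ] at hb
  simp only [hz] at hsq hb ⊢
  linarith

theorem sweep_exists {T0 T A : ℝ} (hT : T0 < T) {D : ℝ → Set H} {γ : ℝ → ℝ}
    (hD : MovingSet T0 T D γ A) {x0 : H} (hx0 : x0 ∈ D T0) :
    ∃ x x' : ℝ → H, x T0 = x0 ∧ IntervalIntegrable x' volume T0 T ∧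
      (∀ t ∈ Icc T0 T, x t = x T0 + ∫ s in T0..t, x' s) ∧
      (∀ t ∈ Icc T0 T, x t ∈ D t) ∧
      (∀ᵐ t ∂volume, t ∈ Icc T0 T → -x' t ∈ proxNormalCone (D t) (x t) ∧ ‖x' t‖ ≤ 3 * γ t) := by
  have hA := hD.hA
  set A' := 4 * A + 2 with hA'
  have hA'0 : 0 ≤ A' := by linarith
  set ε : ℕ → ℝ := fun n => 1 / ((n : ℝ) + 1) with hε
  have hε0 : ∀ n, 0 < ε n := fun n => by simp only [hε]; positivity
  have hε1 : ∀ n, ε n ≤ 1 := fun n => by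
    simp only [hε]; rw [div_le_one (by positivity)]; linarith [(Nat.cast_nonneg n : (0:ℝ) ≤ n)]
  have hεl : Filter.Tendsto ε Filter.atTop (nhds 0) := tendsto_one_div_add_atTop_nhds_zero_nat
  choose g hg using fun n => approx_exists hT hD hx0 (hε0 n)
  set p : ℕ → ℝ → H := fun n => pathOf T0 γ x0 (g n) with hp
  set K := Real.exp (7 * ∫ u in T0..T, (4 * A' + 8) * γ u) with hK
  have hcmp : ∀ m n, ∀ t ∈ Icc T0 T, ‖p m t - p n t‖ ^ 2 ≤ (ε m + ε n) / 4 * K := fun m n =>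
    approx_compare hT hA'0 hD.int hD.one_le (hg m) (hg n) (hε0 m).le (hε1 m) (hε0 n).le (hε1 n)
  have hanti : ∀ m n, m ≤ n → ε n ≤ ε m := by
    intro m n hmn; simp only [hε]; gcongr
  have hcau : ∀ t ∈ Icc T0 T, ∃ l, Filter.Tendsto (fun n => p n t) Filter.atTop (nhds l) := by
    intro t ht
    apply cauchySeq_tendsto_of_complete
    refine cauchySeq_of_le_tendsto_0 (fun N => √(ε N / 2 * K)) ?_ ?_
    · intro n m N hn hm
      rw [dist_eq_norm]
      apply Real.le_sqrt_of_sq_le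
      refine (hcmp n m t ht).trans ?_
      have := hanti _ _ hn
      have := hanti _ _ hm
      have : 0 < K := Real.exp_pos _
      exact mul_le_mul_of_nonneg_right (by linarith) this.le
    · have : Filter.Tendsto (fun N => √(ε N / 2 * K)) Filter.atTop (nhds √(0 / 2 * K)) :=
        ((hεl.div_const 2).mul_const K).sqrt
      simpa using this
  have : ∀ t, ∃ l, t ∈ Icc T0 T → Filter.Tendsto (fun n => p n t) Filter.atTop (nhds l) := by
    intro t
    by_cases ht : t ∈ Icc T0 T
    · obtain ⟨l, hl⟩ := hcau t ht; exact ⟨l, fun _ => hl⟩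
    · exact ⟨0, fun h => absurd h ht⟩
  choose x hx using this
  obtain ⟨x', hx'i, hxx⟩ := rnp_limit hT hD.int hD.one_le (fun n => (hg n).1) (fun n => (hg n).2.1) hx
  have hxT0 : x T0 = x0 := by
    have := hx T0 ⟨le_rfl, hT.le⟩
    simp only [hp, pathOf_T0] at this
    exact (tendsto_nhds_unique this tendsto_const_nhds)
  have hxD : ∀ t ∈ Icc T0 T, x t ∈ D t := by
    intro t ht
    choose y hy hyd using fun n => (hg n).2.2.1 t ht
    have h1 : Filter.Tendsto (fun n => p n t - y n) Filter.atTop (nhds 0) :=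
      squeeze_zero_norm hyd hεl
    have h2 := (hx t ht).sub h1
    simp only [sub_sub_cancel, sub_zero] at h2
    exact (hD.closed t ht).mem_of_tendsto h2 (Filter.Eventually.of_forall hy)
  refine ⟨x, x', hxT0, hx'i, hxx, hxD, ?_⟩
  filter_upwards [V_hasDerivAt hT hD.int, path_hasDerivAt hT.le hx'i hxx] with a hV hxd ha
  obtain ⟨haO, hVd⟩ := hV ha
  obtain ⟨-, hxd⟩ := hxd ha
  constructor
  · refine mem_proxNormalCone_of_le (σ := γ a * A') fun y hy => ?_
    set V : ℝ → ℝ := fun t => ∫ u in T0..t, γ u with hVdef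
    have hineq : ∀ t ∈ Ioo a T, ‖y - x t‖ ^ 2 - ‖y - x a‖ ^ 2 ≤
        2 * (V t - V a) * (A' * (‖y - x a‖ + 4 * (V t - V a)) ^ 2 + 0 + 3 * (V t - V a)) := by
      intro t ht
      have htI : t ∈ Icc T0 T := ⟨ha.1.trans ht.1.le, ht.2.le⟩
      have l1 : Filter.Tendsto (fun n => ‖y - p n t‖) Filter.atTop (nhds ‖y - x t‖) :=
        ((hx t htI).const_sub y).norm
      have l2 : Filter.Tendsto (fun n => ‖y - p n a‖) Filter.atTop (nhds ‖y - x a‖) :=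
        ((hx a ha).const_sub y).norm
      refine le_of_tendsto_of_tendsto' ((l1.pow 2).sub (l2.pow 2))
        ((((((l2.add_const _).pow 2).const_mul A').add hεl).add_const _).const_mul _) fun n => ?_
      exact approx_energy hT hD hA'0 (hg n) ha.1 ht.1.le ht.2.le hy rfl
    have hder : HasDerivAt (fun t => ‖y - x t‖ ^ 2 -
        2 * (V t - V a) * (A' * (‖y - x a‖ + 4 * (V t - V a)) ^ 2 + 0 + 3 * (V t - V a)))
        (2 * ⟪y - x a, -x' a⟫ - 2 * γ a * (A' * ‖y - x a‖ ^ 2)) a := by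
      have d1 : HasDerivAt (fun t => ‖y - x t‖ ^ 2) (2 * ⟪y - x a, -x' a⟫) a :=
        (hxd.const_sub y).norm_sq
      have d2 : HasDerivAt (fun t => V t - V a) (γ a) a := hVd.sub_const _
      have d3 := (d2.const_mul 2).mul ((((((d2.const_mul 4).const_add ‖y - x a‖).pow 2).const_mul A').add_const 0).add
        (d2.const_mul 3))
      have d4 := d1.sub d3
      refine HasDerivAt.congr_deriv (f' := _) d4 ?_
      simp
    have hnp := right_deriv_nonpos haO.2 hder (by
      intro t ht
      have := hineq t ht
      simp only [sub_self, mul_zero, zero_mul, sub_zero]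
      linarith)
    rw [real_inner_comm] at hnp
    linarith
  · refine right_deriv_norm_le haO.2 hxd (hVd.const_mul 3) fun t ht => ?_
    have htI : t ∈ Icc T0 T := ⟨ha.1.trans ht.1.le, ht.2.le⟩
    rw [← mul_sub]
    refine le_of_tendsto' ((hx t htI).sub (hx a ha)).norm fun n => ?_
    exact approx_lipschitz hT hD.int hD.one_le (hg n) ha.1 ht.1.le ht.2.le

theorem mem_cone_translate {S : Set H} {x c v : H} :
    v ∈ proxNormalCone {y | y - c ∈ S} x ↔ v ∈ proxNormalCone S (x - c) := by
  constructor
  · rintro ⟨σ, hσ, δ, hδ, h⟩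
    refine ⟨σ, hσ, δ, hδ, fun y hy => ?_⟩
    have := h (y + c) ⟨by simpa using hy.1, by
      have h2 := hy.2
      rw [Metric.mem_ball, dist_eq_norm] at h2 ⊢
      rwa [show y + c - x = y - (x - c) by abel]⟩
    rwa [show y + c - x = y - (x - c) by abel] at this
  · rintro ⟨σ, hσ, δ, hδ, h⟩
    refine ⟨σ, hσ, δ, hδ, fun y hy => ?_⟩
    have := h (y - c) ⟨hy.1, by
      have h2 := hy.2
      rw [Metric.mem_ball, dist_eq_norm] at h2 ⊢
      rwa [show y - c - (x - c) = y - x by abel]⟩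
    rwa [show y - c - (x - c) = y - x by abel] at this

/-- Hypotheses on the original moving set. -/
structure SetHyp (T0 T : ℝ) (C : ℝ → Set H) (υ υ' : ℝ → ℝ) (A : ℝ) : Prop where
  hA : 0 ≤ A
  closed : ∀ t ∈ Icc T0 T, IsClosed (C t)
  pr : ∀ t ∈ Icc T0 T, ∀ x ∈ C t, ∀ v ∈ proxNormalCone (C t) x, ∀ y ∈ C t,
    ⟪v, y - x⟫ ≤ A * ‖v‖ * ‖y - x‖ ^ 2
  int : IntervalIntegrable υ' volume T0 T
  ac : ∀ t ∈ Icc T0 T, υ t = υ T0 + ∫ s in T0..t, υ' s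
  move : ∀ s ∈ Icc T0 T, ∀ t ∈ Icc T0 T, ∀ y ∈ C t, ∃ y' ∈ C s, ‖y - y'‖ ≤ |υ s - υ t|

theorem forced_exists {T0 T A : ℝ} (hT : T0 < T) {C : ℝ → Set H} {υ υ' : ℝ → ℝ}
    (hC : SetHyp T0 T C υ υ' A) {h : ℝ → H} (hh : IntervalIntegrable h volume T0 T)
    {x0 : H} (hx0 : x0 ∈ C T0) :
    ∃ x x' : ℝ → H, x T0 = x0 ∧ IntervalIntegrable x' volume T0 T ∧
      (∀ t ∈ Icc T0 T, x t = x T0 + ∫ s in T0..t, x' s) ∧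
      (∀ t ∈ Icc T0 T, x t ∈ C t) ∧
      (∀ᵐ t ∂volume, t ∈ Icc T0 T → -x' t - h t ∈ proxNormalCone (C t) (x t) ∧
        ‖x' t + h t‖ ≤ 3 * (|υ' t| + ‖h t‖ + 1)) := by
  set I : ℝ → H := fun t => ∫ s in T0..t, h s with hI
  set γ : ℝ → ℝ := fun t => |υ' t| + ‖h t‖ + 1 with hγ
  have hυn : IntervalIntegrable (fun t => |υ' t|) volume T0 T := hC.int.abs
  have hγi : IntervalIntegrable γ volume T0 T := (hυn.add hh.norm).add (by simp)
  have hI0 : I T0 = 0 := by simp [hI]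
  have hII : ∀ t ∈ Icc T0 T, I t = I T0 + ∫ s in T0..t, h s := by
    intro t _; rw [hI0, zero_add]
  have hV : ∀ s t : ℝ, T0 ≤ s → s ≤ t → t ≤ T →
      ‖I t - I s‖ + |υ t - υ s| ≤ (∫ u in T0..t, γ u) - ∫ u in T0..s, γ u := by
    intro s t hs hst ht
    have e1 := path_dist hh hh.norm hII (Filter.Eventually.of_forall fun _ _ => le_rfl) hs hst ht
    have e2 := path_dist hC.int hυn hC.ac (Filter.Eventually.of_forall fun _ _ => by rfl) hs hst ht
    rw [Real.norm_eq_abs] at e2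
    rw [V_sub hh.norm hs hst ht] at e1
    rw [V_sub hυn hs hst ht] at e2
    rw [V_sub hγi hs hst ht, hγ, intervalIntegral.integral_add
      ((ii_mono hυn hs hst ht).add (ii_mono hh.norm hs hst ht)) (by simp),
      intervalIntegral.integral_add (ii_mono hυn hs hst ht) (ii_mono hh.norm hs hst ht)]
    have : ∫ u in s..t, (1 : ℝ) = t - s := by simp
    rw [this]
    linarith
  have hD : MovingSet T0 T (fun t => {y | y - I t ∈ C t}) γ A := by
    refine ⟨hC.hA, ?_, ?_, hγi, ?_, ?_⟩
    · intro t ht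
      exact (hC.closed t ht).preimage (continuous_id.sub continuous_const)
    · intro t ht x hx v hv y hy
      have := hC.pr t ht (x - I t) hx v (mem_cone_translate.1 hv) (y - I t) hy
      rwa [show y - I t - (x - I t) = y - x by abel] at this
    · intro t
      simp only [hγ]
      have := abs_nonneg (υ' t)
      have := norm_nonneg (h t)
      linarith
    · intro s hs t ht y hy
      obtain ⟨c, hc, hd⟩ := hC.move s hs t ht _ hy
      refine ⟨c + I s, by simpa using hc, ?_⟩
      have e1 : ‖y - (c + I s)‖ ≤ ‖I t - I s‖ + |υ s - υ t| := by
        rw [show y - (c + I s) = (I t - I s) + (y - I t - c) by abel]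
        exact (norm_add_le _ _).trans (by linarith)
      refine e1.trans ?_
      rcases le_total s t with hst | hst
      · have := hV s t hs.1 hst ht.2
        rw [abs_sub_comm] at this
        rw [abs_sub_comm (∫ u in T0..s, γ u)]
        exact this.trans (le_abs_self _)
      · have := hV t s ht.1 hst hs.2
        rw [norm_sub_rev]
        exact this.trans (le_abs_self _)
  obtain ⟨X, X', hX0, hX'i, hXX, hXD, hae⟩ := sweep_exists hT hD (x0 := x0) (by simpa [hI0] using hx0)
  refine ⟨fun t => X t - I t, fun t => X' t - h t, by simp [hX0, hI0], hX'i.sub hh, ?_, hXD, ?_⟩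
  · intro t ht
    change X t - I t = X T0 - I T0 + _
    rw [intervalIntegral.integral_sub (ii_mono hX'i le_rfl ht.1 ht.2) (ii_mono hh le_rfl ht.1 ht.2),
      hI0, hXX t ht]
    simp only [hI]; abel
  · filter_upwards [hae] with t ht htI
    obtain ⟨h1, h2⟩ := ht htI
    refine ⟨?_, by simpa using h2⟩
    rw [show -(X' t - h t) - h t = -X' t by abel]
    exact mem_cone_translate.1 h1

theorem W_continuousOn {T0 T : ℝ} (hT : T0 ≤ T) {ω : ℝ → ℝ}
    (hω : IntervalIntegrable ω volume T0 T) :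
    ContinuousOn (fun t => ∫ u in T0..t, ω u) (Icc T0 T) := by
  have := (hω.absolutelyContinuousOnInterval_intervalIntegral (c := T0) (by simp)).continuousOn
  rwa [uIcc_of_le hT] at this

theorem contraction {T0 T A : ℝ} (hT : T0 < T) {C : ℝ → Set H} {υ υ' : ℝ → ℝ}
    (hC : SetHyp T0 T C υ υ' A) {x x' y y' h k : ℝ → H} {ω : ℝ → ℝ} {d : ℝ} (hd : 0 ≤ d)
    (h0 : x T0 = y T0)
    (hx' : IntervalIntegrable x' volume T0 T) (hy' : IntervalIntegrable y' volume T0 T)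
    (hx : ∀ t ∈ Icc T0 T, x t = x T0 + ∫ s in T0..t, x' s)
    (hy : ∀ t ∈ Icc T0 T, y t = y T0 + ∫ s in T0..t, y' s)
    (hxC : ∀ t ∈ Icc T0 T, x t ∈ C t) (hyC : ∀ t ∈ Icc T0 T, y t ∈ C t)
    (hω : IntervalIntegrable ω volume T0 T) (hω0 : ∀ t ∈ Icc T0 T, 0 ≤ ω t)
    (hxn : ∀ᵐ t ∂volume, t ∈ Icc T0 T → -x' t - h t ∈ proxNormalCone (C t) (x t))
    (hyn : ∀ᵐ t ∂volume, t ∈ Icc T0 T → -y' t - k t ∈ proxNormalCone (C t) (y t))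
    (hb : ∀ᵐ t ∂volume, t ∈ Icc T0 T → A * (‖x' t + h t‖ + ‖y' t + k t‖) ≤ ω t)
    (hhk : ∀ᵐ t ∂volume, t ∈ Icc T0 T →
      ‖h t - k t‖ ≤ ω t * √(d * Real.exp (7 * ∫ u in T0..t, ω u))) :
    ∀ t ∈ Icc T0 T, ‖x t - y t‖ ^ 2 ≤ d / 4 * Real.exp (7 * ∫ u in T0..t, ω u) := by
  set z : ℝ → H := fun t => x t - y t with hz
  set z' : ℝ → H := fun t => x' t - y' t with hz'
  have z0 : z T0 = 0 := by simp [hz, h0]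
  have hi : IntervalIntegrable z' volume T0 T := hx'.sub hy'
  have hzz : ∀ t ∈ Icc T0 T, z t = z T0 + ∫ s in T0..t, z' s := by
    intro t ht
    rw [z0, zero_add, hz', intervalIntegral.integral_sub (ii_mono hx' le_rfl ht.1 ht.2)
      (ii_mono hy' le_rfl ht.1 ht.2)]
    simp only [hz]
    rw [hx t ht, hy t ht, h0]; abel
  have hzc := path_continuousOn hT.le hi hzz
  have hsq := path_normSq hT.le hi hzz
  have hzc2 : ContinuousOn (fun t => ‖z t‖ ^ 2) (Icc T0 T) := hzc.norm.pow 2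
  have hWc := W_continuousOn hT.le hω
  refine gronwall_W hT.le hd hω hω0 hzc2 ?_
  intro t ht
  rw [hsq t ht, z0]
  simp only [norm_zero, ne_eq, OfNat.ofNat_ne_zero, not_false_eq_true, zero_pow, zero_add]
  refine intervalIntegral.integral_mono_ae_restrict ht.1
    (ii_mono ((ii_inner hT.le hi hzc).const_mul 2) le_rfl ht.1 ht.2) ?_ ?_
  · refine ii_mono (hω.mul_continuousOn ?_) le_rfl ht.1 ht.2
    rw [uIcc_of_le hT.le]
    exact (hzc2.const_mul 3).add
      (continuousOn_const.mul (Real.continuous_exp.comp_continuousOn (hWc.const_mul 7)))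
  rw [Filter.EventuallyLE, ae_restrict_iff' measurableSet_Icc]
  filter_upwards [hxn, hyn, hb, hhk] with s e1 e2 e3 e4 hs
  have hsI : s ∈ Icc T0 T := ⟨hs.1, hs.2.trans ht.2⟩
  have f1 := hC.pr s hsI _ (hxC s hsI) _ (e1 hsI) _ (hyC s hsI)
  have f2 := hC.pr s hsI _ (hyC s hsI) _ (e2 hsI) _ (hxC s hsI)
  have f3 := e3 hsI
  have f4 := e4 hsI
  set E := d * Real.exp (7 * ∫ u in T0..s, ω u) with hE
  have hE0 : 0 ≤ E := by positivity
  have n1 : ‖-x' s - h s‖ = ‖x' s + h s‖ := by rw [← norm_neg]; congr 1; abel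
  have n2 : ‖-y' s - k s‖ = ‖y' s + k s‖ := by rw [← norm_neg]; congr 1; abel
  rw [n1, norm_sub_rev] at f1
  rw [n2] at f2
  have i1 : ⟪z' s, z s⟫ = ⟪-x' s - h s, y s - x s⟫ + ⟪-y' s - k s, x s - y s⟫ - ⟪h s - k s, z s⟫ := by
    rw [show y s - x s = -(z s) by simp [hz], inner_neg_right]
    change _ = -⟪-x' s - h s, z s⟫ + ⟪-y' s - k s, z s⟫ - ⟪h s - k s, z s⟫
    rw [← inner_neg_left, ← inner_add_left, ← inner_sub_left]
    congr 1; simp only [hz']; abel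
  have i2 : -(ω s * √E * ‖z s‖) ≤ ⟪h s - k s, z s⟫ := by
    have := (abs_le.1 (abs_real_inner_le_norm (h s - k s) (z s))).1
    have : ‖h s - k s‖ * ‖z s‖ ≤ ω s * √E * ‖z s‖ := by gcongr
    linarith
  have i3 : 2 * (√E * ‖z s‖) ≤ E + ‖z s‖ ^ 2 := by
    have := sq_nonneg (√E - ‖z s‖)
    have h5 := Real.sq_sqrt hE0
    nlinarith
  have i4 : A * (‖x' s + h s‖ + ‖y' s + k s‖) * ‖z s‖ ^ 2 ≤ ω s * ‖z s‖ ^ 2 := by gcongr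
  have i5 : ω s * (2 * (√E * ‖z s‖)) ≤ ω s * (E + ‖z s‖ ^ 2) :=
    mul_le_mul_of_nonneg_left i3 (hω0 s hsI)
  have i6 : ‖x s - y s‖ = ‖z s‖ := rfl
  rw [i6] at f1 f2
  nlinarith

/-- Hypotheses on the forcing terms. -/
structure FHyp (T0 T : ℝ) (U : Set H) (f1 : ℝ → H → H) (f2 : ℝ → ℝ → H → H) (β1 : ℝ → ℝ)
    (β2 : ℝ → ℝ → ℝ) : Prop where
  m1 : ∀ x : H, StronglyMeasurable fun t => f1 t x
  i1 : IntervalIntegrable β1 volume T0 T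
  nn1 : ∀ t ∈ Icc T0 T, 0 ≤ β1 t
  grow1 : ∀ t ∈ Icc T0 T, ∀ x ∈ U, ‖f1 t x‖ ≤ β1 t * (1 + ‖x‖)
  lip1 : ∀ η : ℝ, 0 < η → ∃ L1 : ℝ → ℝ, IntervalIntegrable L1 volume T0 T ∧
      (∀ t ∈ Icc T0 T, 0 ≤ L1 t) ∧
      ∀ t ∈ Icc T0 T, ∀ x ∈ Metric.closedBall (0 : H) η,
        ∀ y ∈ Metric.closedBall (0 : H) η, ‖f1 t x - f1 t y‖ ≤ L1 t * ‖x - y‖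
  m2 : ∀ x : H, StronglyMeasurable fun p : ℝ × ℝ => f2 p.1 p.2 x
  i2 : IntegrableOn (fun p : ℝ × ℝ => β2 p.1 p.2)
      {p : ℝ × ℝ | p.1 ∈ Icc T0 T ∧ p.2 ∈ Icc T0 T ∧ p.2 ≤ p.1} volume
  nn2 : ∀ t ∈ Icc T0 T, ∀ s ∈ Icc T0 t, 0 ≤ β2 t s
  grow2 : ∀ t ∈ Icc T0 T, ∀ s ∈ Icc T0 t, ∀ x ∈ U, ‖f2 t s x‖ ≤ β2 t s * (1 + ‖x‖)
  lip2 : ∀ η : ℝ, 0 < η → ∃ L2 : ℝ → ℝ, IntervalIntegrable L2 volume T0 T ∧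
      (∀ t ∈ Icc T0 T, 0 ≤ L2 t) ∧
      ∀ t ∈ Icc T0 T, ∀ s ∈ Icc T0 t, ∀ x ∈ Metric.closedBall (0 : H) η,
        ∀ y ∈ Metric.closedBall (0 : H) η, ‖f2 t s x - f2 t s y‖ ≤ L2 t * ‖x - y‖

/-- The forcing operator. -/
def Fop (T0 : ℝ) (f1 : ℝ → H → H) (f2 : ℝ → ℝ → H → H) (ξ : ℝ → H) (t : ℝ) : H :=
  f1 t (ξ t) + ∫ s in T0..t, f2 t s (ξ s)

/-- The time triangle. -/
def tri (T0 T : ℝ) : Set (ℝ × ℝ) := {p | p.1 ∈ Icc T0 T ∧ p.2 ∈ Icc T0 T ∧ p.2 ≤ p.1}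

theorem tri_meas (T0 T : ℝ) : MeasurableSet (tri T0 T) := by
  have : IsClosed (tri T0 T) :=
    (isClosed_Icc.preimage continuous_fst).inter
      ((isClosed_Icc.preimage continuous_snd).inter (isClosed_le continuous_snd continuous_fst))
  exact this.measurableSet

theorem tri_fubini {E : Type*} [NormedAddCommGroup E] [NormedSpace ℝ E] {T0 T : ℝ} (hT : T0 < T)
    {G : ℝ × ℝ → E} (hG : IntegrableOn G (tri T0 T) volume) :
    IntervalIntegrable (fun t => ∫ s in T0..t, G (t, s)) volume T0 T ∧
    ∀ᵐ t ∂volume, t ∈ Icc T0 T → IntervalIntegrable (fun s => G (t, s)) volume T0 t := by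
  have h1 : Integrable ((tri T0 T).indicator G) (volume.prod volume) := by
    rw [← Measure.volume_eq_prod]
    exact (integrable_indicator_iff (tri_meas T0 T)).2 hG
  have hslice : ∀ t ∈ Icc T0 T, (fun s => (tri T0 T).indicator G (t, s)) =
      (Icc T0 t).indicator (fun s => G (t, s)) := by
    intro t ht
    funext s
    by_cases hs : s ∈ Icc T0 t
    · rw [indicator_of_mem hs, indicator_of_mem]
      exact ⟨ht, ⟨hs.1, hs.2.trans ht.2⟩, hs.2⟩
    · rw [indicator_of_notMem hs, indicator_of_notMem]
      rintro ⟨-, h2, h3⟩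
      exact hs ⟨h2.1, h3⟩
  constructor
  · have h2 := h1.integral_prod_left
    rw [intervalIntegrable_iff_integrableOn_Ioc_of_le hT.le]
    refine (h2.integrableOn (s := Ioc T0 T)).congr_fun (fun t ht => ?_) measurableSet_Ioc
    have htI := Ioc_subset_Icc_self ht
    simp only
    rw [hslice t htI, integral_indicator measurableSet_Icc, integral_Icc_eq_integral_Ioc,
      intervalIntegral.integral_of_le ht.1.le]
  · filter_upwards [h1.prod_right_ae] with t ht htI
    rw [hslice t htI, integrable_indicator_iff measurableSet_Icc] at ht
    rw [intervalIntegrable_iff_integrableOn_Ioc_of_le htI.1]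
    exact ht.mono_set Ioc_subset_Icc_self

theorem cont_of_loclip {f : H → H} (h : ∀ η : ℝ, 0 < η → ∃ L : ℝ,
    ∀ x ∈ Metric.closedBall (0 : H) η, ∀ y ∈ Metric.closedBall (0 : H) η,
      ‖f x - f y‖ ≤ L * ‖x - y‖) : Continuous f := by
  rw [continuous_iff_continuousAt]
  intro x
  obtain ⟨L, hL⟩ := h (‖x‖ + 1) (by positivity)
  refine continuousAt_of_locally_lipschitz one_pos L fun y hy => ?_
  rw [dist_eq_norm, dist_eq_norm]
  rw [dist_eq_norm] at hy
  refine hL y ?_ x ?_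
  · rw [mem_closedBall_zero_iff]
    have := norm_add_le (y - x) x
    rw [sub_add_cancel] at this
    linarith
  · rw [mem_closedBall_zero_iff]; linarith

section
variable {T0 T : ℝ} {U : Set H} {f1 : ℝ → H → H} {f2 : ℝ → ℝ → H → H} {β1 : ℝ → ℝ}
    {β2 : ℝ → ℝ → ℝ}

theorem FHyp.cont1 (hF : FHyp T0 T U f1 f2 β1 β2) {t : ℝ} (ht : t ∈ Icc T0 T) :
    Continuous (f1 t) := by
  apply cont_of_loclip
  intro η hη
  obtain ⟨L, -, -, h⟩ := hF.lip1 η hη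
  exact ⟨L t, h t ht⟩

theorem FHyp.cont2 (hF : FHyp T0 T U f1 f2 β1 β2) {t s : ℝ} (ht : t ∈ Icc T0 T)
    (hs : s ∈ Icc T0 t) : Continuous (f2 t s) := by
  apply cont_of_loclip
  intro η hη
  obtain ⟨L, -, -, h⟩ := hF.lip2 η hη
  exact ⟨L t, h t ht s hs⟩

theorem bdd_of_cont {ξ : ℝ → H} (hξ : ContinuousOn ξ (Icc T0 T)) :
    ∃ K, ∀ t ∈ Icc T0 T, 1 + ‖ξ t‖ ≤ K := by
  obtain ⟨K, hK⟩ := isCompact_Icc.exists_bound_of_continuousOn hξ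
  exact ⟨1 + K, fun t ht => by linarith [hK t ht]⟩

theorem FHyp.int1 (hF : FHyp T0 T U f1 f2 β1 β2) (hT : T0 < T) {ξ : ℝ → H}
    (hξ : ContinuousOn ξ (Icc T0 T)) (hU : ∀ t ∈ Icc T0 T, ξ t ∈ U) :
    IntervalIntegrable (fun t => f1 t (ξ t)) volume T0 T := by
  obtain ⟨K, hK⟩ := bdd_of_cont hξ
  set ζ : ℝ → H := IccExtend hT.le ((Icc T0 T).domRestrict ξ) with hζ
  have hζc : Continuous ζ := (continuousOn_iff_continuous_domRestrict.1 hξ).Icc_extend'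
  have hζe : ∀ t ∈ Icc T0 T, ζ t = ξ t := fun t ht => by
    simp [hζ, IccExtend_of_mem hT.le _ ht]
  have hu := stronglyMeasurable_uncurry_of_continuous_of_stronglyMeasurable
    (u := fun (τ : ℝ) (t : ℝ) => (Icc T0 T).indicator (fun t => f1 t (ζ τ)) t) (by
      intro t
      by_cases ht : t ∈ Icc T0 T
      · simp only [indicator_of_mem ht]; exact (hF.cont1 ht).comp hζc
      · simp only [indicator_of_notMem ht]; exact continuous_const)
    (fun τ => (hF.m1 _).indicator measurableSet_Icc)
  have hm : StronglyMeasurable (fun t => (Icc T0 T).indicator (fun s => f1 s (ζ t)) t) :=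
    hu.comp_measurable (measurable_id.prodMk measurable_id)
  have hi := hF.i1.mul_const K
  rw [intervalIntegrable_iff_integrableOn_Ioc_of_le hT.le] at hi ⊢
  refine Integrable.mono' hi ?_ ?_
  · refine hm.aestronglyMeasurable.congr ?_
    rw [Filter.EventuallyEq, ae_restrict_iff' measurableSet_Ioc]
    refine Filter.Eventually.of_forall fun t ht => ?_
    rw [indicator_of_mem (Ioc_subset_Icc_self ht), hζe t (Ioc_subset_Icc_self ht)]
  · rw [ae_restrict_iff' measurableSet_Ioc]
    refine Filter.Eventually.of_forall fun t ht => ?_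
    have ht := Ioc_subset_Icc_self ht
    exact (hF.grow1 t ht _ (hU t ht)).trans (mul_le_mul_of_nonneg_left (hK t ht) (hF.nn1 t ht))

theorem FHyp.int2 (hF : FHyp T0 T U f1 f2 β1 β2) (hT : T0 < T) {ξ : ℝ → H}
    (hξ : ContinuousOn ξ (Icc T0 T)) (hU : ∀ t ∈ Icc T0 T, ξ t ∈ U) :
    IntegrableOn (fun p : ℝ × ℝ => f2 p.1 p.2 (ξ p.2)) (tri T0 T) volume := by
  obtain ⟨K, hK⟩ := bdd_of_cont hξ
  set ζ : ℝ → H := IccExtend hT.le ((Icc T0 T).domRestrict ξ) with hζ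
  have hζc : Continuous ζ := (continuousOn_iff_continuous_domRestrict.1 hξ).Icc_extend'
  have hζe : ∀ t ∈ Icc T0 T, ζ t = ξ t := fun t ht => by
    simp [hζ, IccExtend_of_mem hT.le _ ht]
  have hu := stronglyMeasurable_uncurry_of_continuous_of_stronglyMeasurable
    (u := fun (τ : ℝ) (p : ℝ × ℝ) => (tri T0 T).indicator (fun p => f2 p.1 p.2 (ζ τ)) p) (by
      intro p
      by_cases hp : p ∈ tri T0 T
      · simp only [indicator_of_mem hp]
        exact (hF.cont2 hp.1 ⟨hp.2.1.1, hp.2.2⟩).comp hζc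
      · simp only [indicator_of_notMem hp]; exact continuous_const)
    (fun τ => (hF.m2 _).indicator (tri_meas T0 T))
  have hm : StronglyMeasurable (fun p : ℝ × ℝ => (tri T0 T).indicator (fun q => f2 q.1 q.2 (ζ p.2)) p) :=
    hu.comp_measurable (measurable_snd.prodMk measurable_id)
  have hi : IntegrableOn (fun p : ℝ × ℝ => β2 p.1 p.2 * K) (tri T0 T) volume := hF.i2.mul_const K
  refine Integrable.mono' hi ?_ ?_
  · refine hm.aestronglyMeasurable.congr ?_
    rw [Filter.EventuallyEq, ae_restrict_iff' (tri_meas T0 T)]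
    refine Filter.Eventually.of_forall fun p hp => ?_
    rw [indicator_of_mem hp, hζe p.2 hp.2.1]
  · rw [ae_restrict_iff' (tri_meas T0 T)]
    refine Filter.Eventually.of_forall fun p hp => ?_
    have h1 : p.2 ∈ Icc T0 p.1 := ⟨hp.2.1.1, hp.2.2⟩
    exact (hF.grow2 p.1 hp.1 p.2 h1 _ (hU p.2 hp.2.1)).trans
      (mul_le_mul_of_nonneg_left (hK _ hp.2.1) (hF.nn2 _ hp.1 _ h1))

theorem FHyp.intF (hF : FHyp T0 T U f1 f2 β1 β2) (hT : T0 < T) {ξ : ℝ → H}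
    (hξ : ContinuousOn ξ (Icc T0 T)) (hU : ∀ t ∈ Icc T0 T, ξ t ∈ U) :
    IntervalIntegrable (Fop T0 f1 f2 ξ) volume T0 T :=
  (hF.int1 hT hξ hU).add (tri_fubini hT (hF.int2 hT hξ hU)).1

theorem FHyp.intB (hF : FHyp T0 T U f1 f2 β1 β2) (hT : T0 < T) :
    IntervalIntegrable (fun t => β1 t + ∫ s in T0..t, β2 t s) volume T0 T :=
  hF.i1.add (tri_fubini hT hF.i2).1

theorem FHyp.nnB (hF : FHyp T0 T U f1 f2 β1 β2) {t : ℝ} (ht : t ∈ Icc T0 T) :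
    0 ≤ β1 t + ∫ s in T0..t, β2 t s :=
  add_nonneg (hF.nn1 t ht) (intervalIntegral.integral_nonneg ht.1 fun s hs => hF.nn2 t ht s hs)

theorem FHyp.bound (hF : FHyp T0 T U f1 f2 β1 β2) (hT : T0 < T) :
    ∀ᵐ t ∂volume, t ∈ Icc T0 T → ∀ (ξ : ℝ → H) (K : ℝ),
      (∀ s ∈ Icc T0 t, ξ s ∈ U) → (∀ s ∈ Icc T0 t, 1 + ‖ξ s‖ ≤ K) →
      ‖Fop T0 f1 f2 ξ t‖ ≤ (β1 t + ∫ s in T0..t, β2 t s) * K := by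
  filter_upwards [(tri_fubini hT hF.i2).2] with t hi ht ξ K hU hK
  have htt : t ∈ Icc T0 t := ⟨ht.1, le_rfl⟩
  have h1 : ‖f1 t (ξ t)‖ ≤ β1 t * K := (hF.grow1 t ht _ (hU t htt)).trans
    (mul_le_mul_of_nonneg_left (hK t htt) (hF.nn1 t ht))
  have h2 : ‖∫ s in T0..t, f2 t s (ξ s)‖ ≤ ∫ s in T0..t, β2 t s * K := by
    refine intervalIntegral.norm_integral_le_of_norm_le ht.1 ?_ ((hi ht).mul_const K)
    refine Filter.Eventually.of_forall fun s hs => ?_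
    have hs := Ioc_subset_Icc_self hs
    exact (hF.grow2 t ht s hs _ (hU s hs)).trans
      (mul_le_mul_of_nonneg_left (hK s hs) (hF.nn2 t ht s hs))
  rw [intervalIntegral.integral_mul_const] at h2
  refine (norm_add_le _ _).trans ?_
  linarith

theorem FHyp.diff (hF : FHyp T0 T U f1 f2 β1 β2) (hT : T0 < T) {ξ ζ : ℝ → H}
    (hξ : ContinuousOn ξ (Icc T0 T)) (hξU : ∀ t ∈ Icc T0 T, ξ t ∈ U)
    (hζ : ContinuousOn ζ (Icc T0 T)) (hζU : ∀ t ∈ Icc T0 T, ζ t ∈ U) {η : ℝ}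
    (hξη : ∀ t ∈ Icc T0 T, ‖ξ t‖ ≤ η) (hζη : ∀ t ∈ Icc T0 T, ‖ζ t‖ ≤ η)
    {L1 L2 : ℝ → ℝ} (hL1 : ∀ t ∈ Icc T0 T, 0 ≤ L1 t) (hL2 : ∀ t ∈ Icc T0 T, 0 ≤ L2 t)
    (h1 : ∀ t ∈ Icc T0 T, ∀ x ∈ Metric.closedBall (0 : H) η,
        ∀ y ∈ Metric.closedBall (0 : H) η, ‖f1 t x - f1 t y‖ ≤ L1 t * ‖x - y‖)
    (h2 : ∀ t ∈ Icc T0 T, ∀ s ∈ Icc T0 t, ∀ x ∈ Metric.closedBall (0 : H) η,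
        ∀ y ∈ Metric.closedBall (0 : H) η, ‖f2 t s x - f2 t s y‖ ≤ L2 t * ‖x - y‖) :
    ∀ᵐ t ∂volume, t ∈ Icc T0 T → ∀ q : ℝ, (∀ s ∈ Icc T0 t, ‖ξ s - ζ s‖ ≤ q) →
      ‖Fop T0 f1 f2 ξ t - Fop T0 f1 f2 ζ t‖ ≤ (L1 t + (T - T0) * L2 t) * q := by
  filter_upwards [(tri_fubini hT (hF.int2 hT hξ hξU)).2, (tri_fubini hT (hF.int2 hT hζ hζU)).2]
    with t i1 i2 ht q hq
  have htt : t ∈ Icc T0 t := ⟨ht.1, le_rfl⟩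
  have hq0 : 0 ≤ q := (norm_nonneg _).trans (hq t htt)
  have e1 : ‖f1 t (ξ t) - f1 t (ζ t)‖ ≤ L1 t * q :=
    (h1 t ht _ (by simpa using hξη t ht) _ (by simpa using hζη t ht)).trans
      (mul_le_mul_of_nonneg_left (hq t htt) (hL1 t ht))
  have e2 : ‖(∫ s in T0..t, f2 t s (ξ s)) - ∫ s in T0..t, f2 t s (ζ s)‖ ≤ (T - T0) * L2 t * q := by
    rw [← intervalIntegral.integral_sub (i1 ht) (i2 ht)]
    have := intervalIntegral.norm_integral_le_of_norm_le_const (a := T0) (b := t) (C := L2 t * q)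
      (f := fun s => f2 t s (ξ s) - f2 t s (ζ s)) (by
        intro s hs
        rw [uIoc_of_le ht.1] at hs
        have hs := Ioc_subset_Icc_self hs
        have hsT : s ∈ Icc T0 T := ⟨hs.1, hs.2.trans ht.2⟩
        exact (h2 t ht s hs _ (by simpa using hξη s hsT) _ (by simpa using hζη s hsT)).trans
          (mul_le_mul_of_nonneg_left (hq s hs) (hL2 t ht)))
    refine this.trans ?_
    rw [abs_of_nonneg (by linarith [ht.1])]
    have h5 : 0 ≤ L2 t * q := mul_nonneg (hL2 t ht) hq0
    have : t - T0 ≤ T - T0 := by linarith [ht.2]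
    nlinarith
  unfold Fop
  rw [add_sub_add_comm]
  refine (norm_add_le _ _).trans ?_
  linarith
end

theorem W_nonneg {T0 T t : ℝ} {ω : ℝ → ℝ} (hω0 : ∀ t ∈ Icc T0 T, 0 ≤ ω t) (ht : t ∈ Icc T0 T) :
    0 ≤ ∫ u in T0..t, ω u :=
  intervalIntegral.integral_nonneg ht.1 fun u hu => hω0 u ⟨hu.1, hu.2.trans ht.2⟩

section
variable {T0 T : ℝ} {U : Set H} {f1 : ℝ → H → H} {f2 : ℝ → ℝ → H → H} {β1 : ℝ → ℝ}
    {β2 : ℝ → ℝ → ℝ}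

theorem FHyp.step (hF : FHyp T0 T U f1 f2 β1 β2) (hT : T0 < T) {ξ ζ : ℝ → H}
    (hξ : ContinuousOn ξ (Icc T0 T)) (hξU : ∀ t ∈ Icc T0 T, ξ t ∈ U)
    (hζ : ContinuousOn ζ (Icc T0 T)) (hζU : ∀ t ∈ Icc T0 T, ζ t ∈ U) {η : ℝ}
    (hξη : ∀ t ∈ Icc T0 T, ‖ξ t‖ ≤ η) (hζη : ∀ t ∈ Icc T0 T, ‖ζ t‖ ≤ η)
    {L1 L2 : ℝ → ℝ} (hL1 : ∀ t ∈ Icc T0 T, 0 ≤ L1 t) (hL2 : ∀ t ∈ Icc T0 T, 0 ≤ L2 t)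
    (h1 : ∀ t ∈ Icc T0 T, ∀ x ∈ Metric.closedBall (0 : H) η,
        ∀ y ∈ Metric.closedBall (0 : H) η, ‖f1 t x - f1 t y‖ ≤ L1 t * ‖x - y‖)
    (h2 : ∀ t ∈ Icc T0 T, ∀ s ∈ Icc T0 t, ∀ x ∈ Metric.closedBall (0 : H) η,
        ∀ y ∈ Metric.closedBall (0 : H) η, ‖f2 t s x - f2 t s y‖ ≤ L2 t * ‖x - y‖)
    {ω : ℝ → ℝ} (hω : IntervalIntegrable ω volume T0 T) (hω0 : ∀ t ∈ Icc T0 T, 0 ≤ ω t)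
    (hωL : ∀ t ∈ Icc T0 T, L1 t + (T - T0) * L2 t ≤ ω t) {d : ℝ} (hd : 0 ≤ d)
    (hdist : ∀ t ∈ Icc T0 T, ‖ξ t - ζ t‖ ^ 2 ≤ d * Real.exp (7 * ∫ u in T0..t, ω u)) :
    ∀ᵐ t ∂volume, t ∈ Icc T0 T → ‖Fop T0 f1 f2 ξ t - Fop T0 f1 f2 ζ t‖ ≤
      ω t * √(d * Real.exp (7 * ∫ u in T0..t, ω u)) := by
  filter_upwards [hF.diff hT hξ hξU hζ hζU hξη hζη hL1 hL2 h1 h2] with t h ht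
  refine (h ht √(d * Real.exp (7 * ∫ u in T0..t, ω u)) fun s hs => ?_).trans
    (mul_le_mul_of_nonneg_right (hωL t ht) (Real.sqrt_nonneg _))
  apply Real.le_sqrt_of_sq_le
  refine (hdist s ⟨hs.1, hs.2.trans ht.2⟩).trans ?_
  have := integral_mono_W hω hω0 hs.1 hs.2 ht.2
  gcongr

theorem sol_unique (hT : T0 < T) {A : ℝ} {C : ℝ → Set H} {υ υ' : ℝ → ℝ}
    (hC : SetHyp T0 T C υ υ' A) (hCU : ∀ t ∈ Icc T0 T, C t ⊆ U)
    (hF : FHyp T0 T U f1 f2 β1 β2) {x x' y y' : ℝ → H} (h0 : x T0 = y T0)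
    (hx' : IntervalIntegrable x' volume T0 T) (hy' : IntervalIntegrable y' volume T0 T)
    (hx : ∀ t ∈ Icc T0 T, x t = x T0 + ∫ s in T0..t, x' s)
    (hy : ∀ t ∈ Icc T0 T, y t = y T0 + ∫ s in T0..t, y' s)
    (hxC : ∀ t ∈ Icc T0 T, x t ∈ C t) (hyC : ∀ t ∈ Icc T0 T, y t ∈ C t)
    (hxn : ∀ᵐ t ∂volume, t ∈ Icc T0 T →
      -x' t - Fop T0 f1 f2 x t ∈ proxNormalCone (C t) (x t))
    (hyn : ∀ᵐ t ∂volume, t ∈ Icc T0 T →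
      -y' t - Fop T0 f1 f2 y t ∈ proxNormalCone (C t) (y t)) :
    ∀ t ∈ Icc T0 T, x t = y t := by
  have hA := hC.hA
  have hxc := path_continuousOn hT.le hx' hx
  have hyc := path_continuousOn hT.le hy' hy
  obtain ⟨K1, hK1⟩ := bdd_of_cont hxc
  obtain ⟨K2, hK2⟩ := bdd_of_cont hyc
  have hxU : ∀ t ∈ Icc T0 T, x t ∈ U := fun t ht => hCU t ht (hxC t ht)
  have hyU : ∀ t ∈ Icc T0 T, y t ∈ U := fun t ht => hCU t ht (hyC t ht)
  set η := max K1 K2 with hη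
  have hT0 : T0 ∈ Icc T0 T := ⟨le_rfl, hT.le⟩
  have hη0 : 0 < η := lt_of_lt_of_le (by linarith [hK1 T0 hT0, norm_nonneg (x T0)]) (le_max_left K1 K2)
  have hxη : ∀ t ∈ Icc T0 T, ‖x t‖ ≤ η := fun t ht => by
    linarith [hK1 t ht, le_max_left K1 K2]
  have hyη : ∀ t ∈ Icc T0 T, ‖y t‖ ≤ η := fun t ht => by
    linarith [hK2 t ht, le_max_right K1 K2]
  obtain ⟨L1, hL1i, hL1, hl1⟩ := hF.lip1 η hη0
  obtain ⟨L2, hL2i, hL2, hl2⟩ := hF.lip2 η hη0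
  have hTT : 0 < T - T0 := by linarith
  set ω : ℝ → ℝ := fun t => A * (‖x' t + Fop T0 f1 f2 x t‖ + ‖y' t + Fop T0 f1 f2 y t‖) +
    (L1 t + (T - T0) * L2 t) with hω
  have hωi : IntervalIntegrable ω volume T0 T :=
    (((hx'.add (hF.intF hT hxc hxU)).norm.add (hy'.add (hF.intF hT hyc hyU)).norm).const_mul A).add
      (hL1i.add (hL2i.const_mul _))
  have hLL : ∀ t ∈ Icc T0 T, 0 ≤ L1 t + (T - T0) * L2 t := fun t ht => by
    have := hL1 t ht; have := hL2 t ht; positivity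
  have hω0 : ∀ t ∈ Icc T0 T, 0 ≤ ω t := fun t ht => by
    have := hLL t ht; simp only [hω]; positivity
  have key : ∀ n : ℕ, ∀ t ∈ Icc T0 T, ‖x t - y t‖ ^ 2 ≤
      ((2 * η) ^ 2 / 4 ^ n) * Real.exp (7 * ∫ u in T0..t, ω u) := by
    intro n
    induction n with
    | zero =>
      intro t ht
      have h1 : ‖x t - y t‖ ≤ 2 * η := (norm_sub_le _ _).trans (by linarith [hxη t ht, hyη t ht])
      have h2 : 1 ≤ Real.exp (7 * ∫ u in T0..t, ω u) :=
        Real.one_le_exp (by have := W_nonneg hω0 ht; positivity)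
      have h3 : ‖x t - y t‖ ^ 2 ≤ (2 * η) ^ 2 := by gcongr
      simp only [pow_zero, div_one]
      exact h3.trans (le_mul_of_one_le_right (by positivity) h2)
    | succ n ih =>
      have := contraction hT hC (d := (2 * η) ^ 2 / 4 ^ n) (by positivity) h0 hx' hy' hx hy hxC hyC hωi hω0
        hxn hyn (Filter.Eventually.of_forall fun t ht => by
          have := hLL t ht; simp only [hω]; linarith)
        (hF.step hT hxc hxU hyc hyU hxη hyη hL1 hL2 hl1 hl2 hωi hω0 (fun t ht => by
          simp only [hω]
          have : 0 ≤ A * (‖x' t + Fop T0 f1 f2 x t‖ + ‖y' t + Fop T0 f1 f2 y t‖) := by positivity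
          linarith) (by positivity) ih)
      intro t ht
      have := this t ht
      rwa [div_div, ← pow_succ] at this
  intro t ht
  have hlim : Filter.Tendsto (fun n : ℕ => ((2 * η) ^ 2 / 4 ^ n) * Real.exp (7 * ∫ u in T0..t, ω u))
      Filter.atTop (nhds 0) := by
    have h1 : Filter.Tendsto (fun n : ℕ => (2 * η) ^ 2 / (4 : ℝ) ^ n) Filter.atTop (nhds 0) :=
      tendsto_const_nhds.div_atTop (tendsto_pow_atTop_atTop_of_one_lt (by norm_num))
    simpa using h1.mul_const (Real.exp (7 * ∫ u in T0..t, ω u))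
  have h1 := ge_of_tendsto' hlim fun n => key n t ht
  have h2 : ‖x t - y t‖ = 0 := by
    have := sq_nonneg ‖x t - y t‖
    exact pow_eq_zero_iff (two_ne_zero) |>.1 (le_antisymm h1 this)
  exact sub_eq_zero.1 (norm_eq_zero.1 h2)

theorem sol_exists (hT : T0 < T) {A : ℝ} {C : ℝ → Set H} {υ υ' : ℝ → ℝ}
    (hC : SetHyp T0 T C υ υ' A) (hCU : ∀ t ∈ Icc T0 T, C t ⊆ U)
    (hF : FHyp T0 T U f1 f2 β1 β2) {x0 : H} (hx0 : x0 ∈ C T0) :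
    ∃ x x' : ℝ → H, x T0 = x0 ∧ IntervalIntegrable x' volume T0 T ∧
      (∀ t ∈ Icc T0 T, x t = x T0 + ∫ s in T0..t, x' s) ∧
      (∀ t ∈ Icc T0 T, x t ∈ C t) ∧
      (∀ᵐ t ∂volume, t ∈ Icc T0 T →
        -x' t - Fop T0 f1 f2 x t ∈ proxNormalCone (C t) (x t)) := by
  have hA := hC.hA
  have hTm : T ∈ Icc T0 T := ⟨hT.le, le_rfl⟩
  set B : ℝ → ℝ := fun t => β1 t + ∫ s in T0..t, β2 t s with hB
  have hBi : IntervalIntegrable B volume T0 T := hF.intB hT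
  have hB0 : ∀ t ∈ Icc T0 T, 0 ≤ B t := fun t ht => hF.nnB ht
  set ω0 : ℝ → ℝ := fun t => 3 * |υ' t| + 3 + 4 * B t with hω0
  have hω0i : IntervalIntegrable ω0 volume T0 T :=
    ((hC.int.abs.const_mul 3).add (by simp)).add (hBi.const_mul 4)
  have hω00 : ∀ t ∈ Icc T0 T, 0 ≤ ω0 t := fun t ht => by
    have := hB0 t ht; simp only [hω0]; positivity
  set R := 1 + ‖x0‖ with hR
  have hR1 : 1 ≤ R := by linarith [norm_nonneg x0]
  set E0 : ℝ → ℝ := fun t => R * Real.exp (1 * ∫ u in T0..t, ω0 u) with hE0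
  have hE1 : ∀ t ∈ Icc T0 T, 1 ≤ E0 t := fun t ht => by
    have h1 : 1 ≤ Real.exp (1 * ∫ u in T0..t, ω0 u) :=
      Real.one_le_exp (by have := W_nonneg hω00 ht; positivity)
    simp only [hE0]; nlinarith
  have hEm : ∀ s t, T0 ≤ s → s ≤ t → t ≤ T → E0 s ≤ E0 t := fun s t hs hst ht => by
    have := integral_mono_W hω0i hω00 hs hst ht
    simp only [hE0]; gcongr
  set η := E0 T with hη
  have hη1 : 1 ≤ η := hE1 T hTm
  set X : (ℝ → H) → Prop := fun ξ => ContinuousOn ξ (Icc T0 T) ∧ (∀ t ∈ Icc T0 T, ξ t ∈ C t) ∧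
    ∀ t ∈ Icc T0 T, 1 + ‖ξ t‖ ≤ E0 t with hX
  have hXη : ∀ ξ, X ξ → ∀ t ∈ Icc T0 T, ‖ξ t‖ ≤ η := fun ξ h t ht => by
    have := h.2.2 t ht
    have := hEm t T ht.1 ht.2 le_rfl
    linarith
  have hXU : ∀ ξ, X ξ → ∀ t ∈ Icc T0 T, ξ t ∈ U := fun ξ h t ht => hCU t ht (h.2.1 t ht)
  -- solutions for a forcing term of controlled size
  have base : ∀ h : ℝ → H, IntervalIntegrable h volume T0 T →
      (∀ᵐ t ∂volume, t ∈ Icc T0 T → ‖h t‖ ≤ B t * E0 t) →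
      ∃ x x' : ℝ → H, X x ∧ x T0 = x0 ∧ IntervalIntegrable x' volume T0 T ∧
      (∀ t ∈ Icc T0 T, x t = x T0 + ∫ s in T0..t, x' s) ∧
      (∀ᵐ t ∂volume, t ∈ Icc T0 T → -x' t - h t ∈ proxNormalCone (C t) (x t)) ∧
      (∀ᵐ t ∂volume, t ∈ Icc T0 T → ‖x' t + h t‖ ≤ ω0 t * η) := by
    intro h hh hhb
    obtain ⟨x, x', hx0', hx', hxx, hxC, hae⟩ := forced_exists hT hC hh hx0
    have hb1 : ∀ᵐ t ∂volume, t ∈ Icc T0 T → ‖x' t + h t‖ ≤ ω0 t * E0 t ∧ ‖x' t‖ ≤ ω0 t * E0 t := by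
      filter_upwards [hae, hhb] with t e1 e2 ht
      have e1 := (e1 ht).2
      have e2 := e2 ht
      have e3 := hE1 t ht
      have e4 := hB0 t ht
      have e5 : ‖x' t‖ ≤ ‖x' t + h t‖ + ‖h t‖ := by
        have := norm_sub_le (x' t + h t) (h t)
        rwa [add_sub_cancel_right] at this
      have e6 : 3 * |υ' t| + 3 ≤ (3 * |υ' t| + 3) * E0 t :=
        le_mul_of_one_le_right (by positivity) e3
      have e7 : 0 ≤ B t * E0 t := by positivity
      simp only [hω0]
      constructor <;> nlinarith [norm_nonneg (h t)]
    refine ⟨x, x', ⟨path_continuousOn hT.le hx' hxx, hxC, ?_⟩, hx0', hx', hxx, ?_, ?_⟩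
    · intro t ht
      have hgi : IntervalIntegrable (fun t => ω0 t * E0 t) volume T0 T := by
        refine hω0i.mul_continuousOn ?_
        rw [uIcc_of_le hT.le]
        exact continuousOn_const.mul
          (Real.continuous_exp.comp_continuousOn ((W_continuousOn hT.le hω0i).const_mul 1))
      have h1 := path_dist hx' hgi hxx (by filter_upwards [hb1] with t h ht using (h ht).2) le_rfl ht.1 ht.2
      rw [intervalIntegral.integral_same, sub_zero] at h1
      have h2 : ∫ u in T0..t, ω0 u * E0 u = R * (E0 t / R - 1) := by
        have h3 := integral_exp_W hT.le one_pos hω0i hω00 ht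
        have h4 : ∀ u, ω0 u * E0 u = R * (ω0 u * Real.exp (1 * ∫ v in T0..u, ω0 v)) := by
          intro u; simp only [hE0]; ring
        simp only [h4]
        rw [intervalIntegral.integral_const_mul, h3]
        simp only [hE0]
        field_simp
      rw [h2, mul_sub, mul_div_cancel₀ _ (by positivity)] at h1
      have h5 := norm_add_le (x t - x T0) (x T0)
      rw [sub_add_cancel, hx0'] at h5
      rw [hx0'] at h1
      linarith
    · filter_upwards [hae] with t h ht using (h ht).1
    · filter_upwards [hb1] with t h ht
      exact (h ht).1.trans (mul_le_mul_of_nonneg_left (hEm t T ht.1 ht.2 le_rfl) (hω00 t ht))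
  -- the Picard map
  have pic : ∀ ξ : {ξ : ℝ → H // X ξ}, ∃ (x : {ξ : ℝ → H // X ξ}) (x' : ℝ → H), x.1 T0 = x0 ∧
      IntervalIntegrable x' volume T0 T ∧
      (∀ t ∈ Icc T0 T, x.1 t = x.1 T0 + ∫ s in T0..t, x' s) ∧
      (∀ᵐ t ∂volume, t ∈ Icc T0 T → -x' t - Fop T0 f1 f2 ξ.1 t ∈ proxNormalCone (C t) (x.1 t)) ∧
      (∀ᵐ t ∂volume, t ∈ Icc T0 T → ‖x' t + Fop T0 f1 f2 ξ.1 t‖ ≤ ω0 t * η) := by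
    rintro ⟨ξ, hξ⟩
    obtain ⟨x, x', h1, h2⟩ := base (Fop T0 f1 f2 ξ) (hF.intF hT hξ.1 (hXU ξ hξ)) (by
      filter_upwards [hF.bound hT] with t h ht
      refine h ht ξ (E0 t) (fun s hs => hXU ξ hξ s ⟨hs.1, hs.2.trans ht.2⟩) fun s hs => ?_
      exact (hξ.2.2 s ⟨hs.1, hs.2.trans ht.2⟩).trans (hEm s t hs.1 hs.2 ht.2))
    exact ⟨⟨x, h1⟩, x', h2⟩
  obtain ⟨ξ0, -, hξ0, -⟩ := base (fun _ => 0) (by simp) (Filter.Eventually.of_forall fun t ht => by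
    have := hB0 t ht; have := hE1 t ht; rw [norm_zero]; positivity)
  choose Φ Φ' hΦ0 hΦi hΦx hΦn hΦb using pic
  obtain ⟨L1, hL1i, hL1, hl1⟩ := hF.lip1 η (by linarith)
  obtain ⟨L2, hL2i, hL2, hl2⟩ := hF.lip2 η (by linarith)
  have hTT : 0 < T - T0 := by linarith
  set ω : ℝ → ℝ := fun t => 2 * A * η * ω0 t + (L1 t + (T - T0) * L2 t) with hω
  have hωi : IntervalIntegrable ω volume T0 T :=
    (hω0i.const_mul _).add (hL1i.add (hL2i.const_mul _))
  have hLL : ∀ t ∈ Icc T0 T, 0 ≤ L1 t + (T - T0) * L2 t := fun t ht => by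
    have := hL1 t ht; have := hL2 t ht; positivity
  have hAω : ∀ t ∈ Icc T0 T, 0 ≤ 2 * A * η * ω0 t := fun t ht => by
    have := hω00 t ht; positivity
  have hωnn : ∀ t ∈ Icc T0 T, 0 ≤ ω t := fun t ht => add_nonneg (hAω t ht) (hLL t ht)
  have contr : ∀ (ξ ζ : {ξ : ℝ → H // X ξ}) (d : ℝ), 0 ≤ d →
      (∀ t ∈ Icc T0 T, ‖ξ.1 t - ζ.1 t‖ ^ 2 ≤ d * Real.exp (7 * ∫ u in T0..t, ω u)) →
      ∀ t ∈ Icc T0 T, ‖(Φ ξ).1 t - (Φ ζ).1 t‖ ^ 2 ≤ d / 4 * Real.exp (7 * ∫ u in T0..t, ω u) := by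
    intro ξ ζ d hd hdist
    refine contraction hT hC hd ((hΦ0 ξ).trans (hΦ0 ζ).symm) (hΦi ξ) (hΦi ζ) (hΦx ξ) (hΦx ζ)
      (Φ ξ).2.2.1 (Φ ζ).2.2.1 hωi hωnn (hΦn ξ) (hΦn ζ) ?_ ?_
    · filter_upwards [hΦb ξ, hΦb ζ] with t e1 e2 ht
      have e1 := e1 ht
      have e2 := e2 ht
      have e3 := hLL t ht
      have e4 : A * (‖Φ' ξ t + Fop T0 f1 f2 ξ.1 t‖ + ‖Φ' ζ t + Fop T0 f1 f2 ζ.1 t‖) ≤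
        A * (ω0 t * η + ω0 t * η) := by gcongr
      simp only [hω]
      linarith
    · exact hF.step hT ξ.2.1 (hXU _ ξ.2) ζ.2.1 (hXU _ ζ.2) (hXη _ ξ.2) (hXη _ ζ.2) hL1 hL2 hl1 hl2
        hωi hωnn (fun t ht => by have := hAω t ht; simp only [hω]; linarith) hd hdist
  -- iterate
  set ξ : ℕ → {ξ : ℝ → H // X ξ} := fun n => Φ^[n] ⟨ξ0, hξ0⟩ with hξ
  have hξs : ∀ n, ξ (n + 1) = Φ (ξ n) := fun n => Function.iterate_succ_apply' _ _ _
  have hW1 : ∀ t ∈ Icc T0 T, 1 ≤ Real.exp (7 * ∫ u in T0..t, ω u) := fun t ht =>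
    Real.one_le_exp (by have := W_nonneg hωnn ht; positivity)
  have hit : ∀ n : ℕ, ∀ t ∈ Icc T0 T, ‖(ξ (n + 1)).1 t - (ξ n).1 t‖ ^ 2 ≤
      ((2 * η) ^ 2 / 4 ^ n) * Real.exp (7 * ∫ u in T0..t, ω u) := by
    intro n
    induction n with
    | zero =>
      intro t ht
      have h1 : ‖(ξ (0 + 1)).1 t - (ξ 0).1 t‖ ≤ 2 * η :=
        (norm_sub_le _ _).trans (by linarith [hXη _ (ξ (0 + 1)).2 t ht, hXη _ (ξ 0).2 t ht])
      have h3 : ‖(ξ (0 + 1)).1 t - (ξ 0).1 t‖ ^ 2 ≤ (2 * η) ^ 2 := by gcongr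
      rw [pow_zero, div_one]
      exact h3.trans (le_mul_of_one_le_right (by positivity) (hW1 t ht))
    | succ n ih =>
      intro t ht
      have := contr _ _ _ (by positivity) ih t ht
      rwa [div_div, ← pow_succ, ← hξs, ← hξs] at this
  set K := Real.exp (7 * ∫ u in T0..T, ω u) with hK
  have hK1 : 1 ≤ K := hW1 T hTm
  have hgeo : ∀ t ∈ Icc T0 T, ∀ n, dist ((ξ n).1 t) ((ξ (n + 1)).1 t) ≤ (4 * η * K) / 2 / 2 ^ n := by
    intro t ht n
    rw [dist_eq_norm, norm_sub_rev]
    apply abs_le_of_sq_le_sq' _ (by positivity) |>.2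
    refine (hit n t ht).trans ?_
    have h1 := integral_mono_W hωi hωnn ht.1 ht.2 le_rfl
    have h2 : Real.exp (7 * ∫ u in T0..t, ω u) ≤ K := by rw [hK]; gcongr
    have h3 : K ≤ K ^ 2 := by nlinarith
    have h4 : ((4 * η * K) / 2 / 2 ^ n) ^ 2 = ((2 * η) ^ 2 / 4 ^ n) * K ^ 2 := by
      have : (4 : ℝ) ^ n = (2 ^ n) ^ 2 := by rw [← pow_mul, mul_comm, pow_mul]; norm_num
      rw [this]; field_simp; ring
    rw [h4]
    exact mul_le_mul_of_nonneg_left (h2.trans h3) (by positivity)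
  have : ∀ t, ∃ l, t ∈ Icc T0 T → Filter.Tendsto (fun n => (ξ n).1 t) Filter.atTop (nhds l) := by
    intro t
    by_cases ht : t ∈ Icc T0 T
    · obtain ⟨l, hl⟩ := cauchySeq_tendsto_of_complete (cauchySeq_of_le_geometric_two (hgeo t ht))
      exact ⟨l, fun _ => hl⟩
    · exact ⟨0, fun h => absurd h ht⟩
  choose z hz using this
  have hzd : ∀ t ∈ Icc T0 T, ∀ n, dist ((ξ n).1 t) (z t) ≤ (4 * η * K) / 2 ^ n := fun t ht n =>
    dist_le_of_le_geometric_two_of_tendsto (hgeo t ht) (hz t ht) n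
  have hlim2 : Filter.Tendsto (fun n : ℕ => (4 * η * K) / (2 : ℝ) ^ n) Filter.atTop (nhds 0) :=
    tendsto_const_nhds.div_atTop (tendsto_pow_atTop_atTop_of_one_lt (by norm_num))
  have hzu : TendstoUniformlyOn (fun n t => (ξ n).1 t) z Filter.atTop (Icc T0 T) := by
    rw [Metric.tendstoUniformlyOn_iff]
    intro e he
    filter_upwards [hlim2.eventually (gt_mem_nhds he)] with n hn t ht
    rw [dist_comm]
    exact (hzd t ht n).trans_lt hn
  have hzX : X z := by
    refine ⟨hzu.continuousOn (Filter.Frequently.of_forall fun n => (ξ n).2.1), fun t ht => ?_, fun t ht => ?_⟩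
    · exact (hC.closed t ht).mem_of_tendsto (hz t ht)
        (Filter.Eventually.of_forall fun n => (ξ n).2.2.1 t ht)
    · exact le_of_tendsto' ((hz t ht).norm.const_add 1) fun n => (ξ n).2.2.2 t ht
  have hfix : ∀ t ∈ Icc T0 T, (Φ ⟨z, hzX⟩).1 t = z t := by
    intro t ht
    have h1 : ∀ n, ‖(ξ (n + 1)).1 t - (Φ ⟨z, hzX⟩).1 t‖ ^ 2 ≤
        ((4 * η * K) / 2 ^ n) ^ 2 / 4 * Real.exp (7 * ∫ u in T0..t, ω u) := by
      intro n
      rw [hξs]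
      refine contr (ξ n) ⟨z, hzX⟩ _ (by positivity) (fun s hs => ?_) t ht
      have h2 := hzd s hs n
      rw [dist_eq_norm] at h2
      have h3 : ‖(ξ n).1 s - z s‖ ^ 2 ≤ ((4 * η * K) / 2 ^ n) ^ 2 := by gcongr
      exact h3.trans (le_mul_of_one_le_right (by positivity) (hW1 s hs))
    have h2 : Filter.Tendsto (fun n => ‖(ξ (n + 1)).1 t - (Φ ⟨z, hzX⟩).1 t‖ ^ 2) Filter.atTop
        (nhds (‖z t - (Φ ⟨z, hzX⟩).1 t‖ ^ 2)) :=
      ((((hz t ht).comp (Filter.tendsto_add_atTop_nat 1)).sub_const _).norm.pow 2)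
    have h3 : Filter.Tendsto (fun n : ℕ => ((4 * η * K) / (2 : ℝ) ^ n) ^ 2 / 4 * Real.exp (7 * ∫ u in T0..t, ω u))
        Filter.atTop (nhds 0) := by
      simpa using ((hlim2.pow 2).div_const 4).mul_const (Real.exp (7 * ∫ u in T0..t, ω u))
    have h4 := le_of_tendsto_of_tendsto' h2 h3 h1
    have h5 : ‖z t - (Φ ⟨z, hzX⟩).1 t‖ = 0 :=
      pow_eq_zero_iff (two_ne_zero) |>.1 (le_antisymm h4 (sq_nonneg _))
    exact (sub_eq_zero.1 (norm_eq_zero.1 h5)).symm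
  refine ⟨(Φ ⟨z, hzX⟩).1, Φ' ⟨z, hzX⟩, hΦ0 _, hΦi _, hΦx _, (Φ ⟨z, hzX⟩).2.2.1, ?_⟩
  filter_upwards [hΦn ⟨z, hzX⟩] with t h ht
  have e : Fop T0 f1 f2 (Φ ⟨z, hzX⟩).1 t = Fop T0 f1 f2 z t := by
    unfold Fop
    rw [hfix t ht]
    congr 1
    apply intervalIntegral.integral_congr
    intro s hs
    rw [uIcc_of_le ht.1] at hs
    simp only [hfix s ⟨hs.1, hs.2.trans ht.2⟩]
  rw [e]
  exact h ht
end

/-- Theorem 4.2 (existence and uniqueness for the integro-differential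
sweeping process). -/
theorem integro_differential_sweeping_existence_uniqueness
    (T0 T : ℝ) (hT : T0 < T)
    (r : ℝ≥0∞) (hr : 0 < r)
    (C : ℝ → Set H)
    (hC : ∀ t ∈ Icc T0 T, (C t).Nonempty ∧ IsClosed (C t) ∧ IsProxRegular r (C t))
    (υ υ' : ℝ → ℝ)
    (hυint : IntervalIntegrable υ' volume T0 T)
    (hυAC : ∀ t ∈ Icc T0 T, υ t = υ T0 + ∫ s in T0..t, υ' s)
    (hmove : ∀ s ∈ Icc T0 T, ∀ t ∈ Icc T0 T,
      C t ⊆ C s + |υ s - υ t| • Metric.closedBall (0 : H) 1)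
    (f1 : ℝ → H → H)
    (hf1meas : ∀ x : H, StronglyMeasurable fun t => f1 t x)
    (β1 : ℝ → ℝ)
    (hβ1int : IntervalIntegrable β1 volume T0 T)
    (hβ1nn : ∀ t ∈ Icc T0 T, 0 ≤ β1 t)
    (hf1grow : ∀ t ∈ Icc T0 T, ∀ x ∈ ⋃ s ∈ Icc T0 T, C s, ‖f1 t x‖ ≤ β1 t * (1 + ‖x‖))
    (hf1lip : ∀ η : ℝ, 0 < η → ∃ L1 : ℝ → ℝ, IntervalIntegrable L1 volume T0 T ∧
      (∀ t ∈ Icc T0 T, 0 ≤ L1 t) ∧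
      ∀ t ∈ Icc T0 T, ∀ x ∈ Metric.closedBall (0 : H) η,
        ∀ y ∈ Metric.closedBall (0 : H) η, ‖f1 t x - f1 t y‖ ≤ L1 t * ‖x - y‖)
    (f2 : ℝ → ℝ → H → H)
    (hf2meas : ∀ x : H, StronglyMeasurable fun p : ℝ × ℝ => f2 p.1 p.2 x)
    (β2 : ℝ → ℝ → ℝ)
    (hβ2int : IntegrableOn (fun p : ℝ × ℝ => β2 p.1 p.2)
      {p : ℝ × ℝ | p.1 ∈ Icc T0 T ∧ p.2 ∈ Icc T0 T ∧ p.2 ≤ p.1} volume)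
    (hβ2nn : ∀ t ∈ Icc T0 T, ∀ s ∈ Icc T0 t, 0 ≤ β2 t s)
    (hf2grow : ∀ t ∈ Icc T0 T, ∀ s ∈ Icc T0 t, ∀ x ∈ ⋃ u ∈ Icc T0 T, C u,
      ‖f2 t s x‖ ≤ β2 t s * (1 + ‖x‖))
    (hf2lip : ∀ η : ℝ, 0 < η → ∃ L2 : ℝ → ℝ, IntervalIntegrable L2 volume T0 T ∧
      (∀ t ∈ Icc T0 T, 0 ≤ L2 t) ∧
      ∀ t ∈ Icc T0 T, ∀ s ∈ Icc T0 t, ∀ x ∈ Metric.closedBall (0 : H) η,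
        ∀ y ∈ Metric.closedBall (0 : H) η, ‖f2 t s x - f2 t s y‖ ≤ L2 t * ‖x - y‖)
    (x0 : H) (hx0 : x0 ∈ C T0) :
    (∃ x x' : ℝ → H, x T0 = x0 ∧ IsIDSweepingSol T0 T C f1 f2 x x') ∧
    (∀ x x' y y' : ℝ → H, x T0 = x0 → y T0 = x0 →
      IsIDSweepingSol T0 T C f1 f2 x x' → IsIDSweepingSol T0 T C f1 f2 y y' →
      ∀ t ∈ Icc T0 T, x t = y t) := by
  have hSet : SetHyp T0 T C υ υ' ((2 * r)⁻¹).toReal := by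
    refine ⟨ENNReal.toReal_nonneg, fun t ht => (hC t ht).2.1, ?_, hυint, hυAC, ?_⟩
    · intro t ht x hx v hv y hy
      exact proxReg_ineq (hC t ht).2.2 hx hv hy
    · intro s hs t ht y hy
      obtain ⟨c, hc, w, hw, rfl⟩ := hmove s hs t ht hy
      refine ⟨c, hc, ?_⟩
      obtain ⟨b, hb, rfl⟩ := hw
      rw [mem_closedBall_zero_iff] at hb
      simp only [add_sub_cancel_left]
      rw [norm_smul, Real.norm_eq_abs, abs_abs]
      exact mul_le_of_le_one_right (abs_nonneg _) hb
  have hCU : ∀ t ∈ Icc T0 T, C t ⊆ ⋃ s ∈ Icc T0 T, C s := fun t ht =>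
    subset_biUnion_of_mem (u := fun s => C s) ht
  have hF : FHyp T0 T (⋃ s ∈ Icc T0 T, C s) f1 f2 β1 β2 :=
    ⟨hf1meas, hβ1int, hβ1nn, hf1grow, hf1lip, hf2meas, hβ2int, hβ2nn, hf2grow, hf2lip⟩
  have hsub : ∀ (x x' : ℝ → H) (t : ℝ), -x' t - Fop T0 f1 f2 x t =
      -x' t - f1 t (x t) - ∫ s in T0..t, f2 t s (x s) := by
    intro x x' t; unfold Fop; abel
  constructor
  · obtain ⟨x, x', h0, h1, h2, h3, h4⟩ := sol_exists hT hSet hCU hF hx0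
    refine ⟨x, x', h0, h1, h2, h3, ?_⟩
    filter_upwards [h4] with t h ht
    rw [← hsub]
    exact h ht
  · rintro x x' y y' hx hy ⟨a1, a2, a3, a4⟩ ⟨b1, b2, b3, b4⟩
    refine sol_unique hT hSet hCU hF (hx.trans hy.symm) a1 b1 a2 b2 a3 b3 ?_ ?_
    · filter_upwards [a4] with t h ht
      rw [hsub]
      exact h ht
    · filter_upwards [b4] with t h ht
      rw [hsub]
      exact h ht
end
end
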